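/- arXiv:1004.2259 — 2 statements merged into one kernel-verified Lean document; each statement's English description precedes it below -/
import Mathlib

section
/- Let n ≥ 1, let 1 < p < 2 with p' = p/(p−1), and set α = n(1/p − 1/2). For f in the Schwartz class 𝒮(ℝ^n), let u be the continuous function with Fourier transform û(ξ) = |ξ|^α f̂(ξ), i.e. u(x) = ∫_{ℝ^n} e^{−2πi x·ξ} |ξ|^α f̂(ξ) dξ (this is the function (−Δ/4π²)^{α/2} f). Then ∫_{ℝ^n} |f(x)|² dx ≤ C_p · (∫_{ℝ^n} |u(x)|^p dx)^{2/p}, where C_p = π^{n/p − n/2} · [Γ(n/p')/Γ(n/p)] · [Γ(n)/Γ(n/2)]^{2/p − 1}. -/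
open MeasureTheory Real
open scoped ENNReal InnerProductSpace

noncomputable section

/-- The Fourier transform with kernel `e^{2πi x·ξ}` on `ℝ^n`. -/
def fourierPlus {n : ℕ} (g : EuclideanSpace ℝ (Fin n) → ℂ)
    (ξ : EuclideanSpace ℝ (Fin n)) : ℂ :=
  ∫ x, Complex.exp (2 * Real.pi * Complex.I * (⟪x, ξ⟫_ℝ : ℂ)) * g x

/-- The coefficients of the binomial series of `(1 - x) ^ (-q)`. -/
def negBinom (q : ℝ) (k : ℕ) : ℝ := (∏ i ∈ Finset.range k, (q + i)) / k.factorial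

theorem negBinom_pos {q : ℝ} (hq : 0 < q) (k : ℕ) : 0 < negBinom q k := by
  unfold negBinom
  have : 0 < ∏ i ∈ Finset.range k, (q + i) := Finset.prod_pos fun i _ => by positivity
  positivity

theorem succ_mul_negBinom_succ (q : ℝ) (k : ℕ) :
    (k + 1) * negBinom q (k + 1) = (q + k) * negBinom q k := by
  unfold negBinom
  rw [Finset.prod_range_succ, Nat.factorial_succ]
  have : (k.factorial : ℝ) ≠ 0 := by positivity
  push_cast
  field_simp

theorem succ_mul_negBinom_succ' (q : ℝ) (k : ℕ) :
    (k + 1) * negBinom q (k + 1) = q * negBinom (q + 1) k := by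
  unfold negBinom
  rw [Finset.prod_range_succ', Nat.factorial_succ]
  have : (k.factorial : ℝ) ≠ 0 := by positivity
  have h2 : ∏ i ∈ Finset.range k, (q + ((i + 1 : ℕ) : ℝ)) = ∏ i ∈ Finset.range k, (q + 1 + i) :=
    Finset.prod_congr rfl fun i _ => by push_cast; ring
  rw [h2]
  push_cast
  field_simp
  simp [mul_comm]

theorem negBinom_eq_choose (q : ℝ) (k : ℕ) : negBinom q k = Ring.choose (q + k - 1) k := by
  have h : q + k - 1 - k + 1 = q := by ring
  have h2 : (ascPochhammer ℝ k).eval q = ∏ i ∈ Finset.range k, (q + i) := by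
    induction k with
    | zero => simp
    | succ k ih => rw [ascPochhammer_succ_eval, Finset.prod_range_succ, ih (by ring)]
  rw [Ring.choose_eq_smul, negBinom, Polynomial.descPochhammer_smeval_eq_ascPochhammer, h,
    Polynomial.ascPochhammer_smeval_eq_eval, h2, smul_eq_mul, div_eq_inv_mul]

theorem hasSum_negBinom (q : ℝ) {x : ℝ} (hx : |x| < 1) :
    HasSum (fun k => negBinom q k * x ^ k) ((1 - x) ^ (-q)) := by
  have h := (Real.one_div_one_sub_rpow_hasFPowerSeriesOnBall_zero q).hasSum
    (y := x) (by simpa [enorm_eq_nnnorm, ← NNReal.coe_lt_coe] using hx)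
  have hx1 : 0 ≤ 1 - x := by linarith [le_abs_self x]
  simp only [zero_add, one_div] at h
  rw [Real.rpow_neg hx1]
  simpa [negBinom_eq_choose, FormalMultilinearSeries.ofScalars] using h

theorem hasSum_mul_negBinom (q : ℝ) {x : ℝ} (hx : |x| < 1) :
    HasSum (fun k : ℕ => k * negBinom q k * x ^ k) (q * x * (1 - x) ^ (-(q + 1))) := by
  rw [← hasSum_nat_add_iff' 1]
  simp only [Finset.sum_range_one, Nat.cast_zero, zero_mul, sub_zero]
  refine ((hasSum_negBinom (q + 1) hx).mul_left (q * x)).congr_fun fun k => ?_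
  push_cast
  rw [succ_mul_negBinom_succ']
  ring

theorem negBinom_coeff_lower_bound {n q : ℝ} (hq : 0 < q) (hqn : 2 * q < n) :
    ∃ k₀ : ℕ, ∀ j : ℕ, k₀ ≤ j → (n - 2 * q) / 2 * negBinom q (j + 1) ≤
      (j + n) * negBinom q j - (j + 2) * negBinom q (j + 2) := by
  obtain ⟨k₀, hk₀⟩ := exists_nat_ge (2 * (q * q + n * q) / (n - 2 * q))
  refine ⟨k₀, fun j hj => ?_⟩
  have hpos := negBinom_pos hq j
  have h1 := succ_mul_negBinom_succ q j
  have h2 := succ_mul_negBinom_succ q (j + 1)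
  push_cast at h2
  have h3 : (j + 2 : ℝ) * negBinom q (j + 2) = (q + (j + 1)) * negBinom q (j + 1) := by
    rw [← h2]; ring
  have hA : negBinom q (j + 1) = (q + j) * negBinom q j / (j + 1) := by
    rw [← h1]; field_simp
  have hn : 0 < n - 2 * q := by linarith
  have hjk : 2 * (q * q + n * q) / (n - 2 * q) ≤ j := hk₀.trans (by exact_mod_cast hj)
  rw [div_le_iff₀ hn] at hjk
  rw [h3, hA]
  have key : ((n - 2 * q) / 2 + q + (j + 1)) * (q + j) ≤ (j + n) * (j + 1) := by nlinarith
  have : ((n - 2 * q) / 2 + q + (j + 1)) * ((q + j) * negBinom q j / (j + 1)) ≤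
      (j + n) * negBinom q j := by
    rw [← mul_div_assoc, div_le_iff₀ (by positivity)]
    nlinarith [mul_le_mul_of_nonneg_right key hpos.le]
  linarith

/-- Solving the two-step recursion `(j + n) N_{j+1} = j N_{j-1} + d_j` bounds each `N_k` by a
fixed multiple of the binomially weighted sum of the `d_j`. -/
theorem exists_bound_of_recursion {n q : ℝ} (hn : 0 < n) (hq : 0 < q) (k : ℕ) :
    ∃ D : ℝ, 0 ≤ D ∧ ∀ (N d : ℕ → ℝ) (r F : ℝ), N 0 = 0 → (∀ j, 0 ≤ d j) →
      (∀ j : ℕ, (j + n) * N (j + 1) = j * N (j - 1) + d j) → 1 / 2 ≤ r → r < 1 →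
      HasSum (fun j => negBinom q j * r ^ (j + 1) * d j) F → N k ≤ D * F := by
  induction k using Nat.strong_induction_on with
  | _ k ih =>
    rcases k with _ | j
    · exact ⟨0, le_rfl, fun N d r F h0 _ _ _ _ _ => by simp [h0]⟩
    · obtain ⟨D, hD, hb⟩ := ih (j - 1) (by omega)
      have hA := negBinom_pos hq j
      refine ⟨(j * D + 2 ^ (j + 1) / negBinom q j) / (j + n), by positivity, ?_⟩
      intro N d r F h0 hd hrec hr hr1 hF
      have hr0 : 0 < r := by linarith
      have h1 := hb N d r F h0 hd hrec hr hr1 hF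
      have h2 : negBinom q j * r ^ (j + 1) * d j ≤ F :=
        le_hasSum hF j fun i _ => by have := negBinom_pos hq i; have := hd i; positivity
      have hr2 : (1 : ℝ) ≤ 2 ^ (j + 1) * r ^ (j + 1) := by
        rw [← mul_pow]; exact one_le_pow₀ (by linarith)
      have h3 : d j ≤ 2 ^ (j + 1) / negBinom q j * F := by
        have hF0 : 0 ≤ F := le_trans (by have := hd j; positivity) h2
        rw [div_mul_eq_mul_div, le_div_iff₀ hA]
        calc d j * negBinom q j ≤ (2 ^ (j + 1) * r ^ (j + 1)) * (d j * negBinom q j) :=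
              le_mul_of_one_le_left (mul_nonneg (hd j) hA.le) hr2
          _ = 2 ^ (j + 1) * (negBinom q j * r ^ (j + 1) * d j) := by ring
          _ ≤ _ := by gcongr
      rw [div_mul_eq_mul_div, le_div_iff₀ (by positivity), mul_comm, hrec j]
      have : (j : ℝ) * N (j - 1) ≤ j * (D * F) := by gcongr
      linarith

/-- Comparison of the two binomially weighted series attached to the recursion
`(j + n) N_{j+1} = j N_{j-1} + d_j`. -/
theorem exists_tsum_comparison {n q : ℝ} (hq : 0 < q) (hqn : 2 * q < n) :
    ∃ C : ℝ, 0 < C ∧ ∀ (N d : ℕ → ℝ) (B r F G : ℝ), N 0 = 0 → (∀ k, 0 ≤ N k) → (∀ k, N k ≤ B) →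
      (∀ j, 0 ≤ d j) → (∀ j : ℕ, (j + n) * N (j + 1) = j * N (j - 1) + d j) →
      1 / 2 ≤ r → r < 1 →
      HasSum (fun j => negBinom q j * r ^ (j + 1) * d j) F →
      HasSum (fun k => negBinom q k * r ^ k * N k) G → G ≤ C * F := by
  have hn : 0 < n := by linarith
  obtain ⟨k₀, hk₀⟩ := negBinom_coeff_lower_bound hq hqn
  choose D hD hDb using fun k => exists_bound_of_recursion (n := n) hn hq k
  set c := (n - 2 * q) / 2 with hc
  have hc0 : 0 < c := by rw [hc]; linarith
  let K : ℕ → ℝ := fun j => c * negBinom q (j + 1) + (j + 2) * negBinom q (j + 2)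
  have hK : ∀ j, 0 ≤ K j := fun j => by
    have := negBinom_pos hq (j + 1); have := negBinom_pos hq (j + 2); positivity
  refine ⟨(1 + ∑ j ∈ Finset.range k₀, K j * D (j + 1)) / c, ?_, ?_⟩
  · have : 0 ≤ ∑ j ∈ Finset.range k₀, K j * D (j + 1) :=
      Finset.sum_nonneg fun j _ => mul_nonneg (hK j) (hD _)
    positivity
  intro N d B r F G h0 hN hNB hd hrec hr hr1 hF hG
  have hr0 : 0 < r := by linarith
  have habs : |r| < 1 := by rwa [abs_of_pos hr0]
  have hs0 : Summable fun k => negBinom q k * r ^ k := (hasSum_negBinom q habs).summable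
  have hs1 : Summable fun k : ℕ => k * negBinom q k * r ^ k :=
    (hasSum_mul_negBinom q habs).summable
  have hx : Summable fun j : ℕ => negBinom q j * r ^ (j + 1) * ((j + n) * N (j + 1)) := by
    refine Summable.of_nonneg_of_le (fun j => ?_) (fun j => ?_)
      (((hs1.add (hs0.mul_left n)).mul_left (r * B)))
    · have := negBinom_pos hq j; have := hN (j + 1); positivity
    · have := negBinom_pos hq j
      calc _ ≤ negBinom q j * r ^ (j + 1) * ((j + n) * B) := by gcongr; exact hNB _
        _ = _ := by ring
  have hy : HasSum (fun j : ℕ => negBinom q j * r ^ (j + 1) * (j * N (j - 1)))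
      ((∑' j : ℕ, negBinom q j * r ^ (j + 1) * ((j + n) * N (j + 1))) - F) := by
    refine (hx.hasSum.sub hF).congr_fun fun j => ?_
    rw [hrec j]; ring
  rw [← hasSum_nat_add_iff' 2] at hy
  have hG' := hG
  rw [← hasSum_nat_add_iff' 1] at hG'
  have hz := hx.hasSum.sub hy
  simp only [Finset.sum_range_succ, Finset.sum_range_zero, h0] at hz hG'
  simp only [mul_zero, CharP.cast_eq_zero, add_zero, sub_zero,
    sub_sub_cancel] at hz hG'
  have hfin : HasSum (fun j => if j ∈ Finset.range k₀ then K j * (D (j + 1) * F) else 0)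
      (∑ j ∈ Finset.range k₀, K j * (D (j + 1) * F)) := by
    rw [← Finset.sum_congr rfl fun j hj => if_pos hj]
    exact hasSum_sum_of_ne_finset_zero fun j hj => if_neg hj
  have hle := hasSum_le (fun j => ?_) (hG'.mul_left c) (hz.add hfin)
  · rw [div_mul_eq_mul_div, le_div_iff₀ hc0, mul_comm]
    refine hle.trans_eq ?_
    rw [add_mul, one_mul, Finset.sum_mul]
    congr 1
    exact Finset.sum_congr rfl fun j _ => by ring
  · have hA1 := negBinom_pos hq (j + 1)
    have hA2 := negBinom_pos hq (j + 2)
    have hA := negBinom_pos hq j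
    have hNj := hN (j + 1)
    have hpow : r ^ (j + 2 + 1) ≤ r ^ (j + 1) := pow_le_pow_of_le_one hr0.le hr1.le (by omega)
    have hpow1 : r ^ (j + 1) ≤ 1 := pow_le_one₀ hr0.le hr1.le
    have e1 : j + 2 - 1 = j + 1 := by omega
    rw [e1]
    push_cast
    have hstep : negBinom q (j + 2) * r ^ (j + 2 + 1) * ((j + 2) * N (j + 1)) ≤
        negBinom q (j + 2) * r ^ (j + 1) * ((j + 2) * N (j + 1)) := by gcongr
    by_cases hj : j ∈ Finset.range k₀
    · rw [if_pos hj]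
      have h1 : 0 ≤ negBinom q j * r ^ (j + 1) * ((j + n) * N (j + 1)) := by positivity
      have h2 : N (j + 1) ≤ D (j + 1) * F := hDb (j + 1) N d r F h0 hd hrec hr hr1 hF
      have h3 : K j * r ^ (j + 1) * N (j + 1) ≤ K j * (D (j + 1) * F) :=
        calc K j * r ^ (j + 1) * N (j + 1) ≤ K j * 1 * N (j + 1) := by gcongr
          _ = K j * N (j + 1) := by ring
          _ ≤ _ := by gcongr
      simp only [K] at h3 ⊢
      nlinarith
    · rw [if_neg hj]
      have h4 := mul_le_mul_of_nonneg_right (hk₀ j (by simpa using hj))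
        (mul_nonneg (pow_nonneg hr0.le (j + 1)) hNj)
      nlinarith

section PolynomialKernels

variable {ι : Type*} [Fintype ι]

/-- The derivative of the `k`-th tensor power at `a` in the direction `v`, in coordinates. -/
def tensorDeriv (k : ℕ) (a v : ι → ℝ) (β : Fin k → ι) : ℝ :=
  ∑ m, ∏ r, (if r = m then v else a) (β r)

theorem sum_tensorDeriv_mul (j : ℕ) (a v b w : ι → ℝ) :
    ∑ β : Fin (j + 1) → ι, tensorDeriv (j + 1) a v β * tensorDeriv (j + 1) b w β =
      (j + 1) * (∑ i, a i * b i) ^ j * (∑ i, v i * w i) +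
      (j + 1) * j * (∑ i, a i * b i) ^ (j - 1) * ((∑ i, v i * b i) * (∑ i, a i * w i)) := by
  have h1 : ∀ m m' : Fin (j + 1),
      ∑ β : Fin (j + 1) → ι, (∏ r, (if r = m then v else a) (β r)) *
        (∏ r, (if r = m' then w else b) (β r)) =
      ∏ r, ∑ i, (if r = m then v else a) i * (if r = m' then w else b) i := by
    intro m m'
    rw [Finset.prod_univ_sum, Fintype.piFinset_univ]
    exact Finset.sum_congr rfl fun β _ => Finset.prod_mul_distrib.symm
  have h2 : ∀ m m' : Fin (j + 1),
      ∏ r, ∑ i, (if r = m then v else a) i * (if r = m' then w else b) i =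
      if m' = m then (∑ i, a i * b i) ^ j * (∑ i, v i * w i) else
        (∑ i, a i * b i) ^ (j - 1) * ((∑ i, v i * b i) * (∑ i, a i * w i)) := by
    intro m m'
    rw [← Finset.mul_prod_erase _ _ (Finset.mem_univ m)]
    by_cases h : m' = m
    · subst h
      rw [if_pos rfl, Finset.prod_congr rfl (g := fun _ => ∑ i, a i * b i)
        (fun r hr => by simp [Finset.ne_of_mem_erase hr])]
      simp [mul_comm]
    · rw [if_neg h, ← Finset.mul_prod_erase _ _ (Finset.mem_erase.2 ⟨h, Finset.mem_univ m'⟩),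
        Finset.prod_congr rfl (g := fun _ => ∑ i, a i * b i) (fun r hr => by
          have hr' := Finset.mem_erase.1 hr
          simp [hr'.1, Finset.ne_of_mem_erase hr'.2])]
      have hc : (((Finset.univ : Finset (Fin (j + 1))).erase m).erase m').card = j - 1 := by
        rw [Finset.card_erase_of_mem (Finset.mem_erase.2 ⟨h, Finset.mem_univ m'⟩),
          Finset.card_erase_of_mem (Finset.mem_univ m)]
        simp
      rw [Finset.prod_const, hc]
      simp only [if_true, if_neg h, if_neg (Ne.symm h)]
      ring
  generalize (∑ i, v i * b i) * (∑ i, a i * w i) = y at h2 ⊢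
  simp only [tensorDeriv, Finset.sum_mul_sum]
  rw [Finset.sum_comm]
  simp_rw [Finset.sum_comm (s := (Finset.univ : Finset (Fin (j + 1) → ι))), h1, h2]
  have h3 : ∀ m : Fin (j + 1), ∀ x y : ℝ,
      ∑ m' : Fin (j + 1), (if m' = m then x else y) = x + j * y := by
    intro m x y
    rw [← Finset.add_sum_erase _ _ (Finset.mem_univ m), if_pos rfl,
      Finset.sum_congr rfl (g := fun _ => y) (fun r hr => if_neg (Finset.ne_of_mem_erase hr))]
    simp [Finset.card_erase_of_mem]
  simp_rw [h3]
  simp only [Finset.sum_const, Finset.card_univ, Fintype.card_fin, nsmul_eq_mul]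
  push_cast
  ring

variable [DecidableEq ι]

/-- The infinitesimal rotation in a coordinate plane. -/
def rotGen (i i' : ι) (a : ι → ℝ) (l : ι) : ℝ :=
  (if l = i' then a i else 0) - (if l = i then a i' else 0)

theorem rotGen_dot (i i' : ι) (a b : ι → ℝ) :
    ∑ l, rotGen i i' a l * b l = a i * b i' - a i' * b i := by
  simp [rotGen, sub_mul, Finset.sum_sub_distrib]

theorem rotGen_dot_rotGen (i i' : ι) (a b : ι → ℝ) :
    ∑ l, rotGen i i' a l * rotGen i i' b l =
      a i * b i + a i' * b i' - (if i = i' then a i * b i' + a i' * b i else 0) := by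
  rw [rotGen_dot]
  by_cases h : i = i'
  · subst h; simp [rotGen]
  · simp [rotGen, h, Ne.symm h]

/-- The kernel `(n + j) s ^ (j + 1) - j s ^ (j - 1)`, with `s` the inner product of two unit
vectors in `ℝ ^ (n + 1)`, is a sum of squares. -/
theorem sum_rotGen_tensorDeriv {n : ℕ} (hι : Fintype.card ι = n + 1) (j : ℕ) (a b : ι → ℝ)
    (ha : ∑ i, a i ^ 2 = 1) (hb : ∑ i, b i ^ 2 = 1) :
    ∑ t : (ι × ι) × (Fin (j + 1) → ι),
      tensorDeriv (j + 1) a (rotGen t.1.1 t.1.2 a) t.2 *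
        tensorDeriv (j + 1) b (rotGen t.1.1 t.1.2 b) t.2 =
      2 * (j + 1) * ((j + n) * (∑ i, a i * b i) ^ (j + 1) - j * (∑ i, a i * b i) ^ (j - 1)) := by
  rw [Fintype.sum_prod_type]
  simp_rw [sum_tensorDeriv_mul, rotGen_dot_rotGen]
  have h1 : ∀ i i' : ι, ∑ l, a l * rotGen i i' b l = b i * a i' - b i' * a i := fun i i' => by
    rw [← rotGen_dot]; exact Finset.sum_congr rfl fun _ _ => mul_comm _ _
  simp_rw [rotGen_dot, h1, Finset.sum_add_distrib, ← Finset.mul_sum]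
  set s := ∑ i, a i * b i with hs
  have e1 : ∑ p : ι × ι, (a p.1 * b p.1 + a p.2 * b p.2 -
      (if p.1 = p.2 then a p.1 * b p.2 + a p.2 * b p.1 else 0)) = 2 * n * s := by
    rw [Fintype.sum_prod_type]
    simp only [Finset.sum_sub_distrib, Finset.sum_add_distrib, Finset.sum_const, Finset.card_univ,
      hι, nsmul_eq_mul, Finset.sum_ite_eq, Finset.mem_univ, if_true, ← Finset.mul_sum, ← hs]
    have : ∑ x, b x * a x = s := Finset.sum_congr rfl fun _ _ => mul_comm _ _
    push_cast
    linarith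
  have e2 : ∑ p : ι × ι, (a p.1 * b p.2 - a p.2 * b p.1) * (b p.1 * a p.2 - b p.2 * a p.1) =
      2 * s ^ 2 - 2 := by
    have e3 : ∑ p : ι × ι, (a p.1 * b p.2 - a p.2 * b p.1) * (b p.1 * a p.2 - b p.2 * a p.1) =
        ∑ p : ι × ι, ((a p.1 * b p.1) * (a p.2 * b p.2) * 2 - a p.1 ^ 2 * b p.2 ^ 2
          - b p.1 ^ 2 * a p.2 ^ 2) := Finset.sum_congr rfl fun _ _ => by ring
    rw [e3, Fintype.sum_prod_type]
    simp only [Finset.sum_sub_distrib, ← Finset.sum_mul, ← Finset.mul_sum, ha, hb, ← hs]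
    ring
  rw [e1, e2]
  rcases j with _ | j
  · simp; ring
  · simp; ring

end PolynomialKernels

theorem abs_tensorDeriv_le {ι : Type*} {k : ℕ} {a v : ι → ℝ} {R : ℝ} (ha : ∀ i, |a i| ≤ R)
    (hv : ∀ i, |v i| ≤ R) (β : Fin k → ι) : |tensorDeriv k a v β| ≤ k * R ^ k := by
  unfold tensorDeriv
  refine (Finset.abs_sum_le_sum_abs _ _).trans ?_
  have : ∀ m : Fin k, |∏ r, (if r = m then v else a) (β r)| ≤ R ^ k := fun m => by
    rw [Finset.abs_prod]
    refine (Finset.prod_le_prod (fun _ _ => abs_nonneg _) (g := fun _ => R) fun r _ => ?_).trans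
      (by simp)
    split_ifs
    exacts [hv _, ha _]
  exact (Finset.sum_le_sum fun m _ => this m).trans (by simp)

theorem abs_rotGen_le {ι : Type*} [DecidableEq ι] {a : ι → ℝ} (ha : ∀ i, |a i| ≤ 1)
    (i i' l : ι) : |rotGen i i' a l| ≤ 2 := by
  unfold rotGen
  have h : ∀ (p : Prop) [Decidable p] (m : ι), |if p then a m else 0| ≤ 1 := fun p _ m => by
    split_ifs
    · exact ha m
    · simp
  have h1 := h (l = i') i
  have h2 := h (l = i) i'
  exact (abs_sub _ _).trans (by linarith)

theorem abs_le_one_of_sum_sq {ι : Type*} [Fintype ι] {a : ι → ℝ} (ha : ∑ i, a i ^ 2 = 1) (i : ι) :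
    |a i| ≤ 1 := by
  rw [← sq_le_one_iff_abs_le_one, ← ha]
  exact Finset.single_le_sum (f := fun i => a i ^ 2) (fun _ _ => sq_nonneg _) (Finset.mem_univ i)

theorem abs_dot_le_one {ι : Type*} [Fintype ι] {a b : ι → ℝ} (ha : ∑ i, a i ^ 2 = 1)
    (hb : ∑ i, b i ^ 2 = 1) : |∑ i, a i * b i| ≤ 1 := by
  rw [← sq_le_one_iff_abs_le_one]
  simpa [ha, hb] using Finset.sum_mul_sq_le_sq_mul_sq Finset.univ a b

section FormInequality

variable {X : Type*} [MeasurableSpace X]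

theorem integrable_mul_of_bounded {ν : Measure X} [IsFiniteMeasure ν] {f g : X → ℝ} {A B : ℝ}
    (hf : Measurable f) (hg : Measurable g) (hfb : ∀ x, |f x| ≤ A) (hgb : ∀ x, |g x| ≤ B) :
    Integrable (fun x => f x * g x) ν := by
  refine Integrable.of_bound (hf.mul hg).aestronglyMeasurable (A * B) (ae_of_all _ fun x => ?_)
  rw [norm_mul]
  exact mul_le_mul (hfb x) (hgb x) (abs_nonneg _) ((abs_nonneg _).trans (hfb x))

theorem integral_sum_squares_nonneg {ν : Measure X} [IsFiniteMeasure ν] {τ : Type*} [Fintype τ]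
    {h : X → ℝ} (hh : Measurable h) {A B : ℝ} (hA : ∀ x, |h x| ≤ A) {φ : τ → X → ℝ}
    (hφ : ∀ t, Measurable (φ t)) (hB : ∀ t x, |φ t x| ≤ B) :
    0 ≤ ∫ z, h z.1 * h z.2 * ∑ t, φ t z.1 * φ t z.2 ∂(ν.prod ν) := by
  have e : ∀ z : X × X, h z.1 * h z.2 * ∑ t, φ t z.1 * φ t z.2 =
      ∑ t, (h z.1 * φ t z.1) * (h z.2 * φ t z.2) := fun z => by
    rw [Finset.mul_sum]
    exact Finset.sum_congr rfl fun _ _ => by ring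
  simp_rw [e]
  rw [integral_finsetSum]
  · refine Finset.sum_nonneg fun t _ => ?_
    rw [integral_prod_mul (fun x => h x * φ t x) (fun x => h x * φ t x)]
    exact mul_self_nonneg _
  · intro t _
    exact (integrable_mul_of_bounded hh (hφ t) hA (hB t)).mul_prod
      (integrable_mul_of_bounded hh (hφ t) hA (hB t))

theorem hasSum_shifted_negBinom (n q : ℝ) {r s : ℝ} (hx : |r * s| < 1) :
    HasSum (fun j : ℕ => negBinom q j * r ^ (j + 1) * ((j + n) * s ^ (j + 1) - j * s ^ (j - 1)))
      (n * r * s * (1 - r * s) ^ (-q) -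
        q * r ^ 2 * (1 - s ^ 2) * (1 - r * s) ^ (-(q + 1))) := by
  have h1 : HasSum (fun j : ℕ => negBinom q j * r ^ (j + 1) * (n * s ^ (j + 1)))
      (n * r * s * (1 - r * s) ^ (-q)) := by
    refine ((hasSum_negBinom q hx).mul_left (n * r * s)).congr_fun fun k => ?_
    rw [mul_pow]; ring
  have h2 : HasSum (fun j : ℕ => negBinom q j * r ^ (j + 1) * (j * (s ^ (j + 1) - s ^ (j - 1))))
      (-(q * r ^ 2 * (1 - s ^ 2)) * (1 - r * s) ^ (-(q + 1))) := by
    rw [← hasSum_nat_add_iff' 1]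
    simp only [Finset.sum_range_one, Nat.cast_zero, zero_mul, sub_zero, mul_zero]
    refine ((hasSum_negBinom (q + 1) hx).mul_left (-(q * r ^ 2 * (1 - s ^ 2)))).congr_fun
      fun k => ?_
    have e := succ_mul_negBinom_succ' q k
    simp only [Nat.add_sub_cancel, mul_pow]
    push_cast
    linear_combination (r ^ (k + 2) * (s ^ (k + 2) - s ^ k)) * e
  rw [sub_eq_add_neg, ← neg_mul]
  exact (h1.add h2).congr_fun fun k => by ring

theorem half_one_sub_le {r s : ℝ} (h0 : 0 ≤ r) (h1 : r ≤ 1) (hs : |s| ≤ 1) :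
    (1 - s) / 2 ≤ 1 - r * s := by
  obtain ⟨ha, hb⟩ := abs_le.1 hs
  rcases le_total 0 s with h | h <;> nlinarith

theorem hasSum_integral_mul_pow {P : Measure X} {H s : X → ℝ} (hH : Integrable H P)
    (hs : Measurable s) (hs1 : ∀ z, |s z| ≤ 1) {q : ℝ} (hq : 0 < q) {r : ℝ} (h0 : 0 ≤ r)
    (h1 : r < 1) :
    HasSum (fun k => negBinom q k * r ^ k * ∫ z, H z * s z ^ k ∂P)
      (∫ z, H z * (1 - r * s z) ^ (-q) ∂P) := by
  have hr : |r| < 1 := by rwa [abs_of_nonneg h0]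
  have key := hasSum_integral_of_dominated_convergence (μ := P)
    (F := fun k z => negBinom q k * r ^ k * (H z * s z ^ k))
    (f := fun z => H z * (1 - r * s z) ^ (-q))
    (fun k z => negBinom q k * r ^ k * |H z|)
    (fun k => ((hH.1.mul (hs.pow_const k).aestronglyMeasurable).const_mul _))
    (fun k => ae_of_all _ fun z => ?_)
    (ae_of_all _ fun z => ((hasSum_negBinom q hr).mul_right |H z|).summable) ?_
    (ae_of_all _ fun z => ?_)
  · simpa only [integral_const_mul] using key
  · have hA := (negBinom_pos hq k).le
    rw [norm_mul, norm_mul (H z), norm_pow, Real.norm_of_nonneg (by positivity)]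
    have h2 : ‖s z‖ ^ k ≤ 1 := pow_le_one₀ (norm_nonneg _) (hs1 z)
    have : ‖H z‖ * ‖s z‖ ^ k ≤ |H z| := mul_le_of_le_one_right (norm_nonneg _) h2
    gcongr
  · simp_rw [tsum_mul_right]
    exact hH.abs.const_mul _
  · have hx : |r * s z| < 1 := by
      rw [abs_mul, abs_of_nonneg h0]
      exact lt_of_le_of_lt (mul_le_of_le_one_right h0 (hs1 z)) h1
    refine ((hasSum_negBinom q hx).mul_left (H z)).congr_fun fun k => ?_
    rw [mul_pow]; ring

theorem hasSum_integral_mul_shifted {P : Measure X} {H s : X → ℝ} (hH : Integrable H P)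
    (hs : Measurable s) (hs1 : ∀ z, |s z| ≤ 1) {n q : ℝ} (hn : 0 ≤ n) (hq : 0 < q) {r : ℝ}
    (h0 : 0 ≤ r) (h1 : r < 1) :
    HasSum (fun j : ℕ => negBinom q j * r ^ (j + 1) *
        ∫ z, H z * ((j + n) * s z ^ (j + 1) - j * s z ^ (j - 1)) ∂P)
      (∫ z, H z * (n * r * s z * (1 - r * s z) ^ (-q) -
        q * r ^ 2 * (1 - s z ^ 2) * (1 - r * s z) ^ (-(q + 1))) ∂P) := by
  have hr : |r| < 1 := by rwa [abs_of_nonneg h0]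
  have hsum : Summable fun j : ℕ => negBinom q j * r ^ (j + 1) * (2 * j + n) := by
    refine Summable.congr (((hasSum_mul_negBinom q hr).summable.mul_left (2 * r)).add
      ((hasSum_negBinom q hr).summable.mul_left (n * r))) fun j => ?_
    ring
  have key := hasSum_integral_of_dominated_convergence (μ := P)
    (F := fun (j : ℕ) z => negBinom q j * r ^ (j + 1) *
      (H z * ((j + n) * s z ^ (j + 1) - j * s z ^ (j - 1))))
    (f := fun z => H z * (n * r * s z * (1 - r * s z) ^ (-q) -
        q * r ^ 2 * (1 - s z ^ 2) * (1 - r * s z) ^ (-(q + 1))))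
    (fun j z => negBinom q j * r ^ (j + 1) * (2 * j + n) * |H z|)
    (fun j => (hH.1.mul (Measurable.aestronglyMeasurable (by fun_prop))).const_mul _)
    (fun j => ae_of_all _ fun z => ?_)
    (ae_of_all _ fun z => hsum.mul_right |H z|) ?_
    (ae_of_all _ fun z => ?_)
  · simpa only [integral_const_mul] using key
  · have hA := (negBinom_pos hq j).le
    rw [norm_mul, norm_mul (H z), Real.norm_of_nonneg (by positivity), mul_assoc _ (2 * (j : ℝ) + n),
      mul_comm (2 * (j : ℝ) + n)]
    have h2 : ∀ k : ℕ, |s z ^ k| ≤ 1 := fun k => by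
      rw [abs_pow]; exact pow_le_one₀ (abs_nonneg _) (hs1 z)
    have h3 : ‖(j + n) * s z ^ (j + 1) - j * s z ^ (j - 1)‖ ≤ 2 * j + n := by
      refine (norm_sub_le _ _).trans ?_
      rw [norm_mul, norm_mul, Real.norm_of_nonneg (by positivity : 0 ≤ j + n),
        Real.norm_of_nonneg (by positivity : (0 : ℝ) ≤ j)]
      have e1 : (j + n) * ‖s z ^ (j + 1)‖ ≤ j + n :=
        mul_le_of_le_one_right (by positivity) (h2 _)
      have e2 : (j : ℝ) * ‖s z ^ (j - 1)‖ ≤ j := mul_le_of_le_one_right (by positivity) (h2 _)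
      linarith
    gcongr
    exact le_rfl
  · simp_rw [tsum_mul_right]
    exact hH.abs.const_mul _
  · have hx : |r * s z| < 1 := by
      rw [abs_mul, abs_of_nonneg h0]
      exact lt_of_le_of_lt (mul_le_of_le_one_right h0 (hs1 z)) h1
    exact ((hasSum_shifted_negBinom n q hx).mul_left (H z)).congr_fun fun k => by ring

theorem tendsto_integral_one_sub_rpow {P : Measure X} {H s : X → ℝ} (hHm : AEStronglyMeasurable H P)
    (hs : Measurable s) (hs1 : ∀ z, |s z| ≤ 1) (hsne : ∀ᵐ z ∂P, s z ≠ 1) {q : ℝ} (hq : 0 < q)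
    (hInt : Integrable (fun z => H z * (1 - s z) ^ (-q)) P) :
    Filter.Tendsto (fun r : ℝ => ∫ z, H z * (1 - r * s z) ^ (-q) ∂P) (nhdsWithin 1 (Set.Iio 1))
      (nhds (∫ z, H z * (1 - s z) ^ (-q) ∂P)) := by
  have hr : ∀ᶠ r : ℝ in nhdsWithin 1 (Set.Iio 1), 1 / 2 < r ∧ r < 1 := by
    filter_upwards [Ioo_mem_nhdsLT (show (1 / 2 : ℝ) < 1 by norm_num)] with r hr using hr
  refine tendsto_integral_filter_of_dominated_convergence
    (fun z => 2 ^ q * ‖H z * (1 - s z) ^ (-q)‖) ?_ ?_ (hInt.norm.const_mul _) ?_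
  · exact Filter.Eventually.of_forall fun r =>
      hHm.mul (Measurable.aestronglyMeasurable (by fun_prop))
  · filter_upwards [hr] with r hr
    filter_upwards [hsne] with z hz
    have hlt : 0 < 1 - s z := sub_pos.2 (lt_of_le_of_ne (abs_le.1 (hs1 z)).2 hz)
    have hh := half_one_sub_le (by linarith [hr.1]) hr.2.le (hs1 z)
    rw [norm_mul, norm_mul, Real.norm_of_nonneg (Real.rpow_nonneg (by linarith) _),
      Real.norm_of_nonneg (Real.rpow_nonneg hlt.le _)]
    have : (1 - r * s z) ^ (-q) ≤ 2 ^ q * (1 - s z) ^ (-q) := by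
      refine (Real.rpow_le_rpow_of_nonpos (by linarith) hh (by linarith)).trans_eq ?_
      rw [Real.div_rpow hlt.le (by norm_num), Real.rpow_neg (by norm_num : (0:ℝ) ≤ 2)]
      field_simp
    calc ‖H z‖ * (1 - r * s z) ^ (-q) ≤ ‖H z‖ * (2 ^ q * (1 - s z) ^ (-q)) := by gcongr
      _ = _ := by ring
  · filter_upwards [hsne] with z hz
    have hlt : 0 < 1 - s z := sub_pos.2 (lt_of_le_of_ne (abs_le.1 (hs1 z)).2 hz)
    have hc : ContinuousAt (fun r : ℝ => H z * (1 - r * s z) ^ (-q)) 1 := by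
      refine continuousAt_const.mul (ContinuousAt.rpow_const (by fun_prop) (Or.inl ?_))
      simpa using hlt.ne'
    simpa using hc.tendsto.mono_left nhdsWithin_le_nhds

theorem tendsto_integral_shifted {P : Measure X} {H s : X → ℝ} (hHm : AEStronglyMeasurable H P)
    (hs : Measurable s) (hs1 : ∀ z, |s z| ≤ 1) (hsne : ∀ᵐ z ∂P, s z ≠ 1) {n q : ℝ} (hn : 0 ≤ n)
    (hq : 0 < q) (hInt : Integrable (fun z => H z * (1 - s z) ^ (-q)) P) :
    Filter.Tendsto (fun r : ℝ => ∫ z, H z * (n * r * s z * (1 - r * s z) ^ (-q) -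
        q * r ^ 2 * (1 - s z ^ 2) * (1 - r * s z) ^ (-(q + 1))) ∂P) (nhdsWithin 1 (Set.Iio 1))
      (nhds (∫ z, H z * ((n * s z - q * (1 + s z)) * (1 - s z) ^ (-q)) ∂P)) := by
  have hr : ∀ᶠ r : ℝ in nhdsWithin 1 (Set.Iio 1), 1 / 2 < r ∧ r < 1 := by
    filter_upwards [Ioo_mem_nhdsLT (show (1 / 2 : ℝ) < 1 by norm_num)] with r hr using hr
  refine tendsto_integral_filter_of_dominated_convergence
    (fun z => (n * 2 ^ q + q * (4 * 2 ^ q)) * ‖H z * (1 - s z) ^ (-q)‖) ?_ ?_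
    (hInt.norm.const_mul _) ?_
  · exact Filter.Eventually.of_forall fun r =>
      hHm.mul (Measurable.aestronglyMeasurable (by fun_prop))
  · filter_upwards [hr] with r hr
    filter_upwards [hsne] with z hz
    have hlt : 0 < 1 - s z := sub_pos.2 (lt_of_le_of_ne (abs_le.1 (hs1 z)).2 hz)
    have hh := half_one_sub_le (by linarith [hr.1]) hr.2.le (hs1 z)
    have hpos : 0 < 1 - r * s z := by linarith
    have h1 : (1 - r * s z) ^ (-q) ≤ 2 ^ q * (1 - s z) ^ (-q) := by
      refine (Real.rpow_le_rpow_of_nonpos (by linarith) hh (by linarith)).trans_eq ?_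
      rw [Real.div_rpow hlt.le (by norm_num), Real.rpow_neg (by norm_num : (0:ℝ) ≤ 2)]
      field_simp
    have h2 : (1 - s z) * (1 - r * s z) ^ (-(q + 1)) ≤ 2 * (2 ^ q * (1 - s z) ^ (-q)) := by
      rw [show -(q + 1) = -q + -1 by ring, Real.rpow_add hpos, Real.rpow_neg_one]
      have h3 : (1 - s z) * (1 - r * s z)⁻¹ ≤ 2 := by
        rw [← div_eq_mul_inv, div_le_iff₀ hpos]; linarith
      calc (1 - s z) * ((1 - r * s z) ^ (-q) * (1 - r * s z)⁻¹)
          = ((1 - s z) * (1 - r * s z)⁻¹) * (1 - r * s z) ^ (-q) := by ring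
        _ ≤ _ := by gcongr
    have hA : 0 ≤ (1 - r * s z) ^ (-q) := Real.rpow_nonneg hpos.le _
    have hB : 0 ≤ (1 - r * s z) ^ (-(q + 1)) := Real.rpow_nonneg hpos.le _
    obtain ⟨hs2, hs3⟩ := abs_le.1 (hs1 z)
    have h4 : ‖n * r * s z * (1 - r * s z) ^ (-q)‖ ≤ n * (2 ^ q * (1 - s z) ^ (-q)) := by
      rw [norm_mul, Real.norm_of_nonneg hA, norm_mul, norm_mul, Real.norm_of_nonneg hn,
        Real.norm_of_nonneg (by linarith [hr.1] : 0 ≤ r), Real.norm_eq_abs]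
      have : n * r * |s z| ≤ n := by
        have : r * |s z| ≤ 1 := mul_le_one₀ hr.2.le (abs_nonneg _) (hs1 z)
        nlinarith
      gcongr
    have h5 : ‖q * r ^ 2 * (1 - s z ^ 2) * (1 - r * s z) ^ (-(q + 1))‖ ≤
        q * (4 * 2 ^ q) * (1 - s z) ^ (-q) := by
      have hnn : 0 ≤ 1 - s z ^ 2 := by nlinarith
      rw [Real.norm_of_nonneg (by positivity)]
      have e1 : q * r ^ 2 * (1 + s z) ≤ q * 2 := by
        have : r ^ 2 ≤ 1 := by nlinarith [hr.1, hr.2]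
        have : r ^ 2 * (1 + s z) ≤ 2 := by nlinarith
        nlinarith
      calc q * r ^ 2 * (1 - s z ^ 2) * (1 - r * s z) ^ (-(q + 1))
          = (q * r ^ 2 * (1 + s z)) * ((1 - s z) * (1 - r * s z) ^ (-(q + 1))) := by ring
        _ ≤ (q * 2) * (2 * (2 ^ q * (1 - s z) ^ (-q))) := by gcongr
        _ = _ := by ring
    rw [norm_mul, norm_mul, Real.norm_of_nonneg (Real.rpow_nonneg hlt.le _)]
    calc _ ≤ ‖H z‖ * (n * (2 ^ q * (1 - s z) ^ (-q)) + q * (4 * 2 ^ q) * (1 - s z) ^ (-q)) := by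
          gcongr
          exact (norm_sub_le _ _).trans (add_le_add h4 h5)
      _ = _ := by ring
  · filter_upwards [hsne] with z hz
    have hlt : 0 < 1 - s z := sub_pos.2 (lt_of_le_of_ne (abs_le.1 (hs1 z)).2 hz)
    have hc : ∀ c : ℝ, ContinuousAt (fun r : ℝ => (1 - r * s z) ^ c) 1 := fun c => by
      refine ContinuousAt.rpow_const (by fun_prop) (Or.inl ?_)
      simpa using hlt.ne'
    have hc2 : ContinuousAt (fun r : ℝ => H z * (n * r * s z * (1 - r * s z) ^ (-q) -
        q * r ^ 2 * (1 - s z ^ 2) * (1 - r * s z) ^ (-(q + 1)))) 1 :=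
      continuousAt_const.mul (((by fun_prop : ContinuousAt (fun r : ℝ => n * r * s z) 1).mul
        (hc _)).sub ((by fun_prop : ContinuousAt (fun r : ℝ => q * r ^ 2 * (1 - s z ^ 2)) 1).mul
        (hc _)))
    have he : H z * (n * 1 * s z * (1 - 1 * s z) ^ (-q) -
        q * 1 ^ 2 * (1 - s z ^ 2) * (1 - 1 * s z) ^ (-(q + 1))) =
        H z * ((n * s z - q * (1 + s z)) * (1 - s z) ^ (-q)) := by
      rw [one_mul, show -(q + 1) = -q + -1 by ring, Real.rpow_add hlt, Real.rpow_neg_one]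
      field_simp
      ring
    rw [← he]
    exact hc2.tendsto.mono_left nhdsWithin_le_nhds

end FormInequality

/-- The quadratic form of `(1 - s) ^ (-q)` on the sphere exceeds its mean value by at most a
multiple of the quadratic form of `(n s - q (1 + s)) (1 - s) ^ (-q)`. -/
theorem exists_form_inequality {n : ℕ} {q : ℝ} (hq : 0 < q) (hqn : 2 * q < n) :
    ∃ C : ℝ, 0 < C ∧ ∀ {X ι : Type} [MeasurableSpace X] [Fintype ι] (ν : Measure X)
      [IsFiniteMeasure ν] (ω : ι → X → ℝ) (h : X → ℝ) (A : ℝ) (m : ℕ → ℝ) (a : ℝ → ℝ) (L : ℝ),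
      Fintype.card ι = n + 1 → (∀ i, Measurable (ω i)) → (∀ x, ∑ i, ω i x ^ 2 = 1) →
      Measurable h → (∀ x, |h x| ≤ A) →
      m 0 = 1 → (∀ k, |m k| ≤ 1) → (∀ j : ℕ, (j + n) * m (j + 1) = j * m (j - 1)) →
      (∀ r, 1 / 2 ≤ r → r < 1 → HasSum (fun k => negBinom q k * r ^ k * m k) (a r)) →
      Filter.Tendsto a (nhdsWithin 1 (Set.Iio 1)) (nhds L) →
      (∀ᵐ z ∂(ν.prod ν), ∑ i, ω i z.1 * ω i z.2 ≠ 1) →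
      Integrable (fun z : X × X => h z.1 * h z.2 * (1 - ∑ i, ω i z.1 * ω i z.2) ^ (-q))
        (ν.prod ν) →
      (∫ z, h z.1 * h z.2 * (1 - ∑ i, ω i z.1 * ω i z.2) ^ (-q) ∂(ν.prod ν)) -
          L * (∫ x, h x ∂ν) ^ 2 ≤
        C * ∫ z, h z.1 * h z.2 * ((n * (∑ i, ω i z.1 * ω i z.2) -
          q * (1 + ∑ i, ω i z.1 * ω i z.2)) * (1 - ∑ i, ω i z.1 * ω i z.2) ^ (-q))
            ∂(ν.prod ν) := by
  obtain ⟨C, hC, hcomp⟩ := exists_tsum_comparison hq hqn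
  refine ⟨C, hC, ?_⟩
  intro X ι _ _ ν _ ω h A m a L hι hω hω1 hh hA hm0 hm1 hmrec ha haL hne hInt
  classical
  set s : X × X → ℝ := fun z => ∑ i, ω i z.1 * ω i z.2 with hsdef
  have hs : Measurable s := by
    refine Finset.measurable_sum _ fun i _ => ?_
    exact ((hω i).comp measurable_fst).mul ((hω i).comp measurable_snd)
  have hs1 : ∀ z, |s z| ≤ 1 := fun z => abs_dot_le_one (hω1 z.1) (hω1 z.2)
  set P := ν.prod ν
  set H : X × X → ℝ := fun z => h z.1 * h z.2 with hHdef
  have hHint : Integrable H P := integrable_mul_of_bounded (hh.comp measurable_fst)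
    (hh.comp measurable_snd) (fun z => hA z.1) (fun z => hA z.2)
  have hpow : ∀ k : ℕ, Integrable (fun z => H z * s z ^ k) P := fun k => by
    refine hHint.mul_bdd (c := 1) (hs.pow_const k).aestronglyMeasurable (ae_of_all _ fun z => ?_)
    rw [norm_pow]
    exact pow_le_one₀ (norm_nonneg _) (hs1 z)
  have hn : (0 : ℝ) < n := by linarith
  have hM0 : ∫ z, H z ∂P = (∫ x, h x ∂ν) ^ 2 := by
    rw [hHdef, integral_prod_mul, sq]
  have hMle : ∀ k : ℕ, |∫ z, H z * s z ^ k ∂P| ≤ ∫ z, |H z| ∂P := fun k => by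
    refine (norm_integral_le_integral_norm _).trans
      (integral_mono (hpow k).norm hHint.abs fun z => ?_)
    simp only [norm_mul, norm_pow, Real.norm_eq_abs]
    exact mul_le_of_le_one_right (abs_nonneg _) (pow_le_one₀ (abs_nonneg _) (hs1 z))
  have hd : ∀ j : ℕ, 0 ≤ ∫ z, H z * ((j + n) * s z ^ (j + 1) - j * s z ^ (j - 1)) ∂P := by
    intro j
    have hωb : ∀ x i, |ω i x| ≤ 1 := fun x => abs_le_one_of_sum_sq (hω1 x)
    have hrm : ∀ (t : ι × ι) l, Measurable fun x => rotGen t.1 t.2 (fun i => ω i x) l :=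
      fun t l => by
        unfold rotGen
        refine Measurable.sub ?_ ?_ <;> split_ifs <;> first | exact hω _ | exact measurable_const
    have key := integral_sum_squares_nonneg (ν := ν) hh hA
      (φ := fun (t : (ι × ι) × (Fin (j + 1) → ι)) x => tensorDeriv (j + 1) (fun i => ω i x)
        (rotGen t.1.1 t.1.2 (fun i => ω i x)) t.2) (B := (j + 1 : ℕ) * 2 ^ (j + 1))
      (fun t => by
        unfold tensorDeriv
        refine Finset.measurable_sum _ fun m _ => Finset.measurable_prod _ fun r _ => ?_
        split_ifs
        · exact hrm _ _
        · exact hω _)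
      (fun t x => abs_tensorDeriv_le (fun i => (hωb x i).trans one_le_two)
        (fun i => abs_rotGen_le (hωb x) _ _ _) _)
    simp_rw [fun z : X × X => sum_rotGen_tensorDeriv hι j (fun i => ω i z.1) (fun i => ω i z.2)
      (hω1 z.1) (hω1 z.2)] at key
    have e : ∀ z : X × X, h z.1 * h z.2 * (2 * (j + 1) *
        ((j + n) * (∑ i, ω i z.1 * ω i z.2) ^ (j + 1) - j * (∑ i, ω i z.1 * ω i z.2) ^ (j - 1))) =
        (2 * (j + 1)) * (H z * ((j + n) * s z ^ (j + 1) - j * s z ^ (j - 1))) := fun z => by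
      simp only [hHdef, hsdef]; ring
    simp_rw [e] at key
    rw [integral_const_mul] at key
    exact nonneg_of_mul_nonneg_right key (by positivity)
  have hrec : ∀ j : ℕ, ∫ z, H z * ((j + n) * s z ^ (j + 1) - j * s z ^ (j - 1)) ∂P =
      (j + n) * (∫ z, H z * s z ^ (j + 1) ∂P) - j * ∫ z, H z * s z ^ (j - 1) ∂P := fun j => by
    rw [← integral_const_mul, ← integral_const_mul, ← integral_sub ((hpow _).const_mul _)
      ((hpow _).const_mul _)]
    exact integral_congr_ae (ae_of_all _ fun z => by ring)
  set N : ℕ → ℝ := fun k => (∫ z, H z * s z ^ k ∂P) - m k * ∫ z, H z ∂P with hN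
  have hN0 : N 0 = 0 := by simp [hN, hm0]
  have hNrec : ∀ j : ℕ, (j + n) * N (j + 1) = j * N (j - 1) +
      ∫ z, H z * ((j + n) * s z ^ (j + 1) - j * s z ^ (j - 1)) ∂P := fun j => by
    rw [hrec]
    simp only [hN]
    linear_combination (-∫ z, H z ∂P) * hmrec j
  have hNnn : ∀ k, 0 ≤ N k := by
    intro k
    induction k using Nat.strong_induction_on with
    | _ k ih =>
      rcases k with _ | j
      · exact hN0.ge
      · have h1 : 0 ≤ N (j - 1) := ih _ (by omega)
        have h2 : 0 ≤ (j + n) * N (j + 1) := by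
          rw [hNrec]; have := hd j; positivity
        exact nonneg_of_mul_nonneg_right h2 (by positivity)
  have hNB : ∀ k, N k ≤ 2 * ∫ z, |H z| ∂P := fun k => by
    have h1 := (abs_le.1 (hMle k)).2
    have h2 : |m k * ∫ z, H z ∂P| ≤ ∫ z, |H z| ∂P := by
      rw [abs_mul]
      exact (mul_le_of_le_one_left (abs_nonneg _) (hm1 k)).trans
        (norm_integral_le_integral_norm H)
    have h3 := (abs_le.1 h2).1
    simp only [hN]
    linarith
  have hmain : ∀ᶠ r : ℝ in nhdsWithin 1 (Set.Iio 1),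
      (∫ z, H z * (1 - r * s z) ^ (-q) ∂P) - a r * (∫ x, h x ∂ν) ^ 2 ≤
      C * ∫ z, H z * (n * r * s z * (1 - r * s z) ^ (-q) -
        q * r ^ 2 * (1 - s z ^ 2) * (1 - r * s z) ^ (-(q + 1))) ∂P := by
    filter_upwards [Ioo_mem_nhdsLT (show (1 / 2 : ℝ) < 1 by norm_num)] with r hr
    refine hcomp N _ _ r _ _ hN0 hNnn hNB hd hNrec hr.1.le hr.2
      (hasSum_integral_mul_shifted hHint hs hs1 hn.le hq (by linarith [hr.1]) hr.2) ?_
    refine ((hasSum_integral_mul_pow hHint hs hs1 hq (by linarith [hr.1]) hr.2).sub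
      ((ha r hr.1.le hr.2).mul_right ((∫ x, h x ∂ν) ^ 2))).congr_fun fun k => ?_
    simp only [hN, hM0]
    ring
  exact le_of_tendsto_of_tendsto
    ((tendsto_integral_one_sub_rpow hHint.1 hs hs1 hne hq hInt).sub (haL.mul_const _))
    ((tendsto_integral_shifted hHint.1 hs hs1 hne hn.le hq hInt).const_mul C) hmain

section RadialIntegrals

theorem lintegral_rpow_mul_exp_neg_mul_Ioi {c b : ℝ} (hc : 0 < c) (hb : 0 < b) :
    ∫⁻ t in Set.Ioi (0 : ℝ), ENNReal.ofReal (t ^ (c - 1) * Real.exp (-(b * t))) =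
      ENNReal.ofReal (b ^ (-c) * Real.Gamma c) := by
  rw [← ofReal_integral_eq_lintegral_ofReal]
  · rw [Real.integral_rpow_mul_exp_neg_mul_Ioi hc hb, one_div, Real.inv_rpow hb.le,
      Real.rpow_neg hb.le]
  · have := integrableOn_rpow_mul_exp_neg_mul_rpow (s := c - 1) (p := 1) (b := b) (by linarith)
      one_pos hb
    simpa [IntegrableOn] using this
  · filter_upwards [ae_restrict_mem measurableSet_Ioi] with t ht
    have : (0 : ℝ) < t := ht
    positivity

theorem measureReal_unitBall_mul (n : ℕ) (hn : 1 ≤ n) :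
    n * volume.real (Metric.ball (0 : EuclideanSpace ℝ (Fin n)) 1) =
      2 * (π ^ ((n : ℝ) / 2) / Real.Gamma ((n : ℝ) / 2)) := by
  have hn0 : (0 : ℝ) < n := by exact_mod_cast hn
  have : NeZero n := ⟨by omega⟩
  have hG : 0 < Real.Gamma ((n : ℝ) / 2) := Real.Gamma_pos_of_pos (by positivity)
  have hsq : √π ^ n = π ^ ((n : ℝ) / 2) := by
    rw [Real.sqrt_eq_rpow, ← Real.rpow_natCast, ← Real.rpow_mul Real.pi_pos.le]
    congr 1; ring
  rw [measureReal_def, EuclideanSpace.volume_ball]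
  simp only [ENNReal.ofReal_one, one_pow, one_mul, Fintype.card_fin]
  rw [ENNReal.toReal_ofReal (by
      rw [Real.Gamma_add_one (by positivity)]; positivity), hsq,
    Real.Gamma_add_one (by positivity)]
  field_simp

theorem lintegral_norm_rpow_mul_exp_neg {n : ℕ} (hn : 1 ≤ n) {σ t : ℝ} (hσ : 2 * σ < n)
    (ht : 0 < t) :
    ∫⁻ x : EuclideanSpace ℝ (Fin n), ENNReal.ofReal (‖x‖ ^ (-(2 * σ)) * Real.exp (-(t * ‖x‖ ^ 2))) =
      ENNReal.ofReal (π ^ ((n : ℝ) / 2) * Real.Gamma ((n : ℝ) / 2 - σ) / Real.Gamma ((n : ℝ) / 2) *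
        t ^ (-((n : ℝ) / 2 - σ))) := by
  have hn0 : (0 : ℝ) < n := by exact_mod_cast hn
  have : Nonempty (Fin n) := ⟨⟨0, by omega⟩⟩
  have hs : -1 < (n : ℝ) - 1 - 2 * σ := by linarith
  have he : Set.EqOn (fun y : ℝ => y ^ (n - 1) • (y ^ (-(2 * σ)) * Real.exp (-(t * y ^ 2))))
      (fun y => y ^ ((n : ℝ) - 1 - 2 * σ) * Real.exp (-t * y ^ (2 : ℝ))) (Set.Ioi 0) := by
    intro y hy
    have hy : (0 : ℝ) < y := hy
    have h1 : y ^ (n - 1) = y ^ ((n : ℝ) - 1) := by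
      rw [← Real.rpow_natCast, Nat.cast_sub hn, Nat.cast_one]
    simp only [smul_eq_mul, h1]
    rw [sub_eq_add_neg _ (2 * σ), Real.rpow_add hy, Real.rpow_two, neg_mul, mul_assoc]
  rw [← ofReal_integral_eq_lintegral_ofReal]
  · rw [integral_fun_norm_addHaar volume
      (fun y : ℝ => y ^ (-(2 * σ)) * Real.exp (-(t * y ^ 2))), finrank_euclideanSpace_fin,
      setIntegral_congr_fun measurableSet_Ioi he,
      integral_rpow_mul_exp_neg_mul_rpow two_pos hs ht, nsmul_eq_mul, smul_eq_mul, ← mul_assoc,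
      measureReal_unitBall_mul n hn]
    congr 1
    rw [show ((n : ℝ) - 1 - 2 * σ + 1) / 2 = (n : ℝ) / 2 - σ by ring,
      show -((n : ℝ) - 1 - 2 * σ + 1) / 2 = -((n : ℝ) / 2 - σ) by ring]
    ring
  · rw [integrable_fun_norm_addHaar volume
      (f := fun y : ℝ => y ^ (-(2 * σ)) * Real.exp (-(t * y ^ 2))), finrank_euclideanSpace_fin,
      integrableOn_congr_fun he measurableSet_Ioi]
    exact integrableOn_rpow_mul_exp_neg_mul_rpow hs two_pos ht
  · exact ae_of_all _ fun x => by positivity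

theorem lintegral_norm_rpow_mul_one_add_sq {n : ℕ} (hn : 1 ≤ n) {σ c : ℝ} (hσ : 2 * σ < n)
    (hc0 : 0 < c) (hc : (n : ℝ) / 2 - σ < c) :
    ∫⁻ x : EuclideanSpace ℝ (Fin n), ENNReal.ofReal (‖x‖ ^ (-(2 * σ)) * (1 + ‖x‖ ^ 2) ^ (-c)) =
      ENNReal.ofReal (π ^ ((n : ℝ) / 2) * Real.Gamma ((n : ℝ) / 2 - σ) / Real.Gamma ((n : ℝ) / 2) *
        Real.Gamma (c - ((n : ℝ) / 2 - σ)) / Real.Gamma c) := by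
  have hn0 : (0 : ℝ) < n := by exact_mod_cast hn
  have hG : 0 < Real.Gamma c := Real.Gamma_pos_of_pos hc0
  set K := π ^ ((n : ℝ) / 2) * Real.Gamma ((n : ℝ) / 2 - σ) / Real.Gamma ((n : ℝ) / 2) with hK
  have hK0 : 0 < K := by
    have := Real.Gamma_pos_of_pos (show 0 < (n : ℝ) / 2 by positivity)
    have := Real.Gamma_pos_of_pos (show 0 < (n : ℝ) / 2 - σ by linarith)
    positivity
  have key : ENNReal.ofReal (Real.Gamma c) *
      ∫⁻ x : EuclideanSpace ℝ (Fin n), ENNReal.ofReal (‖x‖ ^ (-(2 * σ)) * (1 + ‖x‖ ^ 2) ^ (-c)) =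
      ENNReal.ofReal (K * Real.Gamma (c - ((n : ℝ) / 2 - σ))) := by
    rw [← lintegral_const_mul _ (by fun_prop)]
    have e1 : ∀ x : EuclideanSpace ℝ (Fin n), ENNReal.ofReal (Real.Gamma c) *
        ENNReal.ofReal (‖x‖ ^ (-(2 * σ)) * (1 + ‖x‖ ^ 2) ^ (-c)) =
        ∫⁻ t in Set.Ioi (0 : ℝ), ENNReal.ofReal (t ^ (c - 1) * Real.exp (-t)) *
          ENNReal.ofReal (‖x‖ ^ (-(2 * σ)) * Real.exp (-(t * ‖x‖ ^ 2))) := fun x => by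
      have h1 : ∀ t ∈ Set.Ioi (0 : ℝ), ENNReal.ofReal (t ^ (c - 1) * Real.exp (-t)) *
          ENNReal.ofReal (‖x‖ ^ (-(2 * σ)) * Real.exp (-(t * ‖x‖ ^ 2))) =
          ENNReal.ofReal (‖x‖ ^ (-(2 * σ))) *
            ENNReal.ofReal (t ^ (c - 1) * Real.exp (-((1 + ‖x‖ ^ 2) * t))) := fun t ht => by
        have ht : (0 : ℝ) < t := ht
        rw [← ENNReal.ofReal_mul (by positivity), ← ENNReal.ofReal_mul (by positivity)]
        congr 1
        rw [show -((1 + ‖x‖ ^ 2) * t) = -t + -(t * ‖x‖ ^ 2) by ring, Real.exp_add]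
        ring
      rw [setLIntegral_congr_fun measurableSet_Ioi h1, lintegral_const_mul _ (by fun_prop),
        lintegral_rpow_mul_exp_neg_mul_Ioi hc0 (by positivity),
        ← ENNReal.ofReal_mul (by positivity), ← ENNReal.ofReal_mul (by positivity)]
      congr 1
      ring
    simp_rw [e1]
    rw [lintegral_lintegral_swap (by fun_prop)]
    have e2 : ∀ t ∈ Set.Ioi (0 : ℝ), (∫⁻ x : EuclideanSpace ℝ (Fin n),
        ENNReal.ofReal (t ^ (c - 1) * Real.exp (-t)) *
          ENNReal.ofReal (‖x‖ ^ (-(2 * σ)) * Real.exp (-(t * ‖x‖ ^ 2)))) =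
        ENNReal.ofReal K * ENNReal.ofReal (t ^ (c - ((n : ℝ) / 2 - σ) - 1) *
          Real.exp (-(1 * t))) := fun t ht => by
      have ht : (0 : ℝ) < t := ht
      rw [lintegral_const_mul _ (by fun_prop), lintegral_norm_rpow_mul_exp_neg hn hσ ht, ← hK,
        ← ENNReal.ofReal_mul (by positivity), ← ENNReal.ofReal_mul (by positivity)]
      congr 1
      rw [show c - ((n : ℝ) / 2 - σ) - 1 = (c - 1) + -((n : ℝ) / 2 - σ) by ring,
        Real.rpow_add ht, one_mul]
      ring
    rw [setLIntegral_congr_fun measurableSet_Ioi e2, lintegral_const_mul _ (by fun_prop),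
      lintegral_rpow_mul_exp_neg_mul_Ioi (by linarith) one_pos, ← ENNReal.ofReal_mul hK0.le,
      Real.one_rpow, one_mul]
  rw [ENNReal.ofReal_div_of_pos hG, ← key, ENNReal.mul_div_right_comm, ENNReal.div_self
    (by simpa using hG) ENNReal.ofReal_ne_top, one_mul]

end RadialIntegrals

section ZonalMoments

/-- The integral of `(1 + ‖x‖ ^ 2) ^ (-n)` over `ℝ ^ n`. -/
def sphereMass (n : ℕ) : ℝ := π ^ ((n : ℝ) / 2) * Real.Gamma ((n : ℝ) / 2) / Real.Gamma n

/-- The integral of `‖x‖ ^ (-2 q) * (1 + ‖x‖ ^ 2) ^ (q - n)` over `ℝ ^ n`. -/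
def rieszMass (n : ℕ) (q : ℝ) : ℝ :=
  π ^ ((n : ℝ) / 2) * Real.Gamma ((n : ℝ) / 2 - q) / Real.Gamma (n - q)

theorem sphereMass_pos {n : ℕ} (hn : 1 ≤ n) : 0 < sphereMass n := by
  have hn0 : (0 : ℝ) < n := by exact_mod_cast hn
  have := Real.Gamma_pos_of_pos (show 0 < (n : ℝ) / 2 by positivity)
  have := Real.Gamma_pos_of_pos hn0
  unfold sphereMass
  positivity

theorem rieszMass_pos {n : ℕ} {q : ℝ} (hqn : 2 * q < n) : 0 < rieszMass n q := by
  have hn0 : (0 : ℝ) ≤ n := by positivity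
  have := Real.Gamma_pos_of_pos (show 0 < (n : ℝ) / 2 - q by linarith)
  have := Real.Gamma_pos_of_pos (show 0 < (n : ℝ) - q by linarith)
  unfold rieszMass
  positivity

theorem lintegral_one_add_norm_sq_rpow {n : ℕ} (hn : 1 ≤ n) :
    ∫⁻ x : EuclideanSpace ℝ (Fin n), ENNReal.ofReal ((1 + ‖x‖ ^ 2) ^ (-(n : ℝ))) =
      ENNReal.ofReal (sphereMass n) := by
  have hn0 : (0 : ℝ) < n := by exact_mod_cast hn
  have h := lintegral_norm_rpow_mul_one_add_sq hn (σ := 0) (c := n) (by simpa using hn0) hn0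
    (by linarith)
  simp only [mul_zero, neg_zero, Real.rpow_zero, one_mul, sub_zero] at h
  rw [h]
  congr 1
  have := Real.Gamma_pos_of_pos (show 0 < (n : ℝ) / 2 by positivity)
  rw [sphereMass, show (n : ℝ) - n / 2 = n / 2 by ring]
  field_simp

theorem lintegral_norm_rpow_mul_one_add_norm_sq_rpow {n : ℕ} (hn : 1 ≤ n) {q : ℝ}
    (hqn : 2 * q < n) :
    ∫⁻ x : EuclideanSpace ℝ (Fin n),
      ENNReal.ofReal (‖x‖ ^ (-(2 * q)) * (1 + ‖x‖ ^ 2) ^ (-(n - q))) =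
      ENNReal.ofReal (rieszMass n q) := by
  have hn0 : (0 : ℝ) < n := by exact_mod_cast hn
  rw [lintegral_norm_rpow_mul_one_add_sq hn hqn (by linarith) (by linarith)]
  congr 1
  have := Real.Gamma_pos_of_pos (show 0 < (n : ℝ) / 2 by positivity)
  rw [rieszMass, show (n : ℝ) - q - (n / 2 - q) = n / 2 by ring]
  field_simp

theorem integrable_one_add_norm_sq_rpow {n : ℕ} (hn : 1 ≤ n) :
    Integrable fun x : EuclideanSpace ℝ (Fin n) => (1 + ‖x‖ ^ 2) ^ (-(n : ℝ)) := by
  rw [← lintegral_ofReal_ne_top_iff_integrable (Measurable.aestronglyMeasurable (by fun_prop))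
    (ae_of_all _ fun x => by positivity), lintegral_one_add_norm_sq_rpow hn]
  exact ENNReal.ofReal_ne_top

theorem integral_one_add_norm_sq_rpow {n : ℕ} (hn : 1 ≤ n) :
    ∫ x : EuclideanSpace ℝ (Fin n), (1 + ‖x‖ ^ 2) ^ (-(n : ℝ)) = sphereMass n := by
  rw [integral_eq_lintegral_of_nonneg_ae (ae_of_all _ fun x => by positivity)
    (Measurable.aestronglyMeasurable (by fun_prop)), lintegral_one_add_norm_sq_rpow hn,
    ENNReal.toReal_ofReal (sphereMass_pos hn).le]

theorem abs_zonal_le_one (y : ℝ) : |(1 - y ^ 2) / (1 + y ^ 2)| ≤ 1 := by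
  rw [abs_div, abs_of_pos (by positivity : 0 < 1 + y ^ 2), div_le_one (by positivity), abs_le]
  constructor <;> nlinarith [sq_nonneg y]

theorem hasDerivAt_zonal_antiderivative (n j : ℕ) (hn : 1 ≤ n) (y : ℝ) :
    HasDerivAt (fun y : ℝ => ((1 - y ^ 2) / (1 + y ^ 2)) ^ j * (y / (1 + y ^ 2)) ^ n)
      (y ^ (n - 1) * ((1 + y ^ 2) ^ n)⁻¹ * ((j + n) * ((1 - y ^ 2) / (1 + y ^ 2)) ^ (j + 1) -
        j * ((1 - y ^ 2) / (1 + y ^ 2)) ^ (j - 1))) y := by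
  have hp : (1 + y ^ 2) ≠ 0 := by positivity
  have hnum : HasDerivAt (fun y : ℝ => 1 + y ^ 2) (2 * y) y := by
    simpa using (hasDerivAt_pow 2 y).const_add 1
  have hnum2 : HasDerivAt (fun y : ℝ => 1 - y ^ 2) (-(2 * y)) y := by
    simpa using (hasDerivAt_pow 2 y).const_sub 1
  have h := (((hnum2.fun_div hnum hp).fun_pow j).fun_mul
    (((hasDerivAt_id y).fun_div hnum hp).fun_pow n))
  refine h.congr_deriv ?_
  obtain ⟨k, rfl⟩ : ∃ k, n = k + 1 := ⟨n - 1, by omega⟩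
  simp only [id, Nat.add_sub_cancel]
  rcases j with _ | i
  · simp only [Nat.cast_zero, zero_mul, pow_zero, zero_add, div_pow]
    field_simp
    push_cast
    ring
  · simp only [Nat.add_sub_cancel, div_pow]
    field_simp
    push_cast
    ring

theorem zonal_moment_recursion {n : ℕ} (hn : 1 ≤ n) (j : ℕ) :
    ∫ x : EuclideanSpace ℝ (Fin n), (1 + ‖x‖ ^ 2) ^ (-(n : ℝ)) *
      ((j + n) * ((1 - ‖x‖ ^ 2) / (1 + ‖x‖ ^ 2)) ^ (j + 1) -
        j * ((1 - ‖x‖ ^ 2) / (1 + ‖x‖ ^ 2)) ^ (j - 1)) = 0 := by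
  have : Nonempty (Fin n) := ⟨⟨0, by omega⟩⟩
  have hInt : Integrable fun x : EuclideanSpace ℝ (Fin n) => (1 + ‖x‖ ^ 2) ^ (-(n : ℝ)) *
      ((j + n) * ((1 - ‖x‖ ^ 2) / (1 + ‖x‖ ^ 2)) ^ (j + 1) -
        j * ((1 - ‖x‖ ^ 2) / (1 + ‖x‖ ^ 2)) ^ (j - 1)) := by
    refine (integrable_one_add_norm_sq_rpow hn).mul_bdd (c := 2 * j + n)
      (Measurable.aestronglyMeasurable (by fun_prop)) (ae_of_all _ fun x => ?_)
    have h2 : ∀ k : ℕ, ‖((1 - ‖x‖ ^ 2) / (1 + ‖x‖ ^ 2)) ^ k‖ ≤ 1 := fun k => by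
      rw [norm_pow]; exact pow_le_one₀ (norm_nonneg _) (abs_zonal_le_one _)
    refine (norm_sub_le _ _).trans ?_
    rw [norm_mul, norm_mul, Real.norm_of_nonneg (by positivity : (0 : ℝ) ≤ j + n),
      Real.norm_of_nonneg (by positivity : (0 : ℝ) ≤ j)]
    have e1 := mul_le_of_le_one_right (by positivity : (0 : ℝ) ≤ j + n) (h2 (j + 1))
    have e2 := mul_le_of_le_one_right (by positivity : (0 : ℝ) ≤ j) (h2 (j - 1))
    linarith
  have he : (fun y : ℝ => y ^ (n - 1) • ((1 + y ^ 2) ^ (-(n : ℝ)) *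
      ((j + n) * ((1 - y ^ 2) / (1 + y ^ 2)) ^ (j + 1) -
        j * ((1 - y ^ 2) / (1 + y ^ 2)) ^ (j - 1)))) =
      fun y : ℝ => y ^ (n - 1) * ((1 + y ^ 2) ^ n)⁻¹ *
        ((j + n) * ((1 - y ^ 2) / (1 + y ^ 2)) ^ (j + 1) -
        j * ((1 - y ^ 2) / (1 + y ^ 2)) ^ (j - 1)) := by
    funext y
    rw [Real.rpow_neg (by positivity), Real.rpow_natCast, smul_eq_mul, mul_assoc]
  rw [integrable_fun_norm_addHaar volume (f := fun y : ℝ => (1 + y ^ 2) ^ (-(n : ℝ)) *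
      ((j + n) * ((1 - y ^ 2) / (1 + y ^ 2)) ^ (j + 1) -
        j * ((1 - y ^ 2) / (1 + y ^ 2)) ^ (j - 1))), finrank_euclideanSpace_fin, he] at hInt
  rw [integral_fun_norm_addHaar volume (fun y : ℝ => (1 + y ^ 2) ^ (-(n : ℝ)) *
      ((j + n) * ((1 - y ^ 2) / (1 + y ^ 2)) ^ (j + 1) -
        j * ((1 - y ^ 2) / (1 + y ^ 2)) ^ (j - 1))), finrank_euclideanSpace_fin, he]
  have hlim : Filter.Tendsto
      (fun y : ℝ => ((1 - y ^ 2) / (1 + y ^ 2)) ^ j * (y / (1 + y ^ 2)) ^ n) Filter.atTop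
      (nhds 0) := by
    refine squeeze_zero_norm' ?_ (tendsto_inv_atTop_zero (𝕜 := ℝ))
    filter_upwards [Filter.eventually_ge_atTop 1] with y hy
    have h1 : ‖((1 - y ^ 2) / (1 + y ^ 2)) ^ j‖ ≤ 1 := by
      rw [norm_pow]; exact pow_le_one₀ (norm_nonneg _) (abs_zonal_le_one _)
    have h3 : y / (1 + y ^ 2) ≤ y⁻¹ := by
      rw [div_le_iff₀ (by positivity)]
      field_simp
      nlinarith
    have h4 : y⁻¹ ≤ 1 := inv_le_one_of_one_le₀ hy
    have h0 : 0 ≤ y / (1 + y ^ 2) := by positivity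
    rw [norm_mul, norm_pow (y / _), Real.norm_of_nonneg h0]
    calc _ ≤ 1 * (y / (1 + y ^ 2)) ^ n := by gcongr
      _ ≤ 1 * (y / (1 + y ^ 2)) ^ 1 := by
        gcongr 1 * ?_
        exact pow_le_pow_of_le_one h0 (h3.trans h4) hn
      _ ≤ y⁻¹ := by simpa using h3
  rw [integral_Ioi_of_hasDerivAt_of_tendsto'
    (fun y _ => hasDerivAt_zonal_antiderivative n j hn y) hInt hlim]
  simp [show n ≠ 0 by omega]

theorem exists_zonal_moments {n : ℕ} (hn : 1 ≤ n) {q : ℝ} (hq : 0 < q) (hqn : 2 * q < n) :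
    ∃ (m : ℕ → ℝ) (a : ℝ → ℝ), m 0 = 1 ∧ (∀ k, |m k| ≤ 1) ∧
      (∀ j : ℕ, (j + n) * m (j + 1) = j * m (j - 1)) ∧
      (∀ r, 1 / 2 ≤ r → r < 1 → HasSum (fun k => negBinom q k * r ^ k * m k) (a r)) ∧
      Filter.Tendsto a (nhdsWithin 1 (Set.Iio 1))
        (nhds (2 ^ (-q) * rieszMass n q / sphereMass n)) := by
  have : Nonempty (Fin n) := ⟨⟨0, by omega⟩⟩
  have hZ := sphereMass_pos hn
  set s : EuclideanSpace ℝ (Fin n) → ℝ := fun x => (1 - ‖x‖ ^ 2) / (1 + ‖x‖ ^ 2) with hs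
  set H : EuclideanSpace ℝ (Fin n) → ℝ :=
    fun x => (sphereMass n)⁻¹ * (1 + ‖x‖ ^ 2) ^ (-(n : ℝ)) with hH
  have hHint : Integrable H := (integrable_one_add_norm_sq_rpow hn).const_mul _
  have hHnn : ∀ x, 0 ≤ H x := fun x => by simp only [hH]; positivity
  have hH1 : ∫ x, H x = 1 := by
    rw [integral_const_mul, integral_one_add_norm_sq_rpow hn, inv_mul_cancel₀ hZ.ne']
  have hsm : Measurable s := by fun_prop
  have hs1 : ∀ x, |s x| ≤ 1 := fun x => abs_zonal_le_one _
  have hpow : ∀ k : ℕ, Integrable (fun z => H z * s z ^ k) := fun k => by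
    refine hHint.mul_bdd (c := 1) (hsm.pow_const k).aestronglyMeasurable (ae_of_all _ fun z => ?_)
    rw [norm_pow]
    exact pow_le_one₀ (norm_nonneg _) (hs1 z)
  have h1s : ∀ x, 1 - s x = 2 * ‖x‖ ^ 2 / (1 + ‖x‖ ^ 2) := fun x => by
    simp only [hs]; field_simp; ring
  have hne : ∀ᵐ x : EuclideanSpace ℝ (Fin n), s x ≠ 1 := by
    filter_upwards [Measure.ae_ne volume (0 : EuclideanSpace ℝ (Fin n))] with x hx h
    have h2 := h1s x
    rw [h, sub_self] at h2
    have : 0 < ‖x‖ := norm_pos_iff.2 hx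
    have : 0 < 2 * ‖x‖ ^ 2 / (1 + ‖x‖ ^ 2) := by positivity
    linarith
  have hval : ∀ x, H x * (1 - s x) ^ (-q) = (2 ^ (-q) / sphereMass n) *
      (‖x‖ ^ (-(2 * q)) * (1 + ‖x‖ ^ 2) ^ (-(n - q))) := fun x => by
    rw [h1s, Real.div_rpow (by positivity) (by positivity), Real.mul_rpow two_pos.le
      (by positivity), ← Real.rpow_two, ← Real.rpow_mul (norm_nonneg x),
      show -((n : ℝ) - q) = -n - (-q) by ring, Real.rpow_sub (by positivity)]
    simp only [hH, mul_neg, Real.rpow_two]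
    ring
  have hWnn : ∀ x : EuclideanSpace ℝ (Fin n),
      0 ≤ ‖x‖ ^ (-(2 * q)) * (1 + ‖x‖ ^ 2) ^ (-(n - q)) := fun x => by positivity
  have hWi : Integrable fun x : EuclideanSpace ℝ (Fin n) =>
      ‖x‖ ^ (-(2 * q)) * (1 + ‖x‖ ^ 2) ^ (-(n - q)) := by
    rw [← lintegral_ofReal_ne_top_iff_integrable (Measurable.aestronglyMeasurable (by fun_prop))
      (ae_of_all _ hWnn), lintegral_norm_rpow_mul_one_add_norm_sq_rpow hn hqn]
    exact ENNReal.ofReal_ne_top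
  have hW : ∫ x : EuclideanSpace ℝ (Fin n),
      ‖x‖ ^ (-(2 * q)) * (1 + ‖x‖ ^ 2) ^ (-(n - q)) = rieszMass n q := by
    rw [integral_eq_lintegral_of_nonneg_ae (ae_of_all _ hWnn)
      (Measurable.aestronglyMeasurable (by fun_prop)),
      lintegral_norm_rpow_mul_one_add_norm_sq_rpow hn hqn,
      ENNReal.toReal_ofReal (rieszMass_pos hqn).le]
  refine ⟨fun k => ∫ x, H x * s x ^ k, fun r => ∫ x, H x * (1 - r * s x) ^ (-q), ?_, ?_, ?_, ?_, ?_⟩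
  · simpa using hH1
  · intro k
    refine (norm_integral_le_integral_norm (fun x => H x * s x ^ k)).trans ?_
    rw [← hH1]
    refine integral_mono (hpow k).norm hHint fun z => ?_
    simp only [norm_mul, norm_pow, Real.norm_of_nonneg (hHnn z)]
    exact mul_le_of_le_one_right (hHnn z) (pow_le_one₀ (norm_nonneg _) (hs1 z))
  · intro j
    rw [← sub_eq_zero, ← integral_const_mul, ← integral_const_mul,
      ← integral_sub ((hpow _).const_mul _) ((hpow _).const_mul _)]
    have h := zonal_moment_recursion hn j
    rw [← mul_zero (sphereMass n)⁻¹, ← h, ← integral_const_mul]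
    exact integral_congr_ae (ae_of_all _ fun z => by simp only [hH, hs]; ring)
  · intro r hr hr1
    exact hasSum_integral_mul_pow hHint hsm hs1 hq (by linarith) hr1
  · have hi : Integrable fun x => H x * (1 - s x) ^ (-q) := by
      simp_rw [hval]
      exact hWi.const_mul _
    have := tendsto_integral_one_sub_rpow hHint.1 hsm hs1 hne hq hi
    simp_rw [hval] at this
    rw [integral_const_mul, hW, div_mul_eq_mul_div] at this
    exact this

end ZonalMoments

section NonsharpBound

theorem lintegral_comp_smul_sub {n : ℕ} (g : EuclideanSpace ℝ (Fin n) → ℝ≥0∞) (hg : Measurable g)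
    {c : ℝ} (hc : 0 < c) (x : EuclideanSpace ℝ (Fin n)) :
    ∫⁻ y, g (c • (x - y)) = ENNReal.ofReal (c ^ (-(n : ℝ))) * ∫⁻ y, g y := by
  rw [lintegral_sub_left_eq_self (fun y => g (c • y)) x,
    ← lintegral_map (μ := volume) hg (measurable_const_smul c),
    Measure.map_addHaar_smul volume hc.ne', lintegral_smul_measure, finrank_euclideanSpace_fin,
    Real.rpow_neg hc.le, Real.rpow_natCast, abs_of_pos (by positivity), smul_eq_mul]

theorem min_one_mul_rpow_le {n : ℕ} {p q : ℝ} (hq : 0 < q) (hqn : 2 * q < n)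
    (hp : p * (n - q) = n) {v r : ℝ} (hv : 0 ≤ v) (hr : 0 ≤ r) :
    min v 1 * r ^ (-(2 * q)) ≤
      v ^ p + 2 ^ (n - q) * (r ^ (-(2 * q)) * (1 + r ^ 2) ^ (-(n - q))) := by
  have hnq : 0 < n - q := by linarith
  have hA : 0 ≤ r ^ (-(2 * q)) := Real.rpow_nonneg hr _
  have hvp : 0 ≤ v ^ p := Real.rpow_nonneg hv _
  rcases le_total r 1 with h | h
  · have h1 : 1 ≤ 2 ^ (n - q) * (1 + r ^ 2) ^ (-(n - q)) := by
      rw [Real.rpow_neg (by positivity), ← div_eq_mul_inv, one_le_div (by positivity)]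
      exact Real.rpow_le_rpow (by positivity) (by nlinarith) hnq.le
    calc min v 1 * r ^ (-(2 * q)) ≤ 1 * r ^ (-(2 * q)) := by gcongr; exact min_le_right _ _
      _ ≤ (2 ^ (n - q) * (1 + r ^ 2) ^ (-(n - q))) * r ^ (-(2 * q)) := by gcongr
      _ ≤ _ := by linarith
  · have hr0 : 0 < r := by linarith
    have hp1 : 1 < p := by
      by_contra! hcon
      nlinarith
    have hconj : p.HolderConjugate (n / q) := by
      rw [Real.holderConjugate_iff]
      refine ⟨hp1, ?_⟩
      have : p ≠ 0 := by linarith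
      have hn : (n : ℝ) ≠ 0 := by linarith
      field_simp
      linarith
    have hy := Real.young_inequality_of_nonneg hv hA hconj
    have hn1 : 1 ≤ (n : ℝ) / q := by rw [le_div_iff₀ hq]; linarith
    have h2 : v ^ p / p ≤ v ^ p := div_le_self hvp hp1.le
    have h3 : (r ^ (-(2 * q))) ^ ((n : ℝ) / q) / (n / q) ≤ (r ^ (-(2 * q))) ^ ((n : ℝ) / q) :=
      div_le_self (by positivity) hn1
    have h4 : (r ^ (-(2 * q))) ^ ((n : ℝ) / q) = r ^ (-(2 * q)) * (r ^ 2) ^ (-(n - q)) := by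
      rw [← Real.rpow_mul hr, ← Real.rpow_two, ← Real.rpow_mul hr, ← Real.rpow_add hr0]
      congr 1
      field_simp
      ring
    have h5 : (r ^ 2) ^ (-(n - q)) ≤ 2 ^ (n - q) * (1 + r ^ 2) ^ (-(n - q)) := by
      rw [Real.rpow_neg (by positivity), Real.rpow_neg (by positivity), ← div_eq_mul_inv,
        inv_eq_one_div, div_le_div_iff₀ (by positivity) (by positivity), one_mul,
        ← Real.mul_rpow (by positivity) (by positivity)]
      exact Real.rpow_le_rpow (by positivity) (by nlinarith) hnq.le
    calc min v 1 * r ^ (-(2 * q)) ≤ v * r ^ (-(2 * q)) := by gcongr; exact min_le_left _ _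
      _ ≤ v ^ p + r ^ (-(2 * q)) * (r ^ 2) ^ (-(n - q)) := by rw [← h4]; linarith
      _ ≤ v ^ p + r ^ (-(2 * q)) * (2 ^ (n - q) * (1 + r ^ 2) ^ (-(n - q))) := by gcongr
      _ = _ := by ring

theorem min_mul_rpow_le {n : ℕ} {p q : ℝ} (hq : 0 < q) (hqn : 2 * q < n) (hp : p * (n - q) = n)
    {v b r : ℝ} (hv : 0 ≤ v) (hb : 0 < b) (hr : 0 ≤ r) :
    b * (min v b * r ^ (-(2 * q))) ≤ b ^ p * v ^ p + b ^ p * b ^ p * (2 ^ (n - q) *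
      ((b ^ (p / n) * r) ^ (-(2 * q)) * (1 + (b ^ (p / n) * r) ^ 2) ^ (-(n - q)))) := by
  have hn : (0 : ℝ) < n := by linarith
  have hnq : 0 < n - q := by linarith
  have h := min_one_mul_rpow_le hq hqn hp (v := v / b) (r := b ^ (p / n) * r) (by positivity)
    (by positivity)
  have e1 : min (v / b) 1 = min v b / b := by
    rw [← min_div_div_right hb.le, div_self hb.ne']
  have e2 : (b ^ (p / n) * r) ^ (-(2 * q)) = b ^ (2 - 2 * p) * r ^ (-(2 * q)) := by
    rw [Real.mul_rpow (by positivity) hr, ← Real.rpow_mul hb.le]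
    congr 2
    field_simp
    linarith
  have e3 : (b : ℝ) ^ (2 - 2 * p) = b * b / (b ^ p * b ^ p) := by
    rw [Real.rpow_sub hb, Real.rpow_two, two_mul, Real.rpow_add hb, sq]
  have hbp : 0 < b ^ p := Real.rpow_pos_of_pos hb _
  rw [e1, Real.div_rpow hv hb.le] at h
  nth_rewrite 1 [e2] at h
  rw [e3] at h
  have h2 := mul_le_mul_of_nonneg_left h (mul_pos hbp hbp).le
  have e4 : b ^ p * b ^ p * (min v b / b * (b * b / (b ^ p * b ^ p) * r ^ (-(2 * q)))) =
      b * (min v b * r ^ (-(2 * q))) := by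
    field_simp
  rw [e4, mul_add] at h2
  refine h2.trans_eq ?_
  congr 1
  field_simp

/-- The Riesz energy of a density with respect to the kernel `‖x - y‖ ^ (-2 q)`. -/
def rieszEnergy {n : ℕ} (q : ℝ) (u : EuclideanSpace ℝ (Fin n) → ℝ) : ℝ≥0∞ :=
  ∫⁻ x, ∫⁻ y, ENNReal.ofReal (u x * u y * ‖x - y‖ ^ (-(2 * q)))

theorem rieszEnergy_le_of_lintegral_le_one {n : ℕ} (hn : 1 ≤ n) {p q : ℝ} (hq : 0 < q)
    (hqn : 2 * q < n) (hp : p * (n - q) = n) {u : EuclideanSpace ℝ (Fin n) → ℝ}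
    (hu : Measurable u) (hu0 : ∀ x, 0 ≤ u x)
    (hu1 : ∫⁻ x, ENNReal.ofReal (u x ^ p) ≤ 1) :
    rieszEnergy q u ≤ 2 * (1 + ENNReal.ofReal (2 ^ (n - q) * rieszMass n q)) := by
  set J : EuclideanSpace ℝ (Fin n) → EuclideanSpace ℝ (Fin n) → ℝ≥0∞ :=
    fun x y => ENNReal.ofReal (u x * (min (u y) (u x) * ‖x - y‖ ^ (-(2 * q)))) with hJ
  have hJm : Measurable (Function.uncurry J) := by
    simp only [hJ, Function.uncurry_def]
    fun_prop
  have hpw : ∀ x y, ENNReal.ofReal (u x * u y * ‖x - y‖ ^ (-(2 * q))) ≤ J x y + J y x := by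
    intro x y
    have hk : 0 ≤ ‖x - y‖ ^ (-(2 * q)) := by positivity
    have h1 := hu0 x
    have h2 := hu0 y
    simp only [hJ]
    rw [norm_sub_rev y x, ← ENNReal.ofReal_add (by positivity) (by positivity)]
    refine ENNReal.ofReal_le_ofReal ?_
    rcases le_total (u x) (u y) with h | h
    · rw [min_eq_right h, min_eq_left h]
      nlinarith [mul_nonneg (mul_nonneg h1 h1) hk]
    · rw [min_eq_left h, min_eq_right h]
      nlinarith [mul_nonneg (mul_nonneg h2 h2) hk]
  have hin : ∀ x, ∫⁻ y, J x y ≤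
      ENNReal.ofReal (u x ^ p) * (1 + ENNReal.ofReal (2 ^ (n - q) * rieszMass n q)) := by
    intro x
    rcases (hu0 x).eq_or_lt with h0 | h0
    · simp [hJ, ← h0]
    set b := u x with hb
    have hbp : 0 < b ^ p := Real.rpow_pos_of_pos h0 _
    set g : EuclideanSpace ℝ (Fin n) → ℝ≥0∞ := fun w =>
      ENNReal.ofReal (‖w‖ ^ (-(2 * q)) * (1 + ‖w‖ ^ 2) ^ (-(n - q))) with hg
    have hgm : Measurable g := by fun_prop
    have hbn : 0 < b ^ (p / n) := Real.rpow_pos_of_pos h0 _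
    have hle : ∀ y, J x y ≤ ENNReal.ofReal (b ^ p) * ENNReal.ofReal (u y ^ p) +
        ENNReal.ofReal (b ^ p * b ^ p * 2 ^ (n - q)) * g (b ^ (p / n) • (x - y)) := by
      intro y
      have h2 : 0 ≤ u y ^ p := Real.rpow_nonneg (hu0 y) _
      simp only [hJ, hg]
      rw [← ENNReal.ofReal_mul hbp.le, ← ENNReal.ofReal_mul (by positivity),
        ← ENNReal.ofReal_add (by positivity) (by positivity), norm_smul, Real.norm_of_nonneg hbn.le]
      refine ENNReal.ofReal_le_ofReal ((min_mul_rpow_le hq hqn hp (hu0 y) h0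
        (norm_nonneg (x - y))).trans_eq ?_)
      ring
    refine (lintegral_mono hle).trans ?_
    rw [lintegral_add_left (by fun_prop), lintegral_const_mul _ (by fun_prop),
      lintegral_const_mul _ (by fun_prop), lintegral_comp_smul_sub g hgm hbn,
      lintegral_norm_rpow_mul_one_add_norm_sq_rpow hn hqn, ← Real.rpow_mul h0.le,
      ← ENNReal.ofReal_mul (by positivity), ← ENNReal.ofReal_mul (by positivity), mul_add,
      ← ENNReal.ofReal_mul hbp.le]
    refine add_le_add ?_ (ENNReal.ofReal_le_ofReal (le_of_eq ?_))
    · gcongr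
    · have : (n : ℝ) ≠ 0 := by linarith
      rw [show p / n * -(n : ℝ) = -p by field_simp, Real.rpow_neg h0.le]
      field_simp
  calc rieszEnergy q u ≤ ∫⁻ x, ∫⁻ y, (J x y + J y x) :=
        lintegral_mono fun x => lintegral_mono fun y => hpw x y
    _ = (∫⁻ x, ∫⁻ y, J x y) + ∫⁻ x, ∫⁻ y, J y x := by
        have hm : Measurable fun x => ∫⁻ y, J x y := hJm.lintegral_prod_right'
        rw [← lintegral_add_left hm]
        refine lintegral_congr fun x => lintegral_add_left ?_ _
        exact hJm.comp measurable_prodMk_left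
    _ = 2 * ∫⁻ x, ∫⁻ y, J x y := by
        rw [lintegral_lintegral_swap (f := fun x y => J y x)
          (hJm.comp measurable_swap).aemeasurable, two_mul]
    _ ≤ 2 * ∫⁻ x, ENNReal.ofReal (u x ^ p) *
          (1 + ENNReal.ofReal (2 ^ (n - q) * rieszMass n q)) := by
        gcongr with x
        exact hin x
    _ ≤ _ := by
        rw [lintegral_mul_const _ (by fun_prop)]
        gcongr
        exact mul_le_of_le_one_left zero_le hu1

end NonsharpBound

section Stereographic

variable {n : ℕ}

/-- The conformal factor of stereographic projection centred at `a` with scale `t`. -/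
def confFactor (t : ℝ) (a x : EuclideanSpace ℝ (Fin n)) : ℝ := t ^ 2 + ‖x - a‖ ^ 2

/-- The coordinates in `ℝ ^ (n + 1)` of inverse stereographic projection centred at `a` with
scale `t`. -/
def stereo (t : ℝ) (a : EuclideanSpace ℝ (Fin n)) : Option (Fin n) → EuclideanSpace ℝ (Fin n) → ℝ
  | none, x => (t ^ 2 - ‖x - a‖ ^ 2) / confFactor t a x
  | some i, x => 2 * t * (x i - a i) / confFactor t a x

theorem confFactor_pos {t : ℝ} (ht : 0 < t) (a x : EuclideanSpace ℝ (Fin n)) :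
    0 < confFactor t a x := by
  unfold confFactor; positivity

theorem measurable_confFactor (t : ℝ) (a : EuclideanSpace ℝ (Fin n)) :
    Measurable (confFactor t a) := by
  unfold confFactor; fun_prop

theorem measurable_stereo (t : ℝ) (a : EuclideanSpace ℝ (Fin n)) (i : Option (Fin n)) :
    Measurable (stereo t a i) := by
  have := measurable_confFactor t a
  rcases i with _ | i
  · unfold stereo; fun_prop
  · unfold stereo; fun_prop

theorem one_sub_sum_stereo {t : ℝ} (ht : 0 < t) (a x y : EuclideanSpace ℝ (Fin n)) :
    1 - ∑ i, stereo t a i x * stereo t a i y =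
      2 * t ^ 2 * ‖x - y‖ ^ 2 / (confFactor t a x * confFactor t a y) := by
  have hx := (confFactor_pos ht a x).ne'
  have hy := (confFactor_pos ht a y).ne'
  have h1 : ∑ i : Fin n, stereo t a (some i) x * stereo t a (some i) y =
      4 * t ^ 2 * (∑ i, (x i - a i) * (y i - a i)) / (confFactor t a x * confFactor t a y) := by
    rw [Finset.mul_sum, Finset.sum_div]
    refine Finset.sum_congr rfl fun i _ => ?_
    simp only [stereo]
    field_simp
    ring
  have h2 : ‖x - y‖ ^ 2 = ‖x - a‖ ^ 2 + ‖y - a‖ ^ 2 - 2 * ∑ i, (x i - a i) * (y i - a i) := by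
    simp only [EuclideanSpace.real_norm_sq_eq, Finset.mul_sum, ← Finset.sum_add_distrib,
      ← Finset.sum_sub_distrib, PiLp.sub_apply]
    exact Finset.sum_congr rfl fun i _ => by ring
  rw [Fintype.sum_option, h1, h2]
  simp only [stereo]
  field_simp
  simp only [confFactor]
  ring

theorem sum_stereo_sq {t : ℝ} (ht : 0 < t) (a x : EuclideanSpace ℝ (Fin n)) :
    ∑ i, stereo t a i x ^ 2 = 1 := by
  have h := one_sub_sum_stereo ht a x x
  simp only [sub_self, norm_zero] at h
  simp only [sq]
  simp only [ne_eq, OfNat.ofNat_ne_zero, not_false_eq_true, zero_pow, mul_zero, zero_div] at h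
  linarith

theorem lintegral_confFactor_rpow (hn : 1 ≤ n) {t : ℝ} (ht : 0 < t)
    (a : EuclideanSpace ℝ (Fin n)) :
    ∫⁻ x, ENNReal.ofReal (confFactor t a x ^ (-(n : ℝ))) =
      ENNReal.ofReal (t ^ (-(n : ℝ)) * sphereMass n) := by
  have e : ∀ x, ENNReal.ofReal (confFactor t a x ^ (-(n : ℝ))) =
      ENNReal.ofReal (t ^ (-(2 * n : ℝ))) *
      (fun y : EuclideanSpace ℝ (Fin n) => ENNReal.ofReal ((1 + ‖y‖ ^ 2) ^ (-(n : ℝ))))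
        (t⁻¹ • (a - x)) := fun x => by
    simp only
    rw [← ENNReal.ofReal_mul (by positivity), norm_smul, norm_inv, Real.norm_of_nonneg ht.le,
      show -(2 * n : ℝ) = 2 * -n by ring, Real.rpow_mul ht.le, Real.rpow_two,
      ← Real.mul_rpow (by positivity) (by positivity), norm_sub_rev, confFactor]
    congr 2
    field_simp
  rw [lintegral_congr e, lintegral_const_mul _ (by fun_prop),
    lintegral_comp_smul_sub
      (fun y : EuclideanSpace ℝ (Fin n) => ENNReal.ofReal ((1 + ‖y‖ ^ 2) ^ (-(n : ℝ))))
      (by fun_prop) (inv_pos.2 ht),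
    lintegral_one_add_norm_sq_rpow hn, ← ENNReal.ofReal_mul (by positivity),
    ← ENNReal.ofReal_mul (by positivity)]
  congr 1
  rw [← mul_assoc, Real.inv_rpow ht.le, Real.rpow_neg ht.le (n : ℝ), inv_inv,
    ← Real.rpow_add ht, ← Real.rpow_neg ht.le]
  congr 2
  ring

/-- The best constant in the Hardy-Littlewood-Sobolev inequality. -/
def hlsConst (n : ℕ) (q : ℝ) : ℝ := rieszMass n q * sphereMass n ^ (2 * q / n - 1)

theorem hlsConst_pos (hn : 1 ≤ n) {q : ℝ} (hqn : 2 * q < n) : 0 < hlsConst n q :=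
  mul_pos (rieszMass_pos hqn) (Real.rpow_pos_of_pos (sphereMass_pos hn) _)

theorem one_lt_of_mul_sub_eq {p q : ℝ} (hq : 0 < q) (hqn : 2 * q < n) (hp : p * (n - q) = n) :
    1 < p := by
  by_contra! hcon
  nlinarith

theorem lt_two_of_mul_sub_eq {p q : ℝ} (hqn : 2 * q < n) (hp : p * (n - q) = n) :
    p < 2 := by
  by_contra! hcon
  nlinarith

theorem holderConjugate_of_mul_sub_eq {p q : ℝ} (hq : 0 < q) (hqn : 2 * q < n)
    (hp : p * (n - q) = n) : p.HolderConjugate (n / q) := by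
  have hp1 := one_lt_of_mul_sub_eq hq hqn hp
  rw [Real.holderConjugate_iff]
  refine ⟨hp1, ?_⟩
  have : p ≠ 0 := by linarith
  have hn : (n : ℝ) ≠ 0 := by linarith
  field_simp
  linarith

variable {N : ℝ}

/-- Lebesgue measure restricted to the ball of radius `N` about the origin. -/
abbrev ballMeasure (n : ℕ) (N : ℝ) : Measure (EuclideanSpace ℝ (Fin n)) :=
  volume.restrict (Metric.ball 0 N)

instance isFiniteMeasure_ballMeasure (n : ℕ) (N : ℝ) : IsFiniteMeasure (ballMeasure n N) :=
  ⟨by simpa using measure_ball_lt_top⟩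

theorem sq_integral_mul_confFactor_le (hn : 1 ≤ n) {p q t K : ℝ} (hq : 0 < q) (hqn : 2 * q < n)
    (hp : p * (n - q) = n) (ht : 0 < t) (a : EuclideanSpace ℝ (Fin n))
    {u : EuclideanSpace ℝ (Fin n) → ℝ} (hu : Measurable u) (hu0 : ∀ x, 0 ≤ u x)
    (huK : ∀ x, u x ≤ K) :
    t ^ (2 * q) * rieszMass n q / sphereMass n * (∫ x, u x * confFactor t a x ^ (-q) ∂(ballMeasure n N)) ^ 2 ≤
      hlsConst n q * (∫ x, u x ^ p ∂(ballMeasure n N)) ^ (2 / p) := by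
  have hn0 : (0 : ℝ) < n := by exact_mod_cast hn
  have hρ := fun x => confFactor_pos ht a x
  have hρm := measurable_confFactor t a
  have hρb : ∀ x, confFactor t a x ^ (-q) ≤ (t ^ 2) ^ (-q) := fun x =>
    Real.rpow_le_rpow_of_nonpos (by positivity) (by unfold confFactor; nlinarith [sq_nonneg ‖x - a‖])
      (by linarith)
  have hZ := sphereMass_pos hn
  have hW := rieszMass_pos hqn
  have hp0 : 0 < p := by linarith [one_lt_of_mul_sub_eq hq hqn hp]
  have hH := integral_mul_le_Lp_mul_Lq_of_nonneg (μ := ballMeasure n N)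
    (holderConjugate_of_mul_sub_eq hq hqn hp) (f := u) (g := fun x => confFactor t a x ^ (-q))
    (ae_of_all _ hu0) (ae_of_all _ fun x => Real.rpow_nonneg (hρ x).le _)
    (MemLp.of_bound hu.aestronglyMeasurable K (ae_of_all _ fun x => by
      rw [Real.norm_of_nonneg (hu0 x)]; exact huK x))
    (MemLp.of_bound (hρm.pow_const _).aestronglyMeasurable ((t ^ 2) ^ (-q)) (ae_of_all _ fun x => by
      rw [Real.norm_of_nonneg (Real.rpow_nonneg (hρ x).le _)]; exact hρb x))
  have e1 : ∀ x, (confFactor t a x ^ (-q)) ^ ((n : ℝ) / q) = confFactor t a x ^ (-(n : ℝ)) :=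
    fun x => by
      rw [← Real.rpow_mul (hρ x).le]; congr 1; field_simp
  simp_rw [e1] at hH
  have h2 : ∫ x, confFactor t a x ^ (-(n : ℝ)) ∂(ballMeasure n N) ≤ t ^ (-(n : ℝ)) * sphereMass n := by
    rw [integral_eq_lintegral_of_nonneg_ae (ae_of_all _ fun x => Real.rpow_nonneg (hρ x).le _)
      (hρm.pow_const _).aestronglyMeasurable]
    refine ENNReal.toReal_le_of_le_ofReal (by positivity) ?_
    rw [← lintegral_confFactor_rpow hn ht a]
    exact setLIntegral_le_lintegral _ _
  have hU : 0 ≤ ∫ x, u x ^ p ∂(ballMeasure n N) := integral_nonneg fun x => Real.rpow_nonneg (hu0 x) _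
  have hI0 : 0 ≤ ∫ x, u x * confFactor t a x ^ (-q) ∂(ballMeasure n N) :=
    integral_nonneg fun x => mul_nonneg (hu0 x) (Real.rpow_nonneg (hρ x).le _)
  have h3 : (∫ x, u x * confFactor t a x ^ (-q) ∂(ballMeasure n N)) ^ 2 ≤
      (∫ x, u x ^ p ∂(ballMeasure n N)) ^ (2 / p) * (t ^ (-(2 * q)) * sphereMass n ^ (2 * q / n)) := by
    have h4 : (∫ x, u x * confFactor t a x ^ (-q) ∂(ballMeasure n N)) ≤ (∫ x, u x ^ p ∂(ballMeasure n N)) ^ (1 / p) *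
        (t ^ (-(n : ℝ)) * sphereMass n) ^ (1 / ((n : ℝ) / q)) :=
      hH.trans (mul_le_mul_of_nonneg_left (Real.rpow_le_rpow (integral_nonneg fun x =>
        Real.rpow_nonneg (hρ x).le _) h2 (by positivity)) (by positivity))
    refine (pow_le_pow_left₀ hI0 h4 2).trans_eq ?_
    rw [mul_pow, ← Real.rpow_natCast (_ ^ (1 / p)), ← Real.rpow_mul hU,
      ← Real.rpow_natCast (_ ^ (1 / ((n : ℝ) / q))), ← Real.rpow_mul (by positivity),
      Real.mul_rpow (by positivity) hZ.le, ← Real.rpow_mul ht.le]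
    push_cast
    congr 2
    · ring
    · congr 1; field_simp
    · congr 1; field_simp
  calc _ ≤ t ^ (2 * q) * rieszMass n q / sphereMass n * ((∫ x, u x ^ p ∂(ballMeasure n N)) ^ (2 / p) *
        (t ^ (-(2 * q)) * sphereMass n ^ (2 * q / n))) := by gcongr
    _ = _ := by
      rw [hlsConst, Real.rpow_neg ht.le, Real.rpow_sub hZ, Real.rpow_one]
      have : 0 < t ^ (2 * q) := Real.rpow_pos_of_pos ht _
      field_simp

theorem ae_prod_fst_ne_snd (hn : 1 ≤ n) : ∀ᵐ z ∂((ballMeasure n N).prod (ballMeasure n N)), z.1 ≠ z.2 := by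
  have : Nonempty (Fin n) := ⟨⟨0, by omega⟩⟩
  rw [Measure.ae_prod_iff_ae_ae (p := fun z => z.1 ≠ z.2)
    (measurableSet_eq_fun measurable_fst measurable_snd).compl]
  exact ae_of_all _ fun x => by simpa [eq_comm] using Measure.ae_ne (ballMeasure n N) x

theorem integrable_rieszKernel (hn : 1 ≤ n) {q : ℝ} (hq : 0 < q) (hqn : 2 * q < n) :
    Integrable (fun z : EuclideanSpace ℝ (Fin n) × EuclideanSpace ℝ (Fin n) =>
      ‖z.1 - z.2‖ ^ (-(2 * q))) ((ballMeasure n N).prod (ballMeasure n N)) := by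
  have hn0 : (0 : ℝ) < n := by exact_mod_cast hn
  have hnq : 0 < n - q := by linarith
  obtain ⟨p, hp⟩ : ∃ p : ℝ, p * (n - q) = n := ⟨n / (n - q), by field_simp⟩
  have hp0 : 0 < p := by linarith [one_lt_of_mul_sub_eq hq hqn hp]
  set V : ℝ := (volume (Metric.ball (0 : EuclideanSpace ℝ (Fin n)) N)).toReal with hV
  have hV0 : 0 ≤ V := ENNReal.toReal_nonneg
  set c : ℝ := (1 + V) ^ (-(1 / p)) with hc
  have hc0 : 0 < c := by positivity
  have hcp : c ^ p = (1 + V)⁻¹ := by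
    rw [hc, ← Real.rpow_mul (by positivity), show -(1 / p) * p = -1 by field_simp, Real.rpow_neg_one]
  have hA := rieszEnergy_le_of_lintegral_le_one hn hq hqn hp
    (u := (Metric.ball 0 N).indicator fun _ => c) (measurable_const.indicator measurableSet_ball)
    (fun x => Set.indicator_nonneg (fun _ _ => hc0.le) x) (by
      have e : ∀ x, ENNReal.ofReal ((Metric.ball 0 N).indicator (fun _ => c) x ^ p) =
          (Metric.ball (0 : EuclideanSpace ℝ (Fin n)) N).indicator
            (fun _ => ENNReal.ofReal (c ^ p)) x := fun x => by
        by_cases hx : x ∈ Metric.ball 0 N <;> simp [Set.indicator, hx, Real.zero_rpow hp0.ne']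
      simp_rw [e]
      rw [lintegral_indicator measurableSet_ball, setLIntegral_const,
        ← ENNReal.ofReal_toReal measure_ball_lt_top.ne, ← ENNReal.ofReal_mul (by positivity), hcp,
        ← ENNReal.ofReal_one]
      refine ENNReal.ofReal_le_ofReal ?_
      rw [inv_mul_le_iff₀ (by positivity)]
      linarith)
  rw [← lintegral_ofReal_ne_top_iff_integrable (Measurable.aestronglyMeasurable (by fun_prop))
    (ae_of_all _ fun z => by positivity)]
  have e2 : rieszEnergy q ((Metric.ball (0 : EuclideanSpace ℝ (Fin n)) N).indicator fun _ => c) =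
      ENNReal.ofReal (c * c) * ∫⁻ z, ENNReal.ofReal (‖z.1 - z.2‖ ^ (-(2 * q)))
        ∂((ballMeasure n N).prod (ballMeasure n N)) := by
    rw [lintegral_prod _ (Measurable.aemeasurable (by fun_prop)), rieszEnergy,
      ← lintegral_const_mul _ (by fun_prop), ← lintegral_indicator measurableSet_ball]
    refine lintegral_congr fun x => ?_
    by_cases hx : x ∈ Metric.ball 0 N
    · simp only [Set.indicator_of_mem hx]
      rw [← lintegral_const_mul _ (by fun_prop),
        ← lintegral_indicator measurableSet_ball]
      refine lintegral_congr fun y => ?_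
      by_cases hy : y ∈ Metric.ball 0 N
      · simp only [Set.indicator_of_mem hy]
        rw [ENNReal.ofReal_mul (by positivity)]
      · simp [Set.indicator_of_notMem hy]
    · simp [Set.indicator_of_notMem hx]
  rw [e2] at hA
  intro htop
  rw [htop, ENNReal.mul_top (by simpa using (mul_pos hc0 hc0))] at hA
  exact (lt_of_le_of_lt hA (ENNReal.mul_lt_top (by simp) (by simp))).ne rfl

theorem integrable_rieszKernel_mul (hn : 1 ≤ n) {q : ℝ} (hq : 0 < q) (hqn : 2 * q < n)
    {φ : EuclideanSpace ℝ (Fin n) × EuclideanSpace ℝ (Fin n) → ℝ} (hφ : Measurable φ) {K : ℝ}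
    (hK : ∀ z, |φ z| ≤ K) :
    Integrable (fun z => φ z * ‖z.1 - z.2‖ ^ (-(2 * q))) ((ballMeasure n N).prod (ballMeasure n N)) :=
  (integrable_rieszKernel hn hq hqn).bdd_mul (c := K) hφ.aestronglyMeasurable (ae_of_all _ hK)

end Stereographic

section ConformalInequality

variable {n : ℕ}

/-- The Riesz energy of a bounded function on the ball of radius `N`. -/
def rieszForm (q N : ℝ) (v : EuclideanSpace ℝ (Fin n) → ℝ) : ℝ :=
  ∫ z, v z.1 * v z.2 * ‖z.1 - z.2‖ ^ (-(2 * q)) ∂((ballMeasure n N).prod (ballMeasure n N))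

theorem integrable_rieszForm (hn : 1 ≤ n) {q N : ℝ} (hq : 0 < q) (hqn : 2 * q < n)
    {v : EuclideanSpace ℝ (Fin n) → ℝ} (hv : Measurable v) {K : ℝ} (hK : ∀ x, |v x| ≤ K) :
    Integrable (fun z : EuclideanSpace ℝ (Fin n) × EuclideanSpace ℝ (Fin n) =>
      v z.1 * v z.2 * ‖z.1 - z.2‖ ^ (-(2 * q))) ((ballMeasure n N).prod (ballMeasure n N)) :=
  integrable_rieszKernel_mul (φ := fun z => v z.1 * v z.2) (K := K * K) hn hq hqn (by fun_prop)
    fun z => by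
      rw [abs_mul]
      exact mul_le_mul (hK _) (hK _) (abs_nonneg _) ((abs_nonneg _).trans (hK z.1))

theorem abs_stereo_le_one {t : ℝ} (ht : 0 < t) (a : EuclideanSpace ℝ (Fin n))
    (i : Option (Fin n)) (x : EuclideanSpace ℝ (Fin n)) : |stereo t a i x| ≤ 1 := by
  refine abs_le_one_iff_mul_self_le_one.2 ?_
  rw [← sum_stereo_sq ht a x, ← sq]
  exact Finset.single_le_sum (f := fun i => stereo t a i x ^ 2) (fun _ _ => sq_nonneg _)
    (Finset.mem_univ i)

theorem exists_conformal_inequality (hn : 1 ≤ n) {p q : ℝ} (hq : 0 < q) (hqn : 2 * q < n)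
    (hp : p * (n - q) = n) :
    ∃ C, 0 < C ∧ ∀ (N K t : ℝ) (a : EuclideanSpace ℝ (Fin n)) (u : EuclideanSpace ℝ (Fin n) → ℝ),
      0 < t → Measurable u → (∀ x, 0 ≤ u x) → (∀ x, u x ≤ K) →
      rieszForm q N u - hlsConst n q * (∫ x, u x ^ p ∂(ballMeasure n N)) ^ (2 / p) ≤
        C * ((n - q) * ∑ i, rieszForm q N (fun x => u x * stereo t a i x) -
          q * rieszForm q N u) := by
  obtain ⟨C, hC, H⟩ := exists_form_inequality hq hqn
  obtain ⟨m, b, hm0, hm1, hm2, hb, hbL⟩ := exists_zonal_moments hn hq hqn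
  refine ⟨C, hC, fun N K t a u ht hu hu0 huK => ?_⟩
  have hρ := fun x => confFactor_pos ht a x
  have hρm := measurable_confFactor t a
  have hT : (0 : ℝ) < (2 * t ^ 2) ^ q := by positivity
  have huK' : ∀ x, |u x| ≤ K := fun x => by rw [abs_of_nonneg (hu0 x)]; exact huK x
  have key : ∀ x y, (u x * confFactor t a x ^ (-q)) * (u y * confFactor t a y ^ (-q)) *
      (1 - ∑ i, stereo t a i x * stereo t a i y) ^ (-q) =
      ((2 * t ^ 2) ^ q)⁻¹ * (u x * u y * ‖x - y‖ ^ (-(2 * q))) := fun x y => by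
    rw [one_sub_sum_stereo ht, Real.div_rpow (by positivity) (mul_pos (hρ x) (hρ y)).le,
      Real.mul_rpow (hρ x).le (hρ y).le, Real.mul_rpow (by positivity) (by positivity),
      Real.rpow_neg (x := 2 * t ^ 2) (by positivity), ← Real.rpow_natCast ‖x - y‖,
      ← Real.rpow_mul (norm_nonneg _)]
    have h1 := Real.rpow_pos_of_pos (hρ x) (-q)
    have h2 := Real.rpow_pos_of_pos (hρ y) (-q)
    push_cast
    rw [show (2 : ℝ) * -q = -(2 * q) by ring]
    field_simp
  have hI := integrable_rieszForm (N := N) hn hq hqn hu huK'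
  have hω : ∀ i, Measurable (stereo t a i) := measurable_stereo t a
  have hωI : ∀ i, Integrable (fun z : EuclideanSpace ℝ (Fin n) × EuclideanSpace ℝ (Fin n) =>
      (u z.1 * stereo t a i z.1) * (u z.2 * stereo t a i z.2) * ‖z.1 - z.2‖ ^ (-(2 * q)))
      ((ballMeasure n N).prod (ballMeasure n N)) := fun i =>
    integrable_rieszForm (v := fun x => u x * stereo t a i x) (K := K) hn hq hqn
      (hu.mul (hω i)) fun x => by
        rw [abs_mul]
        exact (mul_le_of_le_one_right (abs_nonneg _) (abs_stereo_le_one ht a i x)).trans (huK' x)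
  have h := H (ballMeasure n N) (stereo t a) (fun x => u x * confFactor t a x ^ (-q))
    (K * (t ^ 2) ^ (-q)) m b _ (by simp) hω (sum_stereo_sq ht a) (by fun_prop)
    (fun x => by
      rw [abs_of_nonneg (mul_nonneg (hu0 x) (Real.rpow_nonneg (hρ x).le _))]
      refine mul_le_mul (huK x) ?_ (Real.rpow_nonneg (hρ x).le _) ((hu0 x).trans (huK x))
      exact Real.rpow_le_rpow_of_nonpos (by positivity)
        (by unfold confFactor; nlinarith [sq_nonneg ‖x - a‖]) (by linarith))
    hm0 hm1 hm2 hb hbL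
    (by
      filter_upwards [ae_prod_fst_ne_snd hn] with z hz h1
      have h2 := one_sub_sum_stereo ht a z.1 z.2
      rw [h1, sub_self] at h2
      have h3 : 0 < ‖z.1 - z.2‖ := norm_pos_iff.2 (sub_ne_zero.2 hz)
      have := mul_pos (hρ z.1) (hρ z.2)
      have : 0 < 2 * t ^ 2 * ‖z.1 - z.2‖ ^ 2 / (confFactor t a z.1 * confFactor t a z.2) := by
        positivity
      linarith)
    (by simp_rw [key]; exact hI.const_mul _)
  have e1 : (∫ z, (u z.1 * confFactor t a z.1 ^ (-q)) * (u z.2 * confFactor t a z.2 ^ (-q)) *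
      (1 - ∑ i, stereo t a i z.1 * stereo t a i z.2) ^ (-q)
      ∂((ballMeasure n N).prod (ballMeasure n N))) = ((2 * t ^ 2) ^ q)⁻¹ * rieszForm q N u := by
    simp_rw [key]
    rw [integral_const_mul, rieszForm]
  have e2 : (∫ z, (u z.1 * confFactor t a z.1 ^ (-q)) * (u z.2 * confFactor t a z.2 ^ (-q)) *
      ((n * (∑ i, stereo t a i z.1 * stereo t a i z.2) -
        q * (1 + ∑ i, stereo t a i z.1 * stereo t a i z.2)) *
      (1 - ∑ i, stereo t a i z.1 * stereo t a i z.2) ^ (-q))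
      ∂((ballMeasure n N).prod (ballMeasure n N))) = ((2 * t ^ 2) ^ q)⁻¹ *
        ((n - q) * ∑ i, rieszForm q N (fun x => u x * stereo t a i x) - q * rieszForm q N u) := by
    simp only [rieszForm]
    rw [← integral_finsetSum _ fun i _ => hωI i, ← integral_const_mul, ← integral_const_mul,
      ← integral_sub ((integrable_finsetSum _ fun i _ => hωI i).const_mul _) (hI.const_mul _),
      ← integral_const_mul]
    refine integral_congr_ae (ae_of_all _ fun z => ?_)
    have hk := key z.1 z.2
    have hs : ∑ i, u z.1 * stereo t a i z.1 * (u z.2 * stereo t a i z.2) *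
        ‖z.1 - z.2‖ ^ (-(2 * q)) = (u z.1 * u z.2 * ‖z.1 - z.2‖ ^ (-(2 * q))) *
        ∑ i, stereo t a i z.1 * stereo t a i z.2 := by
      rw [Finset.mul_sum]
      exact Finset.sum_congr rfl fun i _ => by ring
    simp only
    rw [hs]
    linear_combination (n * (∑ i, stereo t a i z.1 * stereo t a i z.2) -
        q * (1 + ∑ i, stereo t a i z.1 * stereo t a i z.2)) * hk
  rw [e1, e2] at h
  have h5 := sq_integral_mul_confFactor_le (N := N) hn hq hqn hp ht a hu hu0 huK
  have h6 : (2 * t ^ 2) ^ q * (2 ^ (-q) * rieszMass n q / sphereMass n) =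
      t ^ (2 * q) * rieszMass n q / sphereMass n := by
    rw [Real.mul_rpow (by positivity) (by positivity), Real.rpow_neg (by positivity),
      ← Real.rpow_natCast t, ← Real.rpow_mul ht.le]
    have : (0 : ℝ) < 2 ^ q := by positivity
    push_cast
    field_simp
  have h7 := mul_le_mul_of_nonneg_left h hT.le
  have h8 : (2 * t ^ 2) ^ q * ((2 * t ^ 2) ^ q)⁻¹ = 1 := mul_inv_cancel₀ hT.ne'
  calc _ ≤ rieszForm q N u - t ^ (2 * q) * rieszMass n q / sphereMass n *
        (∫ x, u x * confFactor t a x ^ (-q) ∂(ballMeasure n N)) ^ 2 := by linarith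
    _ = (2 * t ^ 2) ^ q * (((2 * t ^ 2) ^ q)⁻¹ * rieszForm q N u -
        2 ^ (-q) * rieszMass n q / sphereMass n *
        (∫ x, u x * confFactor t a x ^ (-q) ∂(ballMeasure n N)) ^ 2) := by
      rw [← h6]; linear_combination (-rieszForm q N u) * h8
    _ ≤ _ := h7
    _ = _ := by linear_combination (C * ((n - q) *
        ∑ i, rieszForm q N (fun x => u x * stereo t a i x) - q * rieszForm q N u)) * h8

end ConformalInequality

section Centering

variable {n : ℕ}

theorem exists_confFactor_div_eq {t δ : ℝ} (ht : 0 < t) (hδ : |δ| < 1)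
    (a : EuclideanSpace ℝ (Fin n)) (i : Option (Fin n)) :
    ∃ (t' : ℝ) (a' : EuclideanSpace ℝ (Fin n)), 0 < t' ∧ ∀ x, confFactor t' a' x / t' =
      confFactor t a x / t * ((1 + δ * stereo t a i x) / √(1 - δ ^ 2)) := by
  obtain ⟨h1, h2⟩ := abs_lt.1 hδ
  have hs : 0 < 1 - δ ^ 2 := by nlinarith
  have hs2 : √(1 - δ ^ 2) ^ 2 = 1 - δ ^ 2 := Real.sq_sqrt hs.le
  have hs0 : 0 < √(1 - δ ^ 2) := Real.sqrt_pos.2 hs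
  have hd : 0 < 1 - δ := by linarith
  rcases i with _ | i
  · refine ⟨t * (√(1 - δ ^ 2) / (1 - δ)), a, by positivity, fun x => ?_⟩
    have hρ := (confFactor_pos ht a x).ne'
    simp only [stereo]
    rw [mul_div_assoc']
    field_simp
    simp only [confFactor, mul_pow, div_pow, hs2]
    field_simp
    ring
  · refine ⟨t * √(1 - δ ^ 2), a - (t * δ) • EuclideanSpace.single i (1 : ℝ), by positivity,
      fun x => ?_⟩
    have hρ := (confFactor_pos ht a x).ne'
    have e : ‖x - (a - (t * δ) • EuclideanSpace.single i (1 : ℝ))‖ ^ 2 =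
        ‖x - a‖ ^ 2 + 2 * t * δ * (x i - a i) + t ^ 2 * δ ^ 2 := by
      rw [← sub_add, norm_add_sq_real, norm_smul, inner_smul_right,
        EuclideanSpace.inner_single_right]
      simp only [PiLp.sub_apply, PiLp.norm_single, norm_one, mul_one, mul_pow,
        Real.norm_eq_abs, sq_abs, abs_mul, map_sub, conj_trivial, one_mul]
      ring
    simp only [stereo]
    field_simp
    simp only [confFactor, e, mul_pow, hs2]
    ring

theorem lintegral_norm_sub_rpow_ballMeasure_le (hn : 1 ≤ n) {q : ℝ} (hq : 0 < q)
    (hqn : 2 * q < n) (N : ℝ) (a : EuclideanSpace ℝ (Fin n)) :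
    ∫⁻ x, ENNReal.ofReal (‖x - a‖ ^ (-(2 * q))) ∂(ballMeasure n N) ≤
      ballMeasure n N Set.univ + ENNReal.ofReal (2 ^ (n - q) * rieszMass n q) := by
  have hnq : 0 < n - q := by linarith
  obtain ⟨p, hp⟩ : ∃ p : ℝ, p * (n - q) = n := ⟨n / (n - q), by field_simp⟩
  have h1 : ∀ x, ENNReal.ofReal (‖x - a‖ ^ (-(2 * q))) ≤ 1 + ENNReal.ofReal (2 ^ (n - q)) *
      ENNReal.ofReal (‖x - a‖ ^ (-(2 * q)) * (1 + ‖x - a‖ ^ 2) ^ (-(n - q))) := fun x => by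
    rw [← ENNReal.ofReal_one, ← ENNReal.ofReal_mul (by positivity),
      ← ENNReal.ofReal_add (by positivity) (by positivity)]
    refine ENNReal.ofReal_le_ofReal ?_
    simpa using min_one_mul_rpow_le hq hqn hp zero_le_one (norm_nonneg (x - a))
  refine (lintegral_mono h1).trans ?_
  rw [lintegral_add_left measurable_const, lintegral_const, one_mul,
    lintegral_const_mul _ (by fun_prop), ENNReal.ofReal_mul (by positivity),
    ← lintegral_norm_rpow_mul_one_add_norm_sq_rpow hn hqn,
    ← lintegral_sub_right_eq_self (fun x : EuclideanSpace ℝ (Fin n) =>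
      ENNReal.ofReal (‖x‖ ^ (-(2 * q)) * (1 + ‖x‖ ^ 2) ^ (-(n - q)))) a]
  gcongr
  exact Measure.restrict_le_self

theorem neg_rpow_div_le_log_confFactor {q t : ℝ} (hq : 0 < q) (ht : 0 < t)
    {a x : EuclideanSpace ℝ (Fin n)} (hx : x ≠ a) :
    -(‖x - a‖ ^ (-(2 * q)) / (2 * q)) ≤ Real.log (confFactor t a x / t) := by
  have hr : 0 < ‖x - a‖ := norm_pos_iff.2 (sub_ne_zero.2 hx)
  have h1 : ‖x - a‖ ≤ confFactor t a x / t := by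
    rw [le_div_iff₀ ht, confFactor]
    nlinarith [sq_nonneg (t - ‖x - a‖), mul_pos ht hr]
  have h2 := Real.log_le_rpow_div (inv_nonneg.2 hr.le) (show 0 < 2 * q by positivity)
  rw [Real.log_inv, Real.inv_rpow hr.le, ← Real.rpow_neg hr.le] at h2
  have h3 := Real.log_le_log hr h1
  linarith

variable {N : ℝ} {w : EuclideanSpace ℝ (Fin n) → ℝ} {M : ℝ}

theorem integrable_mul_log_confFactor (hw : Measurable w) (hwM : ∀ x, |w x| ≤ M) {t : ℝ}
    (ht : 0 < t) (a : EuclideanSpace ℝ (Fin n)) :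
    Integrable (fun x => w x * Real.log (confFactor t a x / t)) (ballMeasure n N) := by
  have h1 : Continuous fun x => Real.log (confFactor t a x / t) := by
    refine Continuous.log ?_ fun x => (div_pos (confFactor_pos ht a x) ht).ne'
    unfold confFactor
    fun_prop
  have h2 : Integrable (fun x => Real.log (confFactor t a x / t)) (ballMeasure n N) :=
    (h1.continuousOn.integrableOn_compact (isCompact_closedBall 0 N)).mono_set
      Metric.ball_subset_closedBall
  exact h2.bdd_mul (c := M) hw.aestronglyMeasurable (ae_of_all _ hwM)

theorem exists_le_integral_mul_log_confFactor (hn : 1 ≤ n) (hw : Measurable w)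
    (hw0 : ∀ x, 0 ≤ w x) (hwM : ∀ x, w x ≤ M) :
    ∃ B, ∀ (t : ℝ) (a : EuclideanSpace ℝ (Fin n)), 0 < t →
      B ≤ ∫ x, w x * Real.log (confFactor t a x / t) ∂(ballMeasure n N) := by
  have : Nonempty (Fin n) := ⟨⟨0, by omega⟩⟩
  obtain ⟨q, hq, hqn⟩ : ∃ q : ℝ, 0 < q ∧ 2 * q < n := by
    have : (1 : ℝ) ≤ n := by exact_mod_cast hn
    exact ⟨1 / 4, by norm_num, by linarith⟩
  have hW := rieszMass_pos hqn
  set V : ℝ := (ballMeasure n N).real Set.univ + 2 ^ (n - q) * rieszMass n q with hV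
  have hV0 : 0 ≤ V := by positivity
  have hM0 : 0 ≤ M := (hw0 0).trans (hwM 0)
  refine ⟨-(M / (2 * q)) * V, fun t a ht => ?_⟩
  have hb := lintegral_norm_sub_rpow_ballMeasure_le hn hq hqn N a
  have hb' : ∫⁻ x, ENNReal.ofReal (‖x - a‖ ^ (-(2 * q))) ∂(ballMeasure n N) ≤
      ENNReal.ofReal V := by
    rw [hV, ENNReal.ofReal_add (by positivity) (by positivity), ofReal_measureReal]
    exact hb
  have hI : Integrable (fun x => ‖x - a‖ ^ (-(2 * q))) (ballMeasure n N) := by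
    rw [← lintegral_ofReal_ne_top_iff_integrable (Measurable.aestronglyMeasurable (by fun_prop))
      (ae_of_all _ fun z => by positivity)]
    exact (hb'.trans_lt ENNReal.ofReal_lt_top).ne
  have hIV : ∫ x, ‖x - a‖ ^ (-(2 * q)) ∂(ballMeasure n N) ≤ V := by
    rw [integral_eq_lintegral_of_nonneg_ae (ae_of_all _ fun z => by positivity) hI.1]
    exact ENNReal.toReal_le_of_le_ofReal hV0 hb'
  calc -(M / (2 * q)) * V ≤ -(M / (2 * q)) * ∫ x, ‖x - a‖ ^ (-(2 * q)) ∂(ballMeasure n N) :=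
        mul_le_mul_of_nonpos_left hIV (by rw [neg_nonpos]; positivity)
    _ = ∫ x, -(M / (2 * q)) * ‖x - a‖ ^ (-(2 * q)) ∂(ballMeasure n N) :=
        (integral_const_mul _ _).symm
    _ ≤ _ := by
      refine integral_mono_ae (hI.const_mul _) (integrable_mul_log_confFactor hw (M := M)
        (fun x => by rw [abs_of_nonneg (hw0 x)]; exact hwM x) ht a) ?_
      filter_upwards [Measure.ae_ne (ballMeasure n N) a] with x hx
      have h1 := mul_le_mul_of_nonneg_left (neg_rpow_div_le_log_confFactor hq ht hx) (hw0 x)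
      have h2 : 0 ≤ ‖x - a‖ ^ (-(2 * q)) / (2 * q) := by positivity
      have h3 := mul_le_mul_of_nonneg_right (hwM x) h2
      calc -(M / (2 * q)) * ‖x - a‖ ^ (-(2 * q)) = -(M * (‖x - a‖ ^ (-(2 * q)) / (2 * q))) := by
            ring
        _ ≤ _ := by linarith

/-- Almost centering of a bounded probability density by a conformal map. -/
theorem exists_abs_integral_mul_stereo_le (hn : 1 ≤ n) (hw : Measurable w)
    (hw0 : ∀ x, 0 ≤ w x) (hwM : ∀ x, w x ≤ M) (hw1 : ∫ x, w x ∂(ballMeasure n N) = 1)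
    {ε : ℝ} (hε : 0 < ε) :
    ∃ (t : ℝ) (a : EuclideanSpace ℝ (Fin n)), 0 < t ∧
      ∀ i, |∫ x, w x * stereo t a i x ∂(ballMeasure n N)| ≤ ε := by
  have hwM' : ∀ x, |w x| ≤ M := fun x => by rw [abs_of_nonneg (hw0 x)]; exact hwM x
  have hwI : Integrable w (ballMeasure n N) :=
    Integrable.of_bound hw.aestronglyMeasurable M (ae_of_all _ hwM')
  obtain ⟨B, hB⟩ := exists_le_integral_mul_log_confFactor (N := N) hn hw hw0 hwM
  set Φ : ℝ → EuclideanSpace ℝ (Fin n) → ℝ := fun t a =>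
    ∫ x, w x * Real.log (confFactor t a x / t) ∂(ballMeasure n N) with hΦ
  set R : Set ℝ := {r | ∃ (t : ℝ) (a : EuclideanSpace ℝ (Fin n)), 0 < t ∧ Φ t a = r} with hR
  have hRb : BddBelow R := ⟨B, by rintro _ ⟨t, a, ht, rfl⟩; exact hB t a ht⟩
  obtain ⟨δ, hδ0, hδ1, hδε⟩ : ∃ δ : ℝ, 0 < δ ∧ δ ≤ 1 / 2 ∧ 2 * δ ≤ ε :=
    ⟨min (1 / 2) (ε / 2), by positivity, min_le_left _ _,
      by linarith [min_le_right (1 / 2) (ε / 2)]⟩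
  obtain ⟨_, ⟨t, a, ht, rfl⟩, hlt⟩ := exists_lt_of_csInf_lt (s := R) ⟨_, 1, 0, one_pos, rfl⟩
    (lt_add_of_pos_right (sInf R) (show 0 < δ ^ 2 by positivity))
  have hmin : ∀ t' a', 0 < t' → Φ t a ≤ Φ t' a' + δ ^ 2 := fun t' a' ht' => by
    have := csInf_le hRb ⟨t', a', ht', rfl⟩
    linarith
  refine ⟨t, a, ht, fun i => ?_⟩
  have hωI : Integrable (fun x => w x * stereo t a i x) (ballMeasure n N) :=
    hwI.mul_bdd (c := 1) (measurable_stereo t a i).aestronglyMeasurable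
      (ae_of_all _ fun x => abs_stereo_le_one ht a i x)
  have key : ∀ d : ℝ, |d| = δ → -2 * δ ^ 2 ≤
      d * ∫ x, w x * stereo t a i x ∂(ballMeasure n N) := fun d hd => by
    have hd2 : d ^ 2 = δ ^ 2 := by rw [← sq_abs, hd]
    have hd1 : |d| < 1 := by linarith
    obtain ⟨t', a', ht', he⟩ := exists_confFactor_div_eq ht hd1 a i
    have hs : 1 / 2 ≤ 1 - d ^ 2 := by nlinarith
    have hlog : -(2 * δ ^ 2) ≤ Real.log (1 - d ^ 2) := by
      have h1 := Real.one_sub_inv_le_log_of_pos (show 0 < 1 - d ^ 2 by linarith)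
      have h2 : (1 - d ^ 2)⁻¹ ≤ 1 + 2 * δ ^ 2 := by
        rw [inv_le_iff_one_le_mul₀ (by linarith), ← hd2]
        nlinarith [sq_nonneg d]
      linarith
    have h1 : Φ t' a' ≤ Φ t a + d * (∫ x, w x * stereo t a i x ∂(ballMeasure n N)) + δ ^ 2 := by
      calc Φ t' a' ≤ ∫ x, (w x * Real.log (confFactor t a x / t) +
            d * (w x * stereo t a i x) + δ ^ 2 * w x) ∂(ballMeasure n N) := by
            refine integral_mono (integrable_mul_log_confFactor hw hwM' ht' a')
              (((integrable_mul_log_confFactor hw hwM' ht a).add (hωI.const_mul d)).add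
                (hwI.const_mul _)) fun x => ?_
            have hω := abs_stereo_le_one ht a i x
            have h3 : |d * stereo t a i x| ≤ 1 / 2 := by
              rw [abs_mul, hd]
              nlinarith [abs_nonneg (stereo t a i x)]
            have h4 : 0 < 1 + d * stereo t a i x := by linarith [(abs_le.1 h3).1]
            have h5 := Real.log_le_sub_one_of_pos h4
            have h6 : Real.log (confFactor t' a' x / t') ≤ Real.log (confFactor t a x / t) +
                d * stereo t a i x + δ ^ 2 := by
              rw [he, Real.log_mul (div_pos (confFactor_pos ht a x) ht).ne'
                (div_pos h4 (Real.sqrt_pos.2 (by linarith))).ne',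
                Real.log_div h4.ne' (Real.sqrt_pos.2 (by linarith)).ne',
                Real.log_sqrt (by linarith)]
              linarith
            have h7 := mul_le_mul_of_nonneg_left h6 (hw0 x)
            simp only
            linarith
        _ = _ := by
          have h8 : Integrable (fun x => w x * Real.log (confFactor t a x / t) +
              d * (w x * stereo t a i x)) (ballMeasure n N) :=
            (integrable_mul_log_confFactor hw hwM' ht a).add (hωI.const_mul d)
          rw [integral_add h8 (hwI.const_mul _),
            integral_add (integrable_mul_log_confFactor hw hwM' ht a) (hωI.const_mul d),
            integral_const_mul, integral_const_mul, hw1, mul_one]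
    have h2 := hmin t' a' ht'
    linarith
  have k1 := key δ (abs_of_pos hδ0)
  have k2 := key (-δ) (by rw [abs_neg, abs_of_pos hδ0])
  rw [abs_le]
  constructor <;> nlinarith

end Centering

section SecondVariation

theorem exists_abs_one_add_rpow_sub_le (p : ℝ) :
    ∃ C η : ℝ, 0 ≤ C ∧ 0 < η ∧ η ≤ 1 / 2 ∧ ∀ y, |y| ≤ η →
      |(1 + y) ^ p - (1 + p * y + p * (p - 1) / 2 * y ^ 2)| ≤ C * |y| ^ 3 := by
  have h := (Real.one_add_rpow_hasFPowerSeriesAt_zero (a := p)).isBigO_sub_partialSum_pow 3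
  obtain ⟨C, hC, hb⟩ := h.exists_nonneg
  have h2 : Ring.choose p 2 = p * (p - 1) / 2 := by
    have := Ring.descPochhammer_eq_factorial_smul_choose p 2
    simp [descPochhammer_succ_left, Polynomial.smeval_mul, Polynomial.smeval_sub] at this
    linarith
  obtain ⟨η, hη, hball⟩ := Metric.eventually_nhds_iff_ball.1 hb.bound
  refine ⟨C, min (η / 2) (1 / 2), hC, by positivity, min_le_right _ _, fun y hy => ?_⟩
  have h3 := hball y (by
    rw [mem_ball_zero_iff, Real.norm_eq_abs]
    linarith [min_le_left (η / 2) (1 / 2)])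
  simp only [FormalMultilinearSeries.partialSum, Finset.sum_range_succ, Finset.range_zero,
    Finset.sum_empty, binomialSeries_apply, List.ofFn_const, List.prod_replicate, h2,
    Ring.choose_zero_right, Ring.choose_one_right, zero_add, smul_eq_mul, pow_zero, mul_one,
    pow_one, norm_pow, Real.norm_eq_abs] at h3
  simpa using h3

theorem one_add_rpow_le {σ x : ℝ} (h1 : 1 ≤ σ) (h2 : σ ≤ 2) (hx : -1 < x) :
    (1 + x) ^ σ ≤ 1 + σ * x + x ^ 2 := by
  have h := rpow_one_add_le_one_add_mul_self hx.le (show 0 ≤ σ - 1 by linarith) (by linarith)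
  have hx0 : 0 < 1 + x := by linarith
  rw [Real.rpow_sub_one hx0.ne', div_le_iff₀ hx0] at h
  nlinarith [sq_nonneg x]

theorem rpow_add_rpow_le_of_abs_sub_le {p C τ m W P Q : ℝ} (hp1 : 1 < p) (hp2 : p < 2)
    (hC : 0 ≤ C) (hτ : 0 < τ) (hτ1 : τ ≤ 1) (hm : |m| ≤ τ) (hW0 : 0 ≤ W) (hW1 : W ≤ 1)
    (hP0 : 0 < P) (hQ0 : 0 < Q)
    (hP : |P - (1 + p * (τ * m) + p * (p - 1) / 2 * (τ ^ 2 * W))| ≤ C * τ ^ 3)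
    (hQ : |Q - (1 - p * (τ * m) + p * (p - 1) / 2 * (τ ^ 2 * W))| ≤ C * τ ^ 3) :
    P ^ (2 / p) + Q ^ (2 / p) ≤
      2 * (1 + (p - 1) * (τ ^ 2 * W) + (2 * C + (3 + C) ^ 2) * τ ^ 3) := by
  have hσ1 : 1 ≤ 2 / p := by rw [le_div_iff₀ (by linarith)]; linarith
  have hσ2 : 2 / p ≤ 2 := by rw [div_le_iff₀ (by linarith)]; linarith
  have h1 := one_add_rpow_le hσ1 hσ2 (show -1 < P - 1 by linarith)
  have h2 := one_add_rpow_le hσ1 hσ2 (show -1 < Q - 1 by linarith)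
  rw [add_sub_cancel] at h1 h2
  have hτ2 : 0 < τ ^ 2 := by positivity
  have hτ3 : τ ^ 3 ≤ τ ^ 2 := pow_le_pow_of_le_one hτ.le hτ1 (by norm_num)
  have hτ4 : τ ^ 4 ≤ τ ^ 3 := pow_le_pow_of_le_one hτ.le hτ1 (by norm_num)
  have hτm : |p * (τ * m)| ≤ 2 * τ ^ 2 := by
    rw [abs_mul, abs_mul, abs_of_pos hτ, abs_of_pos (by linarith : 0 < p), sq]
    exact mul_le_mul hp2.le (by gcongr) (by positivity) (by norm_num)
  have hpW : p * (p - 1) / 2 * (τ ^ 2 * W) ≤ τ ^ 2 := by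
    have h3 : p * (p - 1) / 2 ≤ 1 := by nlinarith
    have h4 : τ ^ 2 * W ≤ τ ^ 2 := mul_le_of_le_one_right hτ2.le hW1
    calc _ ≤ 1 * (τ ^ 2 * W) := by gcongr
      _ ≤ _ := by linarith
  have hpW0 : 0 ≤ p * (p - 1) / 2 * (τ ^ 2 * W) := by
    have : 0 < p - 1 := by linarith
    positivity
  have hCτ : C * τ ^ 3 ≤ C * τ ^ 2 := by gcongr
  obtain ⟨hP1, hP2⟩ := abs_le.1 hP
  obtain ⟨hQ1, hQ2⟩ := abs_le.1 hQ
  obtain ⟨hm1, hm2⟩ := abs_le.1 hτm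
  have hPx : (P - 1) ^ 2 ≤ (3 + C) ^ 2 * τ ^ 3 := by
    have : |P - 1| ≤ (3 + C) * τ ^ 2 := by rw [abs_le]; constructor <;> linarith
    calc (P - 1) ^ 2 = |P - 1| ^ 2 := (sq_abs _).symm
      _ ≤ ((3 + C) * τ ^ 2) ^ 2 := by gcongr
      _ = (3 + C) ^ 2 * τ ^ 4 := by ring
      _ ≤ _ := by gcongr
  have hQx : (Q - 1) ^ 2 ≤ (3 + C) ^ 2 * τ ^ 3 := by
    have : |Q - 1| ≤ (3 + C) * τ ^ 2 := by rw [abs_le]; constructor <;> linarith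
    calc (Q - 1) ^ 2 = |Q - 1| ^ 2 := (sq_abs _).symm
      _ ≤ ((3 + C) * τ ^ 2) ^ 2 := by gcongr
      _ = (3 + C) ^ 2 * τ ^ 4 := by ring
      _ ≤ _ := by gcongr
  have hsum : (P - 1) + (Q - 1) ≤ p * (p - 1) * (τ ^ 2 * W) + 2 * (C * τ ^ 3) := by linarith
  have hsum2 : 2 / p * ((P - 1) + (Q - 1)) ≤
      2 * (p - 1) * (τ ^ 2 * W) + 4 * (C * τ ^ 3) := by
    calc _ ≤ 2 / p * (p * (p - 1) * (τ ^ 2 * W) + 2 * (C * τ ^ 3)) := by gcongr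
      _ = 2 * (p - 1) * (τ ^ 2 * W) + 2 / p * (2 * (C * τ ^ 3)) := by field_simp
      _ ≤ 2 * (p - 1) * (τ ^ 2 * W) + 2 * (2 * (C * τ ^ 3)) := by gcongr
      _ = _ := by ring
  linarith

variable {n : ℕ}

/-- If `S` bounds the energy of all bounded densities, then perturbing a normalized density by a
function `ω` with almost vanishing mean controls the energy of `u * ω`. -/
theorem exists_second_variation_le (hn : 1 ≤ n) {p q : ℝ} (hq : 0 < q) (hqn : 2 * q < n)
    (hp : p * (n - q) = n) :
    ∃ C η : ℝ, 0 ≤ C ∧ 0 < η ∧ η ≤ 1 / 2 ∧ ∀ (N S τ K : ℝ) (u ω : EuclideanSpace ℝ (Fin n) → ℝ),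
      0 ≤ S → (∀ (v : EuclideanSpace ℝ (Fin n) → ℝ) (A : ℝ), Measurable v → (∀ x, 0 ≤ v x) →
        (∀ x, v x ≤ A) → 0 < ∫ x, v x ^ p ∂(ballMeasure n N) →
        rieszForm q N v ≤ S * (∫ x, v x ^ p ∂(ballMeasure n N)) ^ (2 / p)) →
      0 < τ → τ ≤ η → Measurable u → (∀ x, 0 ≤ u x) → (∀ x, u x ≤ K) →
      ∫ x, u x ^ p ∂(ballMeasure n N) = 1 → Measurable ω → (∀ x, |ω x| ≤ 1) →
      |∫ x, u x ^ p * ω x ∂(ballMeasure n N)| ≤ τ →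
      rieszForm q N u + τ ^ 2 * rieszForm q N (fun x => u x * ω x) ≤
        S * (1 + (p - 1) * (τ ^ 2 * ∫ x, u x ^ p * ω x ^ 2 ∂(ballMeasure n N)) + C * τ ^ 3) := by
  have hp1 := one_lt_of_mul_sub_eq hq hqn hp
  have hp2 := lt_two_of_mul_sub_eq hqn hp
  obtain ⟨C, η, hC, hη, hη1, hT⟩ := exists_abs_one_add_rpow_sub_le p
  refine ⟨2 * C + (3 + C) ^ 2, η, by positivity, hη, hη1,
    fun N S τ K u ω hS HS hτ hτη hu hu0 huK hu1 hω hω1 hm => ?_⟩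
  have hup0 : ∀ x, 0 ≤ u x ^ p := fun x => Real.rpow_nonneg (hu0 x) _
  have hK0 : 0 ≤ K := (hu0 0).trans (huK 0)
  have hup : Integrable (fun x => u x ^ p) (ballMeasure n N) :=
    Integrable.of_bound (hu.pow_const _).aestronglyMeasurable (K ^ p) (ae_of_all _ fun x => by
      rw [Real.norm_of_nonneg (hup0 x)]
      exact Real.rpow_le_rpow (hu0 x) (huK x) (by linarith))
  have hupω : Integrable (fun x => u x ^ p * ω x) (ballMeasure n N) :=
    hup.mul_bdd (c := 1) hω.aestronglyMeasurable (ae_of_all _ hω1)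
  have hω2 : ∀ x, ω x ^ 2 ≤ 1 := fun x => by rw [← sq_abs]; exact pow_le_one₀ (abs_nonneg _) (hω1 x)
  have hupω2 : Integrable (fun x => u x ^ p * ω x ^ 2) (ballMeasure n N) :=
    hup.mul_bdd (c := 1) (hω.pow_const _).aestronglyMeasurable (ae_of_all _ fun x => by
      rw [Real.norm_of_nonneg (sq_nonneg _)]; exact hω2 x)
  set m := ∫ x, u x ^ p * ω x ∂(ballMeasure n N) with hm'
  set W := ∫ x, u x ^ p * ω x ^ 2 ∂(ballMeasure n N) with hW
  have hW0 : 0 ≤ W := integral_nonneg fun x => mul_nonneg (hup0 x) (sq_nonneg _)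
  have hW1 : W ≤ 1 := by
    rw [← hu1]
    exact integral_mono hupω2 hup fun x => mul_le_of_le_one_right (hup0 x) (hω2 x)
  have hsmall : ∀ d : ℝ, |d| = τ → ∀ x, |d * ω x| ≤ τ := fun d hd x => by
    rw [abs_mul, hd]; exact mul_le_of_le_one_right hτ.le (hω1 x)
  have hhalf : ∀ d : ℝ, |d| = τ → ∀ x, 1 / 2 ≤ 1 + d * ω x := fun d hd x => by
    linarith [(abs_le.1 (hsmall d hd x)).1]
  have hP : ∀ d : ℝ, |d| = τ → Integrable (fun x => (u x * (1 + d * ω x)) ^ p) (ballMeasure n N) ∧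
      0 < ∫ x, (u x * (1 + d * ω x)) ^ p ∂(ballMeasure n N) ∧
      |(∫ x, (u x * (1 + d * ω x)) ^ p ∂(ballMeasure n N)) -
        (1 + p * (d * m) + p * (p - 1) / 2 * (τ ^ 2 * W))| ≤ C * τ ^ 3 ∧
      rieszForm q N (fun x => u x * (1 + d * ω x)) ≤
        S * (∫ x, (u x * (1 + d * ω x)) ^ p ∂(ballMeasure n N)) ^ (2 / p) := fun d hd => by
    have hd2 : d ^ 2 = τ ^ 2 := by rw [← sq_abs, hd]
    have hv0 : ∀ x, 0 ≤ u x * (1 + d * ω x) := fun x =>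
      mul_nonneg (hu0 x) (by linarith [hhalf d hd x])
    have hv2 : ∀ x, u x * (1 + d * ω x) ≤ K * 2 := fun x =>
      mul_le_mul (huK x) (by linarith [(abs_le.1 (hsmall d hd x)).2])
        (by linarith [hhalf d hd x]) hK0
    have hvm : Measurable fun x => u x * (1 + d * ω x) := by fun_prop
    have hvp : Integrable (fun x => (u x * (1 + d * ω x)) ^ p) (ballMeasure n N) :=
      Integrable.of_bound (hvm.pow_const _).aestronglyMeasurable ((K * 2) ^ p)
        (ae_of_all _ fun x => by
          rw [Real.norm_of_nonneg (Real.rpow_nonneg (hv0 x) _)]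
          exact Real.rpow_le_rpow (hv0 x) (hv2 x) (by linarith))
    have hpos : 0 < ∫ x, (u x * (1 + d * ω x)) ^ p ∂(ballMeasure n N) := by
      calc (0 : ℝ) < (1 / 2) ^ p * ∫ x, u x ^ p ∂(ballMeasure n N) := by rw [hu1]; positivity
        _ = ∫ x, (1 / 2) ^ p * u x ^ p ∂(ballMeasure n N) := (integral_const_mul _ _).symm
        _ ≤ _ := integral_mono (hup.const_mul _) hvp fun x => by
          simp only
          rw [Real.mul_rpow (hu0 x) (by linarith [hhalf d hd x]), mul_comm]
          gcongr
          · exact hup0 x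
          · exact hhalf d hd x
    refine ⟨hvp, hpos, ?_, HS _ (K * 2) hvm hv0 hv2 hpos⟩
    have e0 : Integrable (fun x => u x ^ p + p * d * (u x ^ p * ω x)) (ballMeasure n N) :=
      hup.add (hupω.const_mul _)
    have e1 : ∫ x, (u x ^ p + p * d * (u x ^ p * ω x) +
        p * (p - 1) / 2 * τ ^ 2 * (u x ^ p * ω x ^ 2)) ∂(ballMeasure n N) =
        1 + p * (d * m) + p * (p - 1) / 2 * (τ ^ 2 * W) := by
      rw [integral_add e0 (hupω2.const_mul _), integral_add hup (hupω.const_mul _),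
        integral_const_mul, integral_const_mul, hu1]
      ring
    have e2 : Integrable (fun x => u x ^ p + p * d * (u x ^ p * ω x) +
        p * (p - 1) / 2 * τ ^ 2 * (u x ^ p * ω x ^ 2)) (ballMeasure n N) :=
      e0.add (hupω2.const_mul _)
    rw [← e1, ← integral_sub hvp e2]
    refine abs_integral_le_integral_abs.trans ?_
    calc _ ≤ ∫ x, C * τ ^ 3 * u x ^ p ∂(ballMeasure n N) := by
          refine integral_mono (hvp.sub e2).abs (hup.const_mul _) fun x => ?_
          have h1 := hT (d * ω x) ((hsmall d hd x).trans hτη)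
          have h2 : |d * ω x| ^ 3 ≤ τ ^ 3 := pow_le_pow_left₀ (abs_nonneg _) (hsmall d hd x) 3
          have h3 : (u x * (1 + d * ω x)) ^ p - (u x ^ p + p * d * (u x ^ p * ω x) +
              p * (p - 1) / 2 * τ ^ 2 * (u x ^ p * ω x ^ 2)) = u x ^ p *
              ((1 + d * ω x) ^ p - (1 + p * (d * ω x) + p * (p - 1) / 2 * (d * ω x) ^ 2)) := by
            rw [Real.mul_rpow (hu0 x) (by linarith [hhalf d hd x]), ← hd2]
            ring
          simp only
          rw [h3, abs_mul, abs_of_nonneg (hup0 x), mul_comm]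
          refine mul_le_mul_of_nonneg_right (h1.trans ?_) (hup0 x)
          gcongr
      _ = C * τ ^ 3 := by rw [integral_const_mul, hu1, mul_one]
  obtain ⟨-, hP0, hPe, hPI⟩ := hP τ (abs_of_pos hτ)
  obtain ⟨-, hQ0, hQe, hQI⟩ := hP (-τ) (by rw [abs_neg, abs_of_pos hτ])
  have hfin := rpow_add_rpow_le_of_abs_sub_le hp1 hp2 hC hτ (by linarith) hm hW0 hW1 hP0 hQ0 hPe
    (by convert hQe using 3; ring)
  have hbd : ∀ d : ℝ, |d| = τ → ∀ x, |u x * (1 + d * ω x)| ≤ K * 2 := fun d hd x => by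
    rw [abs_mul, abs_of_nonneg (hu0 x)]
    refine mul_le_mul (huK x) ?_ (abs_nonneg _) hK0
    rw [abs_of_nonneg (by linarith [hhalf d hd x])]
    linarith [(abs_le.1 (hsmall d hd x)).2]
  have hsplit : rieszForm q N (fun x => u x * (1 + τ * ω x)) +
      rieszForm q N (fun x => u x * (1 + -τ * ω x)) =
      2 * (rieszForm q N u + τ ^ 2 * rieszForm q N (fun x => u x * ω x)) := by
    have i1 := integrable_rieszForm (N := N) (v := fun x => u x * (1 + τ * ω x)) hn hq hqn
      (by fun_prop) (hbd τ (abs_of_pos hτ))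
    have i2 := integrable_rieszForm (N := N) (v := fun x => u x * (1 + -τ * ω x)) hn hq hqn
      (by fun_prop) (hbd (-τ) (by rw [abs_neg, abs_of_pos hτ]))
    have i3 := integrable_rieszForm (N := N) hn hq hqn hu
      (fun x => by rw [abs_of_nonneg (hu0 x)]; exact huK x)
    have i4 := integrable_rieszForm (N := N) (v := fun x => u x * ω x) (K := K) hn hq hqn
      (by fun_prop) (fun x => by
        rw [abs_mul, abs_of_nonneg (hu0 x)]
        exact (mul_le_of_le_one_right (hu0 x) (hω1 x)).trans (huK x))
    simp only [rieszForm]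
    rw [← integral_add i1 i2, ← integral_const_mul (τ ^ 2), ← integral_add i3 (i4.const_mul _),
      ← integral_const_mul]
    exact integral_congr_ae (ae_of_all _ fun z => by simp only; ring)
  have hS2 := mul_le_mul_of_nonneg_left hfin hS
  linarith

end SecondVariation

section SharpBall

variable {n : ℕ}

theorem rieszEnergy_indicator (hn : 1 ≤ n) {q N K : ℝ} (hq : 0 < q) (hqn : 2 * q < n)
    {u : EuclideanSpace ℝ (Fin n) → ℝ} (hu : Measurable u) (hu0 : ∀ x, 0 ≤ u x)
    (huK : ∀ x, u x ≤ K) :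
    rieszEnergy q ((Metric.ball 0 N).indicator u) = ENNReal.ofReal (rieszForm q N u) := by
  have hI := integrable_rieszForm (N := N) hn hq hqn hu
    (fun x => by rw [abs_of_nonneg (hu0 x)]; exact huK x)
  rw [rieszForm, ofReal_integral_eq_lintegral_ofReal hI (ae_of_all _ fun z =>
    mul_nonneg (mul_nonneg (hu0 _) (hu0 _)) (by positivity)),
    lintegral_prod _ (Measurable.aemeasurable (by fun_prop)), rieszEnergy,
    ← lintegral_indicator measurableSet_ball]
  refine lintegral_congr fun x => ?_
  by_cases hx : x ∈ Metric.ball 0 N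
  · simp only [Set.indicator_of_mem hx]
    rw [← lintegral_indicator measurableSet_ball]
    refine lintegral_congr fun y => ?_
    by_cases hy : y ∈ Metric.ball 0 N
    · simp only [Set.indicator_of_mem hy]
    · simp [Set.indicator_of_notMem hy]
  · simp [Set.indicator_of_notMem hx]

theorem lintegral_indicator_rpow {p N K : ℝ} (hp : 0 < p)
    {u : EuclideanSpace ℝ (Fin n) → ℝ} (hu : Measurable u) (hu0 : ∀ x, 0 ≤ u x)
    (huK : ∀ x, u x ≤ K) :
    ∫⁻ x, ENNReal.ofReal ((Metric.ball 0 N).indicator u x ^ p) =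
      ENNReal.ofReal (∫ x, u x ^ p ∂(ballMeasure n N)) := by
  rw [ofReal_integral_eq_lintegral_ofReal (Integrable.of_bound
    (hu.pow_const _).aestronglyMeasurable (K ^ p) (ae_of_all _ fun x => by
      rw [Real.norm_of_nonneg (Real.rpow_nonneg (hu0 x) _)]
      exact Real.rpow_le_rpow (hu0 x) (huK x) hp.le))
    (ae_of_all _ fun x => Real.rpow_nonneg (hu0 x) _), ← lintegral_indicator measurableSet_ball]
  refine lintegral_congr fun x => ?_
  by_cases hx : x ∈ Metric.ball 0 N
  · simp only [Set.indicator_of_mem hx]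
  · simp [Set.indicator_of_notMem hx, Real.zero_rpow hp.ne']

theorem rieszForm_const_mul (q N c : ℝ) (u : EuclideanSpace ℝ (Fin n) → ℝ) :
    rieszForm q N (fun x => c * u x) = c ^ 2 * rieszForm q N u := by
  simp only [rieszForm]
  rw [← integral_const_mul]
  exact integral_congr_ae (ae_of_all _ fun z => by simp only; ring)

theorem integral_rpow_const_mul {p N c : ℝ} (hc : 0 ≤ c) {u : EuclideanSpace ℝ (Fin n) → ℝ}
    (hu0 : ∀ x, 0 ≤ u x) :
    ∫ x, (c * u x) ^ p ∂(ballMeasure n N) = c ^ p * ∫ x, u x ^ p ∂(ballMeasure n N) := by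
  rw [← integral_const_mul]
  exact integral_congr_ae (ae_of_all _ fun x => Real.mul_rpow hc (hu0 x))

/-- The values of the Riesz energy on normalized bounded densities. -/
def rieszFormValues (n : ℕ) (p q N : ℝ) : Set ℝ :=
  {r | ∃ (u : EuclideanSpace ℝ (Fin n) → ℝ) (K : ℝ), Measurable u ∧ (∀ x, 0 ≤ u x) ∧
    (∀ x, u x ≤ K) ∧ ∫ x, u x ^ p ∂(ballMeasure n N) = 1 ∧ rieszForm q N u = r}

theorem bddAbove_rieszFormValues (hn : 1 ≤ n) {p q N : ℝ} (hq : 0 < q) (hqn : 2 * q < n)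
    (hp : p * (n - q) = n) : BddAbove (rieszFormValues n p q N) := by
  have hp0 : 0 < p := by linarith [one_lt_of_mul_sub_eq hq hqn hp]
  have hW := rieszMass_pos hqn
  refine ⟨2 * (1 + 2 ^ (n - q) * rieszMass n q), ?_⟩
  rintro _ ⟨u, K, hu, hu0, huK, hu1, rfl⟩
  have h := rieszEnergy_le_of_lintegral_le_one hn hq hqn hp
    (u := (Metric.ball 0 N).indicator u) (hu.indicator measurableSet_ball)
    (fun x => Set.indicator_nonneg (fun y _ => hu0 y) x)
    (by rw [lintegral_indicator_rpow hp0 hu hu0 huK, hu1, ENNReal.ofReal_one])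
  rw [rieszEnergy_indicator hn hq hqn hu hu0 huK] at h
  rw [← ENNReal.ofReal_le_ofReal_iff (by positivity), ENNReal.ofReal_mul (by norm_num),
    ENNReal.ofReal_add (by norm_num) (by positivity)]
  simpa using h

theorem rieszForm_nonneg (q N : ℝ) {u : EuclideanSpace ℝ (Fin n) → ℝ} (hu0 : ∀ x, 0 ≤ u x) :
    0 ≤ rieszForm q N u :=
  integral_nonneg fun z => mul_nonneg (mul_nonneg (hu0 _) (hu0 _)) (by positivity)

theorem rieszForm_le_sSup_mul (hn : 1 ≤ n) {p q N K : ℝ} (hq : 0 < q) (hqn : 2 * q < n)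
    (hp : p * (n - q) = n) {v : EuclideanSpace ℝ (Fin n) → ℝ} (hv : Measurable v)
    (hv0 : ∀ x, 0 ≤ v x) (hvK : ∀ x, v x ≤ K) (hpos : 0 < ∫ x, v x ^ p ∂(ballMeasure n N)) :
    rieszForm q N v ≤
      sSup (rieszFormValues n p q N) * (∫ x, v x ^ p ∂(ballMeasure n N)) ^ (2 / p) := by
  have hp0 : 0 < p := by linarith [one_lt_of_mul_sub_eq hq hqn hp]
  set P := ∫ x, v x ^ p ∂(ballMeasure n N) with hP
  set c := P ^ (-(1 / p)) with hc
  have hc0 : 0 < c := Real.rpow_pos_of_pos hpos _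
  have hcp : c ^ p * P = 1 := by
    rw [hc, ← Real.rpow_mul hpos.le, show -(1 / p) * p = -1 by field_simp, Real.rpow_neg_one]
    exact inv_mul_cancel₀ hpos.ne'
  have hc2 : c ^ 2 * P ^ (2 / p) = 1 := by
    rw [hc, ← Real.rpow_natCast, ← Real.rpow_mul hpos.le, ← Real.rpow_add hpos]
    convert Real.rpow_zero P using 2
    push_cast
    ring
  have h := le_csSup (bddAbove_rieszFormValues (N := N) hn hq hqn hp)
    ⟨fun x => c * v x, c * K, hv.const_mul c, fun x => mul_nonneg hc0.le (hv0 x),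
      fun x => mul_le_mul_of_nonneg_left (hvK x) hc0.le,
      by rw [integral_rpow_const_mul hc0.le hv0, hcp], rfl⟩
  rw [rieszForm_const_mul] at h
  have h2 := mul_le_mul_of_nonneg_right h (Real.rpow_nonneg hpos.le (2 / p))
  calc _ = c ^ 2 * rieszForm q N v * P ^ (2 / p) := by
        linear_combination (-rieszForm q N v) * hc2
    _ ≤ _ := h2

theorem sSup_rieszFormValues_le (hn : 1 ≤ n) {p q N : ℝ} (hq : 0 < q) (hqn : 2 * q < n)
    (hp : p * (n - q) = n) (hne : (rieszFormValues n p q N).Nonempty) :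
    sSup (rieszFormValues n p q N) ≤ hlsConst n q := by
  have hp1 := one_lt_of_mul_sub_eq hq hqn hp
  set S := sSup (rieszFormValues n p q N) with hS
  have hS0 : 0 ≤ S := by
    obtain ⟨_, u, K, hu, hu0, huK, hu1, rfl⟩ := hne
    exact (rieszForm_nonneg q N hu0).trans (le_csSup (bddAbove_rieszFormValues hn hq hqn hp)
      ⟨u, K, hu, hu0, huK, hu1, rfl⟩)
  obtain ⟨C₁, hC₁, hconf⟩ := exists_conformal_inequality hn hq hqn hp
  obtain ⟨C₂, η, hC₂, hη, hη1, hvar⟩ := exists_second_variation_le hn hq hqn hp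
  have hnq : 0 < n - q := by linarith
  have key : ∀ τ : ℝ, 0 < τ → τ ≤ η → S - hlsConst n q ≤
      (1 + C₁ * (n - q) * ((p - 1) + (n + 1) * (1 + S * C₂))) * τ := by
    intro τ hτ hτη
    obtain ⟨_, ⟨u, K, hu, hu0, huK, hu1, rfl⟩, hlt⟩ := exists_lt_of_lt_csSup hne
      (show S - τ ^ 3 < S by linarith [pow_pos hτ 3])
    obtain ⟨t, a, ht, hcen⟩ := exists_abs_integral_mul_stereo_le (N := N) (M := K ^ p) hn
      (hu.pow_const p) (fun x => Real.rpow_nonneg (hu0 x) _)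
      (fun x => Real.rpow_le_rpow (hu0 x) (huK x) (by linarith)) hu1 hτ
    have h1 := hconf N K t a u ht hu hu0 huK
    rw [hu1, Real.one_rpow, mul_one] at h1
    have h2 := fun i => hvar N S τ K u (stereo t a i) hS0
      (fun v A hv hv0 hvA hpos => rieszForm_le_sSup_mul hn hq hqn hp hv hv0 hvA hpos) hτ hτη hu
      hu0 huK hu1 (measurable_stereo t a i) (abs_stereo_le_one ht a i) (hcen i)
    have hup : Integrable (fun x => u x ^ p) (ballMeasure n N) := by
      by_contra hcon
      rw [integral_undef hcon] at hu1
      exact zero_ne_one hu1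
    have hWsum : ∑ i, ∫ x, u x ^ p * stereo t a i x ^ 2 ∂(ballMeasure n N) = 1 := by
      rw [← integral_finsetSum _ fun i _ => hup.mul_bdd (c := 1)
        ((measurable_stereo t a i).pow_const 2).aestronglyMeasurable (ae_of_all _ fun x => by
          rw [norm_pow]; exact pow_le_one₀ (norm_nonneg _) (abs_stereo_le_one ht a i x)), ← hu1]
      refine integral_congr_ae (ae_of_all _ fun x => ?_)
      simp only
      rw [← Finset.mul_sum, sum_stereo_sq ht, mul_one]
    have h3 := Finset.sum_le_sum (s := Finset.univ) fun i _ => h2 i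
    rw [Finset.sum_add_distrib, ← Finset.mul_sum, ← Finset.mul_sum, Finset.sum_add_distrib,
      Finset.sum_add_distrib, ← Finset.mul_sum, ← Finset.mul_sum, hWsum] at h3
    simp only [Finset.sum_const, Finset.card_univ, Fintype.card_option, Fintype.card_fin,
      nsmul_eq_mul, Nat.cast_add, Nat.cast_one, mul_one] at h3
    set T := ∑ i, rieszForm q N (fun x => u x * stereo t a i x) with hT
    have h4 : τ ^ 2 * T ≤ τ ^ 2 * (S * (p - 1) + (n + 1) * (1 + S * C₂) * τ) := by
      have h5 : ((n : ℝ) + 1) * (S - τ ^ 3) ≤ (n + 1) * rieszForm q N u := by gcongr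
      linarith
    have h6 : T ≤ S * (p - 1) + (n + 1) * (1 + S * C₂) * τ :=
      le_of_mul_le_mul_left h4 (by positivity)
    have hq' : q = (n - q) * (p - 1) := by linarith
    have hτ3 : τ ^ 3 ≤ τ := by
      have := pow_le_pow_of_le_one hτ.le (by linarith : τ ≤ 1) (show 1 ≤ 3 by norm_num)
      simpa using this
    have h7 : (n - q) * T - q * rieszForm q N u ≤
        (n - q) * (((p - 1) + (n + 1) * (1 + S * C₂)) * τ) := by
      have h8 : (p - 1) * (S - τ) ≤ (p - 1) * rieszForm q N u :=
        mul_le_mul_of_nonneg_left (by linarith) (by linarith)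
      calc _ = (n - q) * (T - (p - 1) * rieszForm q N u) := by
            linear_combination (-rieszForm q N u) * hq'
        _ ≤ _ := mul_le_mul_of_nonneg_left (by linarith) hnq.le
    have h9 := mul_le_mul_of_nonneg_left h7 hC₁.le
    linarith
  set B := 1 + C₁ * (n - q) * ((p - 1) + (n + 1) * (1 + S * C₂)) with hB
  have hB0 : 0 < B := by
    have : 0 < p - 1 := by linarith
    positivity
  by_contra! hcon
  have h1 := key (min η ((S - hlsConst n q) / (2 * B)))
    (lt_min hη (div_pos (by linarith) (by positivity))) (min_le_left _ _)
  have h2 : B * min η ((S - hlsConst n q) / (2 * B)) ≤ (S - hlsConst n q) / 2 := by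
    calc _ ≤ B * ((S - hlsConst n q) / (2 * B)) := by gcongr; exact min_le_right _ _
      _ = _ := by field_simp
  linarith

theorem rieszForm_le (hn : 1 ≤ n) {p q N K : ℝ} (hq : 0 < q) (hqn : 2 * q < n)
    (hp : p * (n - q) = n) {v : EuclideanSpace ℝ (Fin n) → ℝ} (hv : Measurable v)
    (hv0 : ∀ x, 0 ≤ v x) (hvK : ∀ x, v x ≤ K) (hpos : 0 < ∫ x, v x ^ p ∂(ballMeasure n N)) :
    rieszForm q N v ≤ hlsConst n q * (∫ x, v x ^ p ∂(ballMeasure n N)) ^ (2 / p) := by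
  have hp0 : 0 < p := by linarith [one_lt_of_mul_sub_eq hq hqn hp]
  refine (rieszForm_le_sSup_mul hn hq hqn hp hv hv0 hvK hpos).trans
    (mul_le_mul_of_nonneg_right (sSup_rieszFormValues_le hn hq hqn hp ?_) (by positivity))
  set P := ∫ x, v x ^ p ∂(ballMeasure n N) with hP
  have hc0 : 0 < P ^ (-(1 / p)) := Real.rpow_pos_of_pos hpos _
  refine ⟨_, fun x => P ^ (-(1 / p)) * v x, P ^ (-(1 / p)) * K, hv.const_mul _,
    fun x => mul_nonneg hc0.le (hv0 x), fun x => mul_le_mul_of_nonneg_left (hvK x) hc0.le, ?_, rfl⟩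
  rw [integral_rpow_const_mul hc0.le hv0, ← hP, ← Real.rpow_mul hpos.le,
    show -(1 / p) * p = -1 by field_simp, Real.rpow_neg_one]
  exact inv_mul_cancel₀ hpos.ne'

end SharpBall

section SharpInequality

variable {n : ℕ}

theorem rieszEnergy_eq_lintegral_prod (q : ℝ) {u : EuclideanSpace ℝ (Fin n) → ℝ}
    (hu : Measurable u) :
    rieszEnergy q u = ∫⁻ z : EuclideanSpace ℝ (Fin n) × EuclideanSpace ℝ (Fin n),
      ENNReal.ofReal (u z.1 * u z.2 * ‖z.1 - z.2‖ ^ (-(2 * q))) := by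
  rw [Measure.volume_eq_prod, lintegral_prod _ (Measurable.aemeasurable (by fun_prop)), rieszEnergy]

theorem rieszEnergy_indicator_le (hn : 1 ≤ n) {p q N K : ℝ} (hq : 0 < q) (hqn : 2 * q < n)
    (hp : p * (n - q) = n) {u : EuclideanSpace ℝ (Fin n) → ℝ} (hu : Measurable u)
    (hu0 : ∀ x, 0 ≤ u x) (huK : ∀ x, u x ≤ K) :
    rieszEnergy q ((Metric.ball 0 N).indicator u) ≤ ENNReal.ofReal (hlsConst n q) *
      (∫⁻ x, ENNReal.ofReal ((Metric.ball 0 N).indicator u x ^ p)) ^ (2 / p) := by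
  have hp0 : 0 < p := by linarith [one_lt_of_mul_sub_eq hq hqn hp]
  have hP0 : 0 ≤ ∫ x, u x ^ p ∂(ballMeasure n N) :=
    integral_nonneg fun x => Real.rpow_nonneg (hu0 x) _
  rcases hP0.eq_or_lt with h0 | hpos
  · have h1 := lintegral_indicator_rpow (N := N) hp0 hu hu0 huK
    have hm : Measurable ((Metric.ball 0 N).indicator u) := hu.indicator measurableSet_ball
    rw [← h0, ENNReal.ofReal_zero, lintegral_eq_zero_iff (by fun_prop)] at h1
    have h2 : rieszEnergy q ((Metric.ball 0 N).indicator u) = 0 := by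
      rw [rieszEnergy, lintegral_eq_zero_iff (Measurable.lintegral_prod_right' (f := fun z :
        EuclideanSpace ℝ (Fin n) × EuclideanSpace ℝ (Fin n) => ENNReal.ofReal
          ((Metric.ball 0 N).indicator u z.1 * (Metric.ball 0 N).indicator u z.2 *
            ‖z.1 - z.2‖ ^ (-(2 * q)))) (by fun_prop))]
      filter_upwards [h1] with x hx
      have h3 : (Metric.ball 0 N).indicator u x = 0 := by
        have h4 : 0 ≤ (Metric.ball 0 N).indicator u x :=
          Set.indicator_nonneg (fun y _ => hu0 y) x
        rw [Pi.zero_apply, ENNReal.ofReal_eq_zero] at hx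
        by_contra hcon
        exact absurd hx (not_le.2 (Real.rpow_pos_of_pos (lt_of_le_of_ne h4 (Ne.symm hcon)) _))
      simp [h3]
    rw [h2]
    exact zero_le
  · rw [rieszEnergy_indicator hn hq hqn hu hu0 huK, lintegral_indicator_rpow hp0 hu hu0 huK,
      ENNReal.ofReal_rpow_of_nonneg hP0 (by positivity),
      ← ENNReal.ofReal_mul (hlsConst_pos hn hqn).le]
    exact ENNReal.ofReal_le_ofReal (rieszForm_le hn hq hqn hp hu hu0 huK hpos)

/-- The sharp Hardy-Littlewood-Sobolev inequality in the diagonal case. -/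
theorem rieszEnergy_le (hn : 1 ≤ n) {p q : ℝ} (hq : 0 < q) (hqn : 2 * q < n)
    (hp : p * (n - q) = n) {u : EuclideanSpace ℝ (Fin n) → ℝ} (hu : Measurable u)
    (hu0 : ∀ x, 0 ≤ u x) :
    rieszEnergy q u ≤ ENNReal.ofReal (hlsConst n q) *
      (∫⁻ x, ENNReal.ofReal (u x ^ p)) ^ (2 / p) := by
  have hp0 : 0 < p := by linarith [one_lt_of_mul_sub_eq hq hqn hp]
  set v : ℕ → EuclideanSpace ℝ (Fin n) → ℝ := fun k =>
    (Metric.ball 0 (k : ℝ)).indicator fun x => min (u x) k with hv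
  have hmin : ∀ k : ℕ, Measurable fun x => min (u x) (k : ℝ) := fun k => hu.min measurable_const
  have hmin0 : ∀ (k : ℕ) x, 0 ≤ min (u x) (k : ℝ) := fun k x => le_min (hu0 x) k.cast_nonneg
  have hvm : ∀ k, Measurable (v k) := fun k => (hmin k).indicator measurableSet_ball
  have hv0 : ∀ k x, 0 ≤ v k x := fun k x => Set.indicator_nonneg (fun y _ => hmin0 k y) x
  have hvu : ∀ k x, v k x ≤ u x := fun k x =>
    Set.indicator_le_self' (fun _ _ => hmin0 k _) x |>.trans (min_le_left _ _)
  have hmono : ∀ x, Monotone fun k => v k x := fun x j k hjk => by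
    have hjk' : (j : ℝ) ≤ k := by exact_mod_cast hjk
    simp only [hv]
    exact (Set.indicator_le_indicator_of_subset (Metric.ball_subset_ball hjk')
      (fun y => hmin0 j y) x).trans (Set.indicator_le_indicator (min_le_min_left _ hjk'))
  have hev : ∀ x, ∀ᶠ k in Filter.atTop, v k x = u x := fun x => by
    obtain ⟨k₀, hk₀⟩ := exists_nat_gt (max ‖x‖ (u x))
    filter_upwards [Filter.eventually_ge_atTop k₀] with k hk
    have hk' : (k₀ : ℝ) ≤ k := by exact_mod_cast hk
    have h1 := (le_max_left _ _).trans_lt (hk₀.trans_le hk')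
    have h2 := (le_max_right _ _).trans_lt (hk₀.trans_le hk')
    simp only [hv]
    rw [Set.indicator_of_mem (mem_ball_zero_iff.2 h1), min_eq_left h2.le]
  have hlim : Filter.Tendsto (fun k => rieszEnergy q (v k)) Filter.atTop
      (nhds (rieszEnergy q u)) := by
    simp_rw [rieszEnergy_eq_lintegral_prod q hu, fun k => rieszEnergy_eq_lintegral_prod q (hvm k)]
    refine lintegral_tendsto_of_tendsto_of_monotone
      (fun k => Measurable.aemeasurable (by have := hvm k; fun_prop))
      (ae_of_all _ fun z j k hjk => ENNReal.ofReal_le_ofReal ?_) (ae_of_all _ fun z => ?_)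
    · exact mul_le_mul_of_nonneg_right (mul_le_mul (hmono _ hjk) (hmono _ hjk) (hv0 _ _)
        (hv0 _ _)) (by positivity)
    · refine tendsto_const_nhds.congr' ?_
      filter_upwards [hev z.1, hev z.2] with k h1 h2
      rw [h1, h2]
  refine le_of_tendsto hlim (Filter.Eventually.of_forall fun k => ?_)
  refine (rieszEnergy_indicator_le hn hq hqn hp (hmin k) (hmin0 k)
    (fun x => min_le_right (u x) (k : ℝ))).trans ?_
  gcongr with x
  · exact hv0 k x
  · exact hvu k x

end SharpInequality

section FourierForm

theorem norm_cexp_two_pi_I_mul (s : ℝ) : ‖Complex.exp (2 * π * Complex.I * (s : ℂ))‖ = 1 := by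
  rw [show 2 * (π : ℂ) * Complex.I * s = ((2 * π * s : ℝ) : ℂ) * Complex.I by push_cast; ring,
    Complex.norm_exp_ofReal_mul_I]

theorem norm_fourierPlus_le {n : ℕ} (v : EuclideanSpace ℝ (Fin n) → ℂ)
    (ξ : EuclideanSpace ℝ (Fin n)) : ‖fourierPlus v ξ‖ ≤ ∫ x, ‖v x‖ := by
  refine (norm_integral_le_integral_norm _).trans_eq (integral_congr_ae (ae_of_all _ fun x => ?_))
  simp only [norm_mul, norm_cexp_two_pi_I_mul, one_mul]

theorem continuous_fourierPlus {n : ℕ} {v : EuclideanSpace ℝ (Fin n) → ℂ} (hv : Integrable v) :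
    Continuous (fourierPlus v) := by
  refine continuous_of_dominated (bound := fun x => ‖v x‖) (fun ξ => ?_) (fun ξ => ?_) hv.norm
    (ae_of_all _ fun x => by fun_prop)
  · exact (Continuous.aestronglyMeasurable (by fun_prop)).mul hv.1
  · exact ae_of_all _ fun x => by simp only [norm_mul, norm_cexp_two_pi_I_mul, one_mul, le_refl]

theorem integral_fourierPlus_mul {n : ℕ} {v w : EuclideanSpace ℝ (Fin n) → ℂ} (hv : Integrable v)
    (hw : Integrable w) : ∫ ξ, fourierPlus v ξ * w ξ = ∫ x, v x * fourierPlus w x := by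
  have h := integral_integral_swap (μ := volume) (ν := volume)
    (f := fun ξ x : EuclideanSpace ℝ (Fin n) =>
      Complex.exp (2 * π * Complex.I * (⟪x, ξ⟫_ℝ : ℂ)) * v x * w ξ) ?_
  · simp only [fourierPlus, ← integral_mul_const, ← integral_const_mul]
    rw [h]
    refine integral_congr_ae (ae_of_all _ fun x => integral_congr_ae (ae_of_all _ fun ξ => ?_))
    simp only [real_inner_comm x ξ]
    ring
  · refine (hw.mul_prod hv).mono ?_ (ae_of_all _ fun z => ?_)
    · have h1 : AEStronglyMeasurable (fun z : EuclideanSpace ℝ (Fin n) × EuclideanSpace ℝ (Fin n) =>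
          Complex.exp (2 * π * Complex.I * (⟪z.2, z.1⟫_ℝ : ℂ))) (volume.prod volume) :=
        Continuous.aestronglyMeasurable (by fun_prop)
      exact (h1.mul hv.1.comp_snd).mul hw.1.comp_fst
    · simp only [Function.uncurry, norm_mul, norm_cexp_two_pi_I_mul, one_mul]
      rw [mul_comm]

theorem integrable_gaussian_char {n : ℕ} {b : ℝ} (hb : 0 < b) (ξ : EuclideanSpace ℝ (Fin n)) :
    Integrable fun x : EuclideanSpace ℝ (Fin n) =>
      Complex.exp (2 * π * Complex.I * (⟪x, ξ⟫_ℝ : ℂ)) * Complex.exp (-b * ‖x‖ ^ 2) := by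
  have := GaussianFourier.integrable_cexp_neg_mul_sq_norm_add (b := (b : ℂ)) (by simpa)
    (2 * π * Complex.I) ξ
  refine this.congr (ae_of_all _ fun x => ?_)
  simp only [← Complex.exp_add, real_inner_comm ξ x, add_comm]

theorem fourierPlus_gaussian_char {n : ℕ} {b : ℝ} (hb : 0 < b) (ξ η : EuclideanSpace ℝ (Fin n)) :
    fourierPlus (fun x => Complex.exp (2 * π * Complex.I * (⟪x, ξ⟫_ℝ : ℂ)) *
      Complex.exp (-b * ‖x‖ ^ 2)) η =
      ((π / b : ℝ) ^ ((n : ℝ) / 2) * Real.exp (-(π ^ 2 * ‖η + ξ‖ ^ 2 / b)) : ℝ) := by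
  have h := GaussianFourier.integral_cexp_neg_mul_sq_norm_add (b := (b : ℂ)) (by simpa)
    (2 * π * Complex.I) (η + ξ)
  rw [finrank_euclideanSpace_fin] at h
  rw [Complex.ofReal_mul, Complex.ofReal_cpow (by positivity)]
  push_cast
  convert h using 1
  · refine integral_congr_ae (ae_of_all _ fun x => ?_)
    simp only [← Complex.exp_add]
    congr 1
    rw [inner_add_left, real_inner_comm η x, real_inner_comm ξ x]
    push_cast
    ring
  · congr 2
    have : (b : ℂ) ≠ 0 := by exact_mod_cast hb.ne'
    field_simp
    rw [Complex.I_sq]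
    ring

theorem lintegral_gaussian_mul_fourierPlus_sq_le {n : ℕ} {v : EuclideanSpace ℝ (Fin n) → ℂ}
    (hv : Integrable v) {t : ℝ} (ht : 0 < t) :
    ∫⁻ ξ, ENNReal.ofReal (Real.exp (-(π * t * ‖ξ‖ ^ 2)) * ‖fourierPlus v ξ‖ ^ 2) ≤
      ∫⁻ x, ∫⁻ y, ENNReal.ofReal (‖v x‖ * ‖v y‖ *
        (t ^ (-((n : ℝ) / 2)) * Real.exp (-(π * ‖x - y‖ ^ 2 / t)))) := by
  have hb : 0 < π * t := by positivity
  have hGi (x : EuclideanSpace ℝ (Fin n)) := integrable_gaussian_char hb (-x)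
  have hG0 : Integrable fun ξ : EuclideanSpace ℝ (Fin n) =>
      Complex.exp (-(π * t : ℝ) * ‖ξ‖ ^ 2) := by
    simpa using hGi 0
  have hVc := continuous_fourierPlus hv
  have hbound : Integrable fun ξ => Complex.exp (-(π * t : ℝ) * ‖ξ‖ ^ 2) *
      (starRingEnd ℂ) (fourierPlus v ξ) := by
    refine hG0.mul_bdd (c := ∫ x, ‖v x‖) (Continuous.aestronglyMeasurable (by fun_prop))
      (ae_of_all _ fun ξ => ?_)
    rw [RCLike.norm_conj]
    exact norm_fourierPlus_le v ξ
  have hnorm (ξ : EuclideanSpace ℝ (Fin n)) :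
      fourierPlus v ξ * (Complex.exp (-(π * t : ℝ) * ‖ξ‖ ^ 2) *
        (starRingEnd ℂ) (fourierPlus v ξ)) =
      (Real.exp (-(π * t * ‖ξ‖ ^ 2)) * ‖fourierPlus v ξ‖ ^ 2 : ℝ) := by
    rw [mul_left_comm, Complex.mul_conj']
    push_cast
    ring_nf
  have hInt : Integrable fun ξ => Real.exp (-(π * t * ‖ξ‖ ^ 2)) * ‖fourierPlus v ξ‖ ^ 2 := by
    have h1 := (hbound.bdd_mul (c := ∫ x, ‖v x‖) hVc.aestronglyMeasurable
      (ae_of_all _ (norm_fourierPlus_le v))).norm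
    refine h1.congr (ae_of_all _ fun ξ => ?_)
    simp only [hnorm]
    rw [Complex.norm_real, Real.norm_of_nonneg (by positivity)]
  have hW (x : EuclideanSpace ℝ (Fin n)) :
      fourierPlus (fun ξ => Complex.exp (-(π * t : ℝ) * ‖ξ‖ ^ 2) *
        (starRingEnd ℂ) (fourierPlus v ξ)) x =
      (starRingEnd ℂ) (∫ y, v y *
        (t ^ (-((n : ℝ) / 2)) * Real.exp (-(π * ‖x - y‖ ^ 2 / t)) : ℝ)) := by
    have h2 := integral_fourierPlus_mul hv (hGi x)
    simp only [fourierPlus_gaussian_char hb] at h2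
    have h3 (y : EuclideanSpace ℝ (Fin n)) :
        (π / (π * t)) ^ ((n : ℝ) / 2) * Real.exp (-(π ^ 2 * ‖y + -x‖ ^ 2 / (π * t))) =
        t ^ (-((n : ℝ) / 2)) * Real.exp (-(π * ‖x - y‖ ^ 2 / t)) := by
      rw [← sub_eq_add_neg, norm_sub_rev, Real.rpow_neg ht.le, ← Real.inv_rpow ht.le]
      congr 2
      · field_simp
      · field_simp
    simp only [h3] at h2
    rw [← h2, ← integral_conj]
    refine integral_congr_ae (ae_of_all _ fun ξ => ?_)
    simp only [map_mul, ← Complex.exp_conj, map_neg, Complex.conj_I, Complex.conj_ofReal, map_pow,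
      map_ofNat, inner_neg_right, Complex.ofReal_neg]
    ring_nf
  calc ∫⁻ ξ, ENNReal.ofReal (Real.exp (-(π * t * ‖ξ‖ ^ 2)) * ‖fourierPlus v ξ‖ ^ 2)
      = ENNReal.ofReal (∫ ξ, Real.exp (-(π * t * ‖ξ‖ ^ 2)) * ‖fourierPlus v ξ‖ ^ 2) :=
        (ofReal_integral_eq_lintegral_ofReal hInt (ae_of_all _ fun ξ => by positivity)).symm
    _ ≤ ‖∫ ξ, fourierPlus v ξ * (Complex.exp (-(π * t : ℝ) * ‖ξ‖ ^ 2) *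
          (starRingEnd ℂ) (fourierPlus v ξ))‖ₑ := by
        simp only [hnorm]
        rw [integral_complex_ofReal, ← ofReal_norm, Complex.norm_real]
        exact ENNReal.ofReal_le_ofReal (le_abs_self _)
    _ ≤ ∫⁻ x, ‖v x * fourierPlus (fun ξ => Complex.exp (-(π * t : ℝ) * ‖ξ‖ ^ 2) *
          (starRingEnd ℂ) (fourierPlus v ξ)) x‖ₑ := by
        rw [integral_fourierPlus_mul hv hbound]
        exact enorm_integral_le_lintegral_enorm _
    _ ≤ _ := by
        refine lintegral_mono fun x => ?_
        rw [hW, enorm_mul]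
        have h4 : ‖(starRingEnd ℂ) (∫ y, v y *
            (t ^ (-((n : ℝ) / 2)) * Real.exp (-(π * ‖x - y‖ ^ 2 / t)) : ℝ))‖ₑ ≤
            ∫⁻ y, ‖v y * (t ^ (-((n : ℝ) / 2)) * Real.exp (-(π * ‖x - y‖ ^ 2 / t)) : ℝ)‖ₑ := by
          rw [← ofReal_norm, RCLike.norm_conj, ofReal_norm]
          exact enorm_integral_le_lintegral_enorm _
        refine (mul_le_mul_right h4 _).trans_eq ?_
        rw [← lintegral_const_mul' _ _ enorm_ne_top]
        refine lintegral_congr fun y => ?_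
        rw [← enorm_mul, ← ofReal_norm, norm_mul, norm_mul, Complex.norm_real,
          Real.norm_of_nonneg (by positivity), mul_assoc]

theorem lintegral_rpow_mul_exp_neg_div_Ioi {c b : ℝ} (hc : 0 < c) (hb : 0 < b) :
    ∫⁻ t in Set.Ioi (0 : ℝ), ENNReal.ofReal (t ^ (-c - 1) * Real.exp (-(b / t))) =
      ENNReal.ofReal (b ^ (-c) * Real.Gamma c) := by
  have himage : Set.image (fun t : ℝ => t⁻¹) (Set.Ioi 0) = Set.Ioi 0 := by
    ext s
    simp only [Set.mem_image, Set.mem_Ioi]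
    exact ⟨fun ⟨t, ht, hs⟩ => hs ▸ inv_pos.2 ht, fun hs => ⟨s⁻¹, inv_pos.2 hs, inv_inv s⟩⟩
  rw [← lintegral_rpow_mul_exp_neg_mul_Ioi hc hb]
  conv_rhs => rw [← himage]
  rw [lintegral_image_eq_lintegral_abs_deriv_mul measurableSet_Ioi
    (f' := fun t => -(t ^ 2)⁻¹) (fun t ht => (hasDerivAt_inv (ne_of_gt ht)).hasDerivWithinAt)
    inv_injective.injOn]
  refine setLIntegral_congr_fun measurableSet_Ioi fun t ht => ?_
  have ht : 0 < t := ht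
  rw [← ENNReal.ofReal_mul (abs_nonneg _), abs_neg, abs_of_pos (by positivity), ← mul_assoc,
    Real.inv_rpow ht.le, ← Real.rpow_neg ht.le, ← Real.rpow_natCast, ← Real.rpow_neg ht.le,
    ← Real.rpow_add ht, div_eq_mul_inv]
  congr 3
  push_cast
  ring

theorem lintegral_norm_rpow_mul_fourierPlus_sq_le {n : ℕ} (hn : 1 ≤ n) {q : ℝ} (hq : 0 < q)
    (hqn : 2 * q < n) {v : EuclideanSpace ℝ (Fin n) → ℂ} (hvm : Measurable v)
    (hv : Integrable v) :
    ∫⁻ ξ, ENNReal.ofReal (‖ξ‖ ^ (-(n - 2 * q)) * ‖fourierPlus v ξ‖ ^ 2) ≤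
      ENNReal.ofReal (π ^ ((n : ℝ) / 2 - 2 * q) * (Real.Gamma q / Real.Gamma ((n : ℝ) / 2 - q))) *
        rieszEnergy q fun x => ‖v x‖ := by
  have : Nonempty (Fin n) := ⟨⟨0, by omega⟩⟩
  have hα : 0 < (n : ℝ) / 2 - q := by linarith
  have hΓq := Real.Gamma_pos_of_pos hq
  have hΓα := Real.Gamma_pos_of_pos hα
  have hVm : Measurable (fourierPlus v) := (continuous_fourierPlus hv).measurable
  have hne (x : EuclideanSpace ℝ (Fin n)) : ∀ᵐ y : EuclideanSpace ℝ (Fin n), y ≠ x :=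
    compl_mem_ae_iff.2 (measure_singleton x)
  have hleft : ∫⁻ t in Set.Ioi (0 : ℝ), ENNReal.ofReal (t ^ ((n : ℝ) / 2 - q - 1)) *
        ∫⁻ ξ, ENNReal.ofReal (Real.exp (-(π * t * ‖ξ‖ ^ 2)) * ‖fourierPlus v ξ‖ ^ 2) =
      ENNReal.ofReal (π ^ (-((n : ℝ) / 2 - q)) * Real.Gamma ((n : ℝ) / 2 - q)) *
        ∫⁻ ξ, ENNReal.ofReal (‖ξ‖ ^ (-(n - 2 * q)) * ‖fourierPlus v ξ‖ ^ 2) := by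
    simp_rw [← lintegral_const_mul' _ _ ENNReal.ofReal_ne_top]
    rw [lintegral_lintegral_swap (Measurable.aemeasurable (by fun_prop))]
    refine lintegral_congr_ae ?_
    filter_upwards [hne 0] with ξ hξ
    have hξ : 0 < ‖ξ‖ := norm_pos_iff.2 hξ
    have h1 := lintegral_rpow_mul_exp_neg_mul_Ioi hα (show 0 < π * ‖ξ‖ ^ 2 by positivity)
    calc _ = ∫⁻ t in Set.Ioi (0 : ℝ), ENNReal.ofReal (t ^ ((n : ℝ) / 2 - q - 1) *
            Real.exp (-(π * ‖ξ‖ ^ 2 * t))) * ENNReal.ofReal (‖fourierPlus v ξ‖ ^ 2) := by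
          refine setLIntegral_congr_fun measurableSet_Ioi fun t ht => ?_
          have ht : 0 < t := ht
          rw [← ENNReal.ofReal_mul (by positivity), ← ENNReal.ofReal_mul (by positivity)]
          ring_nf
      _ = _ := by
          rw [lintegral_mul_const' _ _ ENNReal.ofReal_ne_top, h1,
            ← ENNReal.ofReal_mul (by positivity), ← ENNReal.ofReal_mul (by positivity),
            Real.mul_rpow pi_nonneg (by positivity), ← Real.rpow_natCast, ← Real.rpow_mul hξ.le,
            show ((2 : ℕ) : ℝ) * -((n : ℝ) / 2 - q) = -(n - 2 * q) by push_cast; ring]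
          ring_nf
  have hright : ∫⁻ t in Set.Ioi (0 : ℝ), ENNReal.ofReal (t ^ ((n : ℝ) / 2 - q - 1)) *
        ∫⁻ x, ∫⁻ y, ENNReal.ofReal (‖v x‖ * ‖v y‖ *
          (t ^ (-((n : ℝ) / 2)) * Real.exp (-(π * ‖x - y‖ ^ 2 / t)))) =
      ENNReal.ofReal (π ^ (-q) * Real.Gamma q) * rieszEnergy q fun x => ‖v x‖ := by
    simp_rw [rieszEnergy, ← lintegral_const_mul' _ _ ENNReal.ofReal_ne_top]
    rw [lintegral_lintegral_swap (Measurable.aemeasurable (by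
      refine Measurable.lintegral_prod_right' (f := fun z : (ℝ × EuclideanSpace ℝ (Fin n)) ×
        EuclideanSpace ℝ (Fin n) => ENNReal.ofReal (z.1.1 ^ ((n : ℝ) / 2 - q - 1)) *
          ENNReal.ofReal (‖v z.1.2‖ * ‖v z.2‖ * (z.1.1 ^ (-((n : ℝ) / 2)) *
            Real.exp (-(π * ‖z.1.2 - z.2‖ ^ 2 / z.1.1))))) ?_
      fun_prop))]
    refine lintegral_congr fun x => ?_
    rw [lintegral_lintegral_swap (Measurable.aemeasurable (by fun_prop))]
    refine lintegral_congr_ae ?_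
    filter_upwards [hne x] with y hy
    have hxy : 0 < ‖x - y‖ := norm_pos_iff.2 (sub_ne_zero.2 hy.symm)
    have h1 := lintegral_rpow_mul_exp_neg_div_Ioi hq (show 0 < π * ‖x - y‖ ^ 2 by positivity)
    calc _ = ∫⁻ t in Set.Ioi (0 : ℝ), ENNReal.ofReal (t ^ (-q - 1) *
            Real.exp (-(π * ‖x - y‖ ^ 2 / t))) * ENNReal.ofReal (‖v x‖ * ‖v y‖) := by
          refine setLIntegral_congr_fun measurableSet_Ioi fun t ht => ?_
          have ht : 0 < t := ht
          rw [← ENNReal.ofReal_mul (by positivity), ← ENNReal.ofReal_mul (by positivity),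
            show -q - 1 = ((n : ℝ) / 2 - q - 1) + -((n : ℝ) / 2) by ring, Real.rpow_add ht]
          ring_nf
      _ = _ := by
          rw [lintegral_mul_const' _ _ ENNReal.ofReal_ne_top, h1,
            ← ENNReal.ofReal_mul (by positivity), ← ENNReal.ofReal_mul (by positivity),
            Real.mul_rpow pi_nonneg (by positivity), ← Real.rpow_natCast, ← Real.rpow_mul hxy.le,
            show ((2 : ℕ) : ℝ) * -q = -(2 * q) by push_cast; ring]
          ring_nf
  have hmain : ENNReal.ofReal (π ^ (-((n : ℝ) / 2 - q)) * Real.Gamma ((n : ℝ) / 2 - q)) *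
        ∫⁻ ξ, ENNReal.ofReal (‖ξ‖ ^ (-(n - 2 * q)) * ‖fourierPlus v ξ‖ ^ 2) ≤
      ENNReal.ofReal (π ^ (-q) * Real.Gamma q) * rieszEnergy q fun x => ‖v x‖ := by
    rw [← hleft, ← hright]
    refine setLIntegral_mono' measurableSet_Ioi fun t ht => ?_
    exact mul_le_mul_right (lintegral_gaussian_mul_fourierPlus_sq_le hv ht) _
  calc ∫⁻ ξ, ENNReal.ofReal (‖ξ‖ ^ (-(n - 2 * q)) * ‖fourierPlus v ξ‖ ^ 2)
      = ENNReal.ofReal (π ^ ((n : ℝ) / 2 - q) * (Real.Gamma ((n : ℝ) / 2 - q))⁻¹) *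
        (ENNReal.ofReal (π ^ (-((n : ℝ) / 2 - q)) * Real.Gamma ((n : ℝ) / 2 - q)) *
          ∫⁻ ξ, ENNReal.ofReal (‖ξ‖ ^ (-(n - 2 * q)) * ‖fourierPlus v ξ‖ ^ 2)) := by
        rw [← mul_assoc, ← ENNReal.ofReal_mul (by positivity), mul_mul_mul_comm,
          ← Real.rpow_add pi_pos, inv_mul_cancel₀ hΓα.ne', add_neg_cancel, Real.rpow_zero, mul_one,
          ENNReal.ofReal_one, one_mul]
    _ ≤ _ := by
        refine (mul_le_mul_right hmain _).trans_eq ?_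
        rw [← mul_assoc, ← ENNReal.ofReal_mul (by positivity),
          show (n : ℝ) / 2 - 2 * q = (n / 2 - q) + -q by ring, Real.rpow_add pi_pos]
        ring_nf

theorem integrable_gaussian_mul_fourierPlus {n : ℕ} {g : EuclideanSpace ℝ (Fin n) → ℂ}
    (hg : Integrable g) {c : ℝ} (hc : 0 < c) :
    Integrable fun x : EuclideanSpace ℝ (Fin n) =>
      Complex.exp (-(c⁻¹ : ℝ) * ‖x‖ ^ 2) * fourierPlus g (-x) := by
  have h0 := integrable_gaussian_char (n := n) (inv_pos.2 hc) 0
  simp only [inner_zero_right, Complex.ofReal_zero, mul_zero, Complex.exp_zero, one_mul] at h0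
  exact h0.mul_bdd (c := ∫ x, ‖g x‖)
    ((continuous_fourierPlus hg).comp continuous_neg).aestronglyMeasurable
    (ae_of_all _ fun x => norm_fourierPlus_le g (-x))

theorem tendsto_fourierPlus_gaussian_mul_fourierPlus {n : ℕ} {g : EuclideanSpace ℝ (Fin n) → ℂ}
    (hg : Integrable g) (hgc : Continuous g) (ξ : EuclideanSpace ℝ (Fin n)) :
    Filter.Tendsto (fun c : ℝ => fourierPlus
      (fun x => Complex.exp (-(c⁻¹ : ℝ) * ‖x‖ ^ 2) * fourierPlus g (-x)) ξ)
      Filter.atTop (nhds (g ξ)) := by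
  refine (Real.tendsto_integral_gaussian_smul' hg (v := ξ) hgc.continuousAt).congr' ?_
  filter_upwards [Filter.Ioi_mem_atTop 0] with c hc
  have hc : 0 < c := hc
  have h1 := integral_fourierPlus_mul hg (integrable_gaussian_char (inv_pos.2 hc) (-ξ))
  simp only [fourierPlus_gaussian_char (inv_pos.2 hc)] at h1
  trans ∫ x, fourierPlus g x * (Complex.exp (2 * π * Complex.I * (⟪x, -ξ⟫_ℝ : ℂ)) *
    Complex.exp (-(c⁻¹ : ℝ) * ‖x‖ ^ 2))
  · rw [h1]
    refine integral_congr_ae (ae_of_all _ fun w => ?_)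
    simp only
    rw [smul_eq_mul, mul_comm, finrank_euclideanSpace_fin, ← sub_eq_add_neg, norm_sub_rev,
      Complex.ofReal_mul, Complex.ofReal_cpow (by positivity)]
    push_cast
    rw [div_inv_eq_mul, div_inv_eq_mul]
    ring_nf
  · rw [fourierPlus, ← integral_neg_eq_self]
    refine integral_congr_ae (ae_of_all _ fun x => ?_)
    simp only [inner_neg_left, inner_neg_right, norm_neg, neg_neg]
    ring

theorem fourierPlus_eq_fourierInv {n : ℕ} (g : EuclideanSpace ℝ (Fin n) → ℂ) :
    fourierPlus g = FourierTransformInv.fourierInv g := by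
  ext ξ
  rw [Real.fourierInv_eq']
  refine integral_congr_ae (ae_of_all _ fun x => ?_)
  simp only [smul_eq_mul]
  congr 2
  push_cast
  ring

theorem lintegral_fourierPlus_sq {n : ℕ} (f : SchwartzMap (EuclideanSpace ℝ (Fin n)) ℂ) :
    ∫⁻ ξ, ENNReal.ofReal (‖fourierPlus f ξ‖ ^ 2) = ∫⁻ x, ENNReal.ofReal (‖f x‖ ^ 2) := by
  have hsq (h : SchwartzMap (EuclideanSpace ℝ (Fin n)) ℂ) :
      Integrable fun x => ‖h x‖ ^ 2 :=
    (h.memLp 2).integrable_norm_pow (by norm_num)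
  have hf : fourierPlus f = ⇑(FourierTransformInv.fourierInv f) := by
    rw [fourierPlus_eq_fourierInv, SchwartzMap.fourierInv_coe]
  have h := SchwartzMap.integral_norm_sq_fourier (FourierTransformInv.fourierInv f)
  rw [FourierTransform.fourier_fourierInv_eq] at h
  rw [hf, ← ofReal_integral_eq_lintegral_ofReal (hsq _) (ae_of_all _ fun x => by positivity),
    ← ofReal_integral_eq_lintegral_ofReal (hsq _) (ae_of_all _ fun x => by positivity), h]

theorem integrable_norm_rpow_mul_schwartz {n : ℕ} {α : ℝ} (hα : 0 < α)
    (h : SchwartzMap (EuclideanSpace ℝ (Fin n)) ℂ) :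
    Integrable fun ξ => ((‖ξ‖ ^ α : ℝ) : ℂ) * h ξ := by
  obtain ⟨k, hk⟩ := exists_nat_ge α
  have h1 := (h.integrable_pow_mul volume k).add (h.integrable_pow_mul volume 0)
  refine h1.mono ?_ (ae_of_all _ fun ξ => ?_)
  · have := Real.continuous_rpow_const hα.le
    exact Continuous.aestronglyMeasurable (by fun_prop)
  · have hb : ‖ξ‖ ^ α ≤ ‖ξ‖ ^ k + 1 := by
      rcases le_total ‖ξ‖ 1 with hle | hle
      · exact (Real.rpow_le_one (norm_nonneg _) hle hα.le).trans (by simp)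
      · exact ((Real.rpow_le_rpow_of_exponent_le hle hk).trans_eq (Real.rpow_natCast _ _)).trans
          (by simp)
    rw [norm_mul, Complex.norm_real, Real.norm_of_nonneg (by positivity), Pi.add_apply,
      Real.norm_of_nonneg (by positivity), pow_zero, ← add_mul]
    gcongr

theorem fourierConst_mul_hlsConst {n : ℕ} (hn : 1 ≤ n) {p q : ℝ} (hqn : 2 * q < n)
    (hp : p * (n - q) = n) :
    π ^ ((n : ℝ) / 2 - 2 * q) * (Real.Gamma q / Real.Gamma ((n : ℝ) / 2 - q)) * hlsConst n q =
      π ^ ((n : ℝ) / p - (n : ℝ) / 2) *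
        (Real.Gamma ((n : ℝ) / (p / (p - 1))) / Real.Gamma ((n : ℝ) / p)) *
        (Real.Gamma (n : ℝ) / Real.Gamma ((n : ℝ) / 2)) ^ (2 / p - 1) := by
  have hn0 : (0 : ℝ) < n := by exact_mod_cast hn
  have hnq : 0 < (n : ℝ) - q := by linarith
  have hp0 : p ≠ 0 := by
    rintro rfl
    linarith
  have h1 : (n : ℝ) / p = n - q := by
    rw [div_eq_iff hp0]
    linarith
  have h2 : (n : ℝ) / (p / (p - 1)) = q := by
    rw [div_div_eq_mul_div, mul_sub, sub_div, mul_div_cancel_right₀ _ hp0, mul_one, h1]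
    ring
  have h3 : 2 / p - 1 = -(2 * q / n - 1) := by
    have : 1 / p = (n - q) / n := by
      rw [← h1]
      field_simp
    rw [show 2 / p = 2 * (1 / p) by ring, this]
    field_simp
    ring
  have hΓ1 := Real.Gamma_pos_of_pos (show 0 < (n : ℝ) / 2 - q by linarith)
  have hΓ2 := Real.Gamma_pos_of_pos (show 0 < (n : ℝ) / 2 by linarith)
  have hΓ3 := Real.Gamma_pos_of_pos hn0
  rw [h1, h2, h3, hlsConst, rieszMass, sphereMass, Real.rpow_neg (by positivity),
    ← Real.inv_rpow (by positivity), inv_div, mul_div_assoc (π ^ _) (Real.Gamma (n / 2)),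
    Real.mul_rpow (by positivity) (by positivity), ← Real.rpow_mul pi_nonneg,
    show (n : ℝ) - q - n / 2 = (n / 2 - 2 * q) + n / 2 + n / 2 * (2 * q / n - 1) by
      field_simp
      ring,
    Real.rpow_add pi_pos, Real.rpow_add pi_pos]
  generalize Real.Gamma ((n : ℝ) / 2 - q) = a at hΓ1 ⊢
  field_simp

end FourierForm

/-- **Hardy–Littlewood–Sobolev inequality, fractional Laplacian form.**
For `1 < p < 2`, `α = n(1/p − 1/2)` and `f` Schwartz,
`∫ |f|² ≤ C_p (∫ |(−Δ/4π²)^{α/2} f|^p)^{2/p}`. -/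
theorem stmt2 (n : ℕ) (hn : 1 ≤ n) (p : ℝ) (hp1 : 1 < p) (hp2 : p < 2)
    (α : ℝ) (hα : α = n * (1 / p - 1 / 2))
    (f : SchwartzMap (EuclideanSpace ℝ (Fin n)) ℂ)
    (u : EuclideanSpace ℝ (Fin n) → ℂ)
    (hu : ∀ x, u x = ∫ ξ, Complex.exp (-(2 * Real.pi * Complex.I * (⟪x, ξ⟫_ℝ : ℂ))) *
      ((‖ξ‖ ^ α : ℝ) * fourierPlus (fun y => f y) ξ)) :
    (∫⁻ x, (‖f x‖₊ : ℝ≥0∞) ^ (2 : ℕ)) ≤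
      ENNReal.ofReal
        (Real.pi ^ ((n : ℝ) / p - (n : ℝ) / 2) *
          (Real.Gamma ((n : ℝ) / (p / (p - 1))) / Real.Gamma ((n : ℝ) / p)) *
          (Real.Gamma (n : ℝ) / Real.Gamma ((n : ℝ) / 2)) ^ (2 / p - 1)) *
        (∫⁻ x, (‖u x‖₊ : ℝ≥0∞) ^ p) ^ (2 / p) := by
  have : Nonempty (Fin n) := ⟨⟨0, by omega⟩⟩
  have hn0 : (0 : ℝ) < n := by exact_mod_cast hn
  have hp0 : 0 < p := by linarith
  obtain ⟨q, hqdef⟩ : ∃ q : ℝ, q = n * (1 - 1 / p) := ⟨_, rfl⟩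
  have hp : p * (n - q) = n := by
    rw [hqdef]
    field_simp
    ring
  have hq : 0 < q := by
    have : 1 / p < 1 := by rwa [div_lt_one hp0]
    rw [hqdef]
    exact mul_pos hn0 (by linarith)
  have hqn : 2 * q < n := by nlinarith
  have hαq : α = n / 2 - q := by
    rw [hα, hqdef]
    ring
  have hα0 : 0 < α := by linarith
  have hΓq := Real.Gamma_pos_of_pos hq
  have hΓα := Real.Gamma_pos_of_pos (show 0 < (n : ℝ) / 2 - q by linarith)
  set g : EuclideanSpace ℝ (Fin n) → ℂ := fun ξ => ((‖ξ‖ ^ α : ℝ) : ℂ) * fourierPlus f ξ with hg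
  have hfhat : fourierPlus f = ⇑(FourierTransformInv.fourierInv f) := by
    rw [fourierPlus_eq_fourierInv, SchwartzMap.fourierInv_coe]
  have hgi : Integrable g := by
    rw [hg, hfhat]
    exact integrable_norm_rpow_mul_schwartz hα0 _
  have hgc : Continuous g := by
    have := Real.continuous_rpow_const hα0.le
    rw [hg, hfhat]
    fun_prop
  have hug (x : EuclideanSpace ℝ (Fin n)) : u x = fourierPlus g (-x) := by
    rw [hu, fourierPlus]
    refine integral_congr_ae (ae_of_all _ fun ξ => ?_)
    simp only [hg, inner_neg_right, real_inner_comm x ξ, Complex.ofReal_neg, mul_neg]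
  set v : ℕ → EuclideanSpace ℝ (Fin n) → ℂ := fun k x =>
    Complex.exp (-(((k : ℝ) + 1)⁻¹ : ℝ) * ‖x‖ ^ 2) * fourierPlus g (-x) with hv
  have hvi (k : ℕ) : Integrable (v k) := integrable_gaussian_mul_fourierPlus hgi (by positivity)
  have hvc (k : ℕ) : Continuous (v k) := by
    have := continuous_fourierPlus hgi
    fun_prop
  have hvu (k : ℕ) (x : EuclideanSpace ℝ (Fin n)) : ‖v k x‖ ≤ ‖u x‖ := by
    rw [hug, hv, norm_mul]
    refine mul_le_of_le_one_left (norm_nonneg _) ?_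
    rw [Complex.norm_exp, Real.exp_le_one_iff]
    norm_cast
    have : 0 ≤ ((k : ℝ) + 1)⁻¹ * ‖x‖ ^ 2 := by positivity
    push_cast at this ⊢
    linarith
  have hlim (ξ : EuclideanSpace ℝ (Fin n)) : Filter.Tendsto
      (fun k : ℕ => ENNReal.ofReal (‖ξ‖ ^ (-(n - 2 * q)) * ‖fourierPlus (v k) ξ‖ ^ 2)) Filter.atTop
      (nhds (ENNReal.ofReal (‖ξ‖ ^ (-(n - 2 * q)) * ‖g ξ‖ ^ 2))) := by
    refine ENNReal.tendsto_ofReal (((Filter.Tendsto.norm ?_).pow 2).const_mul _)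
    exact (tendsto_fourierPlus_gaussian_mul_fourierPlus hgi hgc ξ).comp
      (Filter.tendsto_atTop_add_const_right _ 1 tendsto_natCast_atTop_atTop)
  have hfg : ∫⁻ x, (‖f x‖₊ : ℝ≥0∞) ^ (2 : ℕ) =
      ∫⁻ ξ, ENNReal.ofReal (‖ξ‖ ^ (-(n - 2 * q)) * ‖g ξ‖ ^ 2) := by
    trans ∫⁻ x, ENNReal.ofReal (‖f x‖ ^ 2)
    · refine lintegral_congr fun x => ?_
      rw [ENNReal.ofReal_pow (norm_nonneg _), ofReal_norm, enorm_eq_nnnorm]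
    rw [← lintegral_fourierPlus_sq]
    refine lintegral_congr_ae ?_
    filter_upwards [compl_mem_ae_iff.2 (measure_singleton 0)] with ξ hξ
    have hξ : 0 < ‖ξ‖ := norm_pos_iff.2 hξ
    rw [hg, norm_mul, Complex.norm_real, Real.norm_of_nonneg (by positivity), mul_pow, ← mul_assoc,
      ← Real.rpow_natCast (‖ξ‖ ^ α), ← Real.rpow_mul hξ.le, ← Real.rpow_add hξ, hαq,
      show -((n : ℝ) - 2 * q) + (n / 2 - q) * (2 : ℕ) = 0 by push_cast; ring, Real.rpow_zero,
      one_mul]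
  have hbound (k : ℕ) :
      ∫⁻ ξ, ENNReal.ofReal (‖ξ‖ ^ (-(n - 2 * q)) * ‖fourierPlus (v k) ξ‖ ^ 2) ≤
      ENNReal.ofReal (π ^ ((n : ℝ) / 2 - 2 * q) *
        (Real.Gamma q / Real.Gamma ((n : ℝ) / 2 - q)) * hlsConst n q) *
        (∫⁻ x, (‖u x‖₊ : ℝ≥0∞) ^ p) ^ (2 / p) := by
    refine (lintegral_norm_rpow_mul_fourierPlus_sq_le hn hq hqn (hvc k).measurable (hvi k)).trans ?_
    rw [ENNReal.ofReal_mul (q := hlsConst n q) (by positivity), mul_assoc]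
    refine mul_le_mul_right ((rieszEnergy_le hn hq hqn hp (hvc k).norm.measurable
      fun x => norm_nonneg _).trans ?_) _
    gcongr with x
    rw [← ENNReal.ofReal_rpow_of_nonneg (norm_nonneg _) hp0.le, ← enorm_eq_nnnorm, ← ofReal_norm]
    gcongr
    exact hvu k x
  rw [hfg, ← fourierConst_mul_hlsConst hn hqn hp]
  calc ∫⁻ ξ, ENNReal.ofReal (‖ξ‖ ^ (-(n - 2 * q)) * ‖g ξ‖ ^ 2)
      = ∫⁻ ξ, Filter.liminf (fun k : ℕ =>
          ENNReal.ofReal (‖ξ‖ ^ (-(n - 2 * q)) * ‖fourierPlus (v k) ξ‖ ^ 2)) Filter.atTop :=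
        lintegral_congr fun ξ => (hlim ξ).liminf_eq.symm
    _ ≤ Filter.liminf (fun k : ℕ => ∫⁻ ξ,
          ENNReal.ofReal (‖ξ‖ ^ (-(n - 2 * q)) * ‖fourierPlus (v k) ξ‖ ^ 2)) Filter.atTop := by
        refine lintegral_liminf_le fun k => ?_
        have := (continuous_fourierPlus (hvi k)).measurable
        fun_prop
    _ ≤ _ := (Filter.liminf_le_liminf (Filter.Eventually.of_forall hbound)).trans_eq
        (Filter.liminf_const _)
end
end

section
/- Let n ≥ 1 and let a, b > 0 satisfy a + b < n. Then for all x, w ∈ ℝ^n with x ≠ w, ∫_{ℝ^n} |y−x|^{−(n−a)} |y−w|^{−(n−b)} dy = π^{n/2} · [Γ(a/2) Γ(b/2) Γ((n−a−b)/2)] / [Γ((n−a)/2) Γ((n−b)/2) Γ((a+b)/2)] · |x−w|^{−(n−a−b)}. -/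
open MeasureTheory Real
open scoped ENNReal

noncomputable section

/-- The Gamma integral with a scaling parameter, as a Lebesgue integral. -/
lemma lintegral_rpow_mul_exp_neg_mul {p c : ℝ} (hp : 0 < p) (hc : 0 < c) :
    ∫⁻ t in Set.Ioi (0 : ℝ), ENNReal.ofReal (t ^ (p - 1) * exp (-(c * t))) =
      ENNReal.ofReal (Gamma p * c ^ (-p)) := by
  have key := integral_rpow_mul_exp_neg_mul_Ioi hp hc
  have hΓ := Gamma_pos_of_pos hp
  rw [← ofReal_integral_eq_lintegral_ofReal (.of_integral_ne_zero (by rw [key]; positivity)), key]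
  · rw [one_div, inv_rpow hc.le, rpow_neg hc.le, mul_comm]
  · exact (ae_restrict_iff' measurableSet_Ioi).2 (ae_of_all _ fun t (ht : 0 < t) => by positivity)

/-- The substitution `s = t * v` on the positive half-line. -/
lemma lintegral_Ioi_comp_mul_left {t : ℝ} (ht : 0 < t) (f : ℝ → ℝ≥0∞) :
    ∫⁻ s in Set.Ioi (0 : ℝ), f s = ∫⁻ v in Set.Ioi (0 : ℝ), ENNReal.ofReal t * f (t * v) := by
  have h := lintegral_image_eq_lintegral_abs_deriv_mul (s := Set.Ioi (0 : ℝ))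
    (f := fun v => t * v) (f' := fun _ => t) measurableSet_Ioi
    (fun v _ => by simpa using ((hasDerivAt_id v).const_mul t).hasDerivWithinAt)
    (fun u _ v _ huv => mul_left_cancel₀ ht.ne' huv) f
  rw [Set.image_mul_left_Ioi ht, mul_zero, abs_of_pos ht] at h
  exact h

/-- The Euler beta integral on the positive half-line. -/
lemma lintegral_beta_Ioi {p q : ℝ} (hp : 0 < p) (hq : 0 < q) :
    ∫⁻ v in Set.Ioi (0 : ℝ), ENNReal.ofReal (v ^ (p - 1) * (1 + v) ^ (-(p + q))) =
      ENNReal.ofReal (Gamma p * Gamma q / Gamma (p + q)) := by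
  have hpq : 0 < p + q := add_pos hp hq
  have hΓ := Gamma_pos_of_pos hpq
  have hΓp := Gamma_pos_of_pos hp
  have hΓq := Gamma_pos_of_pos hq
  have key : ENNReal.ofReal (Gamma (p + q)) *
      ∫⁻ v in Set.Ioi (0 : ℝ), ENNReal.ofReal (v ^ (p - 1) * (1 + v) ^ (-(p + q))) =
      ENNReal.ofReal (Gamma p * Gamma q) := by
    calc
      _ = ∫⁻ v in Set.Ioi (0 : ℝ), ∫⁻ u in Set.Ioi (0 : ℝ),
            ENNReal.ofReal (v ^ (p - 1) * (u ^ (p + q - 1) * exp (-((1 + v) * u)))) := by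
        rw [← lintegral_const_mul' _ _ ENNReal.ofReal_ne_top]
        refine setLIntegral_congr_fun measurableSet_Ioi fun v (hv : 0 < v) => ?_
        have hv' : 0 ≤ v ^ (p - 1) := by positivity
        simp only [ENNReal.ofReal_mul hv']
        rw [lintegral_const_mul' _ _ ENNReal.ofReal_ne_top,
          lintegral_rpow_mul_exp_neg_mul hpq (by positivity), ENNReal.ofReal_mul hΓ.le]
        ring
      _ = ∫⁻ u in Set.Ioi (0 : ℝ), ∫⁻ v in Set.Ioi (0 : ℝ),
            ENNReal.ofReal (v ^ (p - 1) * (u ^ (p + q - 1) * exp (-((1 + v) * u)))) :=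
        lintegral_lintegral_swap (by unfold Function.uncurry; fun_prop)
      _ = ∫⁻ u in Set.Ioi (0 : ℝ), ENNReal.ofReal (Gamma p) *
            ENNReal.ofReal (u ^ (q - 1) * exp (-(1 * u))) := by
        refine setLIntegral_congr_fun measurableSet_Ioi fun u (hu : 0 < u) => ?_
        have h1 : ∀ v : ℝ, v ^ (p - 1) * (u ^ (p + q - 1) * exp (-((1 + v) * u))) =
            (u ^ (p + q - 1) * exp (-u)) * (v ^ (p - 1) * exp (-(u * v))) := fun v => by
          rw [show -((1 + v) * u) = -u + -(u * v) by ring, exp_add]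
          ring
        have hu' : 0 ≤ u ^ (p + q - 1) * exp (-u) := by positivity
        simp only [h1, ENNReal.ofReal_mul hu']
        rw [lintegral_const_mul' _ _ ENNReal.ofReal_ne_top,
          lintegral_rpow_mul_exp_neg_mul hp hu, ← ENNReal.ofReal_mul hu',
          ← ENNReal.ofReal_mul hΓp.le, one_mul,
          show q - 1 = (p + q - 1) + (-p) by ring, rpow_add hu]
        congr 1
        ring
      _ = _ := by
        rw [lintegral_const_mul' _ _ ENNReal.ofReal_ne_top,
          lintegral_rpow_mul_exp_neg_mul hq one_pos, ← ENNReal.ofReal_mul hΓp.le, one_rpow, mul_one]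
  rw [ENNReal.ofReal_div_of_pos hΓ]
  exact (ENNReal.eq_div_iff (by simpa using hΓ) ENNReal.ofReal_ne_top).2 key

/-- The integral over the positive quadrant left after integrating out the Gaussian factors. -/
lemma lintegral_rpow_mul_exp_neg_harmonic {α β m ρ : ℝ} (hρ : 0 < ρ) (hα : α < m) (hβ : β < m)
    (hm : m < α + β) :
    ∫⁻ t in Set.Ioi (0 : ℝ), ∫⁻ s in Set.Ioi (0 : ℝ), ENNReal.ofReal
        (s ^ (α - 1) * t ^ (β - 1) * ((s + t) ^ (-m) * exp (-(s * t / (s + t) * ρ)))) =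
      ENNReal.ofReal (Gamma (α + β - m) * ρ ^ (-(α + β - m)) *
        (Gamma (m - β) * Gamma (m - α) / Gamma (m - β + (m - α)))) := by
  set γ := α + β - m with hγ_def
  have hγ : 0 < γ := by linarith
  have hΓ := Gamma_pos_of_pos hγ
  have hΓ' : 0 ≤ Gamma γ * ρ ^ (-γ) := by positivity
  calc
    _ = ∫⁻ t in Set.Ioi (0 : ℝ), ∫⁻ v in Set.Ioi (0 : ℝ), ENNReal.ofReal
          (v ^ (α - 1) * (1 + v) ^ (-m) * (t ^ (γ - 1) * exp (-(v / (1 + v) * ρ * t)))) := by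
      refine setLIntegral_congr_fun measurableSet_Ioi fun t (ht : 0 < t) => ?_
      rw [lintegral_Ioi_comp_mul_left ht]
      refine setLIntegral_congr_fun measurableSet_Ioi fun v (hv : 0 < v) => ?_
      rw [← ENNReal.ofReal_mul ht.le]
      congr 1
      have h1v : 0 < 1 + v := by positivity
      rw [show t * v + t = t * (1 + v) by ring, mul_rpow ht.le hv.le, mul_rpow ht.le h1v.le,
        show t * v * t / (t * (1 + v)) * ρ = v / (1 + v) * ρ * t by field_simp,
        show γ - 1 = 1 + (α - 1) + (β - 1) + (-m) by rw [hγ_def]; ring,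
        rpow_add ht, rpow_add ht, rpow_add ht, rpow_one]
      ring
    _ = ∫⁻ v in Set.Ioi (0 : ℝ), ∫⁻ t in Set.Ioi (0 : ℝ), ENNReal.ofReal
          (v ^ (α - 1) * (1 + v) ^ (-m) * (t ^ (γ - 1) * exp (-(v / (1 + v) * ρ * t)))) :=
      lintegral_lintegral_swap (by unfold Function.uncurry; fun_prop)
    _ = ∫⁻ v in Set.Ioi (0 : ℝ), ENNReal.ofReal (Gamma γ * ρ ^ (-γ)) *
          ENNReal.ofReal (v ^ (m - β - 1) * (1 + v) ^ (-(m - β + (m - α)))) := by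
      refine setLIntegral_congr_fun measurableSet_Ioi fun v (hv : 0 < v) => ?_
      have h1v : 0 < 1 + v := by positivity
      have hv' : 0 ≤ v ^ (α - 1) * (1 + v) ^ (-m) := by positivity
      simp only [ENNReal.ofReal_mul hv']
      rw [lintegral_const_mul' _ _ ENNReal.ofReal_ne_top,
        lintegral_rpow_mul_exp_neg_mul hγ (by positivity), ← ENNReal.ofReal_mul hv',
        ← ENNReal.ofReal_mul hΓ', mul_rpow (by positivity) hρ.le, div_rpow hv.le h1v.le,
        rpow_neg h1v.le γ, div_inv_eq_mul,
        show m - β - 1 = (α - 1) + (-γ) by rw [hγ_def]; ring,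
        show -(m - β + (m - α)) = -m + γ by rw [hγ_def]; ring, rpow_add hv, rpow_add h1v]
      congr 1
      ring
    _ = _ := by
      rw [lintegral_const_mul' _ _ ENNReal.ofReal_ne_top,
        lintegral_beta_Ioi (sub_pos.2 hβ) (sub_pos.2 hα), ← ENNReal.ofReal_mul hΓ']

section InnerProductSpace

variable {V : Type*} [NormedAddCommGroup V] [InnerProductSpace ℝ V]

/-- Completing the square in a weighted sum of two squared distances. -/
lemma weighted_sq_norm_sub_add {s t : ℝ} (hst : s + t ≠ 0) (x w y : V) :
    s * ‖y - x‖ ^ 2 + t * ‖y - w‖ ^ 2 =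
      (s + t) * ‖y - (s + t)⁻¹ • (s • x + t • w)‖ ^ 2 + s * t / (s + t) * ‖x - w‖ ^ 2 := by
  simp only [← real_inner_self_eq_norm_sq, inner_sub_left, inner_sub_right, inner_add_left,
    inner_add_right, real_inner_smul_left, real_inner_smul_right, real_inner_comm y x,
    real_inner_comm y w, real_inner_comm x w]
  field_simp
  ring

variable [FiniteDimensional ℝ V] [MeasurableSpace V] [BorelSpace V]

/-- The integral of a product of two Gaussians with different centres. -/
lemma lintegral_exp_neg_mul_sq_norm_sub {s t : ℝ} (hs : 0 < s) (ht : 0 < t) (x w : V) :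
    ∫⁻ y : V, ENNReal.ofReal (exp (-(‖y - x‖ ^ 2 * s)) * exp (-(‖y - w‖ ^ 2 * t))) =
      ENNReal.ofReal ((π / (s + t)) ^ (Module.finrank ℝ V / 2 : ℝ) *
        exp (-(s * t / (s + t) * ‖x - w‖ ^ 2))) := by
  have hst : 0 < s + t := add_pos hs ht
  have key := GaussianFourier.integral_rexp_neg_mul_sq_norm (V := V) hst
  have h1 : ∀ y : V, exp (-(‖y - x‖ ^ 2 * s)) * exp (-(‖y - w‖ ^ 2 * t)) =
      exp (-(s * t / (s + t) * ‖x - w‖ ^ 2)) *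
        exp (-(s + t) * ‖y - (s + t)⁻¹ • (s • x + t • w)‖ ^ 2) := fun y => by
    rw [← exp_add, ← exp_add]
    congr 1
    linarith [weighted_sq_norm_sub_add hst.ne' x w y]
  simp only [h1, ENNReal.ofReal_mul (exp_pos _).le]
  rw [lintegral_const_mul' _ _ ENNReal.ofReal_ne_top,
    lintegral_sub_right_eq_self (fun y : V => ENNReal.ofReal (exp (-(s + t) * ‖y‖ ^ 2))),
    ← ofReal_integral_eq_lintegral_ofReal (.of_integral_ne_zero (by rw [key]; positivity))
      (ae_of_all _ fun y => (exp_pos _).le), key, ← ENNReal.ofReal_mul (exp_pos _).le, mul_comm]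

/-- Composition of Riesz kernels, with the exponents written as `-2α` and `-2β`. -/
lemma lintegral_riesz_kernel_mul [Nontrivial V] {α β m : ℝ} (hm_def : m = Module.finrank ℝ V / 2)
    (hα : α < m) (hβ : β < m) (hm : m < α + β) {x w : V} (hxw : x ≠ w) :
    ∫⁻ y : V, ENNReal.ofReal ((‖y - x‖ ^ 2) ^ (-α) * (‖y - w‖ ^ 2) ^ (-β)) =
      ENNReal.ofReal (π ^ m * (Gamma (α + β - m) * (‖x - w‖ ^ 2) ^ (-(α + β - m)) *
        (Gamma (m - β) * Gamma (m - α) / Gamma (m - β + (m - α)))) / (Gamma α * Gamma β)) := by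
  have hα0 : 0 < α := by linarith
  have hβ0 : 0 < β := by linarith
  have hΓα := Gamma_pos_of_pos hα0
  have hΓβ := Gamma_pos_of_pos hβ0
  have hΓ : 0 < Gamma α * Gamma β := by positivity
  have hr : 0 < ‖x - w‖ ^ 2 := by
    have := norm_pos_iff.2 (sub_ne_zero.2 hxw)
    positivity
  have key : ENNReal.ofReal (Gamma α * Gamma β) *
      ∫⁻ y : V, ENNReal.ofReal ((‖y - x‖ ^ 2) ^ (-α) * (‖y - w‖ ^ 2) ^ (-β)) =
      ENNReal.ofReal (π ^ m * (Gamma (α + β - m) * (‖x - w‖ ^ 2) ^ (-(α + β - m)) *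
        (Gamma (m - β) * Gamma (m - α) / Gamma (m - β + (m - α))))) := by
    calc
      _ = ∫⁻ y : V, ∫⁻ t in Set.Ioi (0 : ℝ), ∫⁻ s in Set.Ioi (0 : ℝ),
            ENNReal.ofReal (t ^ (β - 1) * exp (-(‖y - w‖ ^ 2 * t))) *
            ENNReal.ofReal (s ^ (α - 1) * exp (-(‖y - x‖ ^ 2 * s))) := by
        rw [← lintegral_const_mul' _ _ ENNReal.ofReal_ne_top]
        refine lintegral_congr_ae ?_
        filter_upwards [Measure.ae_ne volume x, Measure.ae_ne volume w] with y hyx hyw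
        have hx : 0 < ‖y - x‖ ^ 2 := by
          have := norm_pos_iff.2 (sub_ne_zero.2 hyx)
          positivity
        have hw : 0 < ‖y - w‖ ^ 2 := by
          have := norm_pos_iff.2 (sub_ne_zero.2 hyw)
          positivity
        simp only [lintegral_const_mul' _ _ ENNReal.ofReal_ne_top,
          lintegral_rpow_mul_exp_neg_mul hα0 hx, lintegral_mul_const' _ _ ENNReal.ofReal_ne_top,
          lintegral_rpow_mul_exp_neg_mul hβ0 hw]
        rw [← ENNReal.ofReal_mul hΓ.le, ← ENNReal.ofReal_mul (by positivity)]
        congr 1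
        ring
      _ = ∫⁻ t in Set.Ioi (0 : ℝ), ∫⁻ s in Set.Ioi (0 : ℝ), ∫⁻ y : V,
            ENNReal.ofReal (t ^ (β - 1) * exp (-(‖y - w‖ ^ 2 * t))) *
            ENNReal.ofReal (s ^ (α - 1) * exp (-(‖y - x‖ ^ 2 * s))) := by
        rw [lintegral_lintegral_swap]
        · refine lintegral_congr fun t => lintegral_lintegral_swap ?_
          unfold Function.uncurry
          fun_prop
        · simp only [lintegral_const_mul' _ _ ENNReal.ofReal_ne_top]
          unfold Function.uncurry
          refine AEMeasurable.mul (by fun_prop) (Measurable.aemeasurable ?_)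
          refine Measurable.comp
            (g := fun y : V => ∫⁻ s in Set.Ioi (0 : ℝ),
              ENNReal.ofReal (s ^ (α - 1) * exp (-(‖y - x‖ ^ 2 * s)))) ?_ measurable_fst
          refine Measurable.lintegral_prod_right ?_
          unfold Function.uncurry
          fun_prop
      _ = ∫⁻ t in Set.Ioi (0 : ℝ), ∫⁻ s in Set.Ioi (0 : ℝ), ENNReal.ofReal (π ^ m) *
            ENNReal.ofReal (s ^ (α - 1) * t ^ (β - 1) *
              ((s + t) ^ (-m) * exp (-(s * t / (s + t) * ‖x - w‖ ^ 2)))) := by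
        refine setLIntegral_congr_fun measurableSet_Ioi fun t (ht : 0 < t) => ?_
        refine setLIntegral_congr_fun measurableSet_Ioi fun s (hs : 0 < s) => ?_
        have hst : 0 < s + t := add_pos hs ht
        have h1 : ∀ y : V, ENNReal.ofReal (t ^ (β - 1) * exp (-(‖y - w‖ ^ 2 * t))) *
            ENNReal.ofReal (s ^ (α - 1) * exp (-(‖y - x‖ ^ 2 * s))) =
            ENNReal.ofReal (s ^ (α - 1) * t ^ (β - 1)) *
              ENNReal.ofReal (exp (-(‖y - x‖ ^ 2 * s)) * exp (-(‖y - w‖ ^ 2 * t))) := fun y => by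
          rw [← ENNReal.ofReal_mul (by positivity), ← ENNReal.ofReal_mul (by positivity)]
          congr 1
          ring
        simp only [h1]
        rw [lintegral_const_mul' _ _ ENNReal.ofReal_ne_top,
          lintegral_exp_neg_mul_sq_norm_sub hs ht, ← hm_def, ← ENNReal.ofReal_mul (by positivity),
          ← ENNReal.ofReal_mul (by positivity), div_rpow pi_pos.le hst.le, rpow_neg hst.le]
        congr 1
        ring
      _ = _ := by
        simp only [lintegral_const_mul' _ _ ENNReal.ofReal_ne_top]
        rw [lintegral_rpow_mul_exp_neg_harmonic hr hα hβ hm, ← ENNReal.ofReal_mul (by positivity)]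
  rw [ENNReal.ofReal_div_of_pos hΓ]
  exact (ENNReal.eq_div_iff (by simpa using hΓ) ENNReal.ofReal_ne_top).2 key

end InnerProductSpace

/-- **Composition of Riesz potentials (beta integral on `ℝ^n`).**
For `a, b > 0` with `a + b < n` and `x ≠ w`,
`∫ |y−x|^{−(n−a)} |y−w|^{−(n−b)} dy
  = π^{n/2} Γ(a/2)Γ(b/2)Γ((n−a−b)/2) / (Γ((n−a)/2)Γ((n−b)/2)Γ((a+b)/2)) · |x−w|^{−(n−a−b)}`. -/
theorem stmt3 (n : ℕ) (hn : 1 ≤ n) (a b : ℝ) (ha : 0 < a) (hb : 0 < b)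
    (hab : a + b < n) (x w : EuclideanSpace ℝ (Fin n)) (hxw : x ≠ w) :
    (∫ y : EuclideanSpace ℝ (Fin n), ‖y - x‖ ^ (a - n) * ‖y - w‖ ^ (b - n)) =
      Real.pi ^ ((n : ℝ) / 2) *
        (Real.Gamma (a / 2) * Real.Gamma (b / 2) * Real.Gamma (((n : ℝ) - a - b) / 2) /
          (Real.Gamma (((n : ℝ) - a) / 2) * Real.Gamma (((n : ℝ) - b) / 2) *
            Real.Gamma ((a + b) / 2))) *
        ‖x - w‖ ^ (a + b - n) := by
  have : NeZero n := ⟨by omega⟩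
  have hrw : ∀ (u : EuclideanSpace ℝ (Fin n)) (c : ℝ), ‖u‖ ^ c = (‖u‖ ^ 2) ^ (c / 2) := fun u c => by
    rw [← rpow_natCast, ← rpow_mul (norm_nonneg u)]
    congr 1
    push_cast
    ring
  have key := lintegral_riesz_kernel_mul (V := EuclideanSpace ℝ (Fin n)) (m := (n : ℝ) / 2)
    (α := ((n : ℝ) - a) / 2) (β := ((n : ℝ) - b) / 2) (by simp) (by linarith) (by linarith)
    (by linarith) hxw
  rw [show ((n : ℝ) - a) / 2 + (n - b) / 2 - n / 2 = (n - a - b) / 2 by ring,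
    show (n : ℝ) / 2 - (n - b) / 2 = b / 2 by ring,
    show (n : ℝ) / 2 - (n - a) / 2 = a / 2 by ring,
    show -(((n : ℝ) - a) / 2) = (a - n) / 2 by ring,
    show -(((n : ℝ) - b) / 2) = (b - n) / 2 by ring,
    show -(((n : ℝ) - a - b) / 2) = (a + b - n) / 2 by ring,
    show b / 2 + a / 2 = (a + b) / 2 by ring] at key
  simp only [hrw]
  rw [integral_eq_lintegral_of_nonneg_ae (ae_of_all _ fun y => by positivity)
    (by fun_prop), key, ENNReal.toReal_ofReal]
  · ring
  · have h1 := Gamma_pos_of_pos (show 0 < ((n : ℝ) - a - b) / 2 by linarith)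
    have h2 := Gamma_pos_of_pos (show 0 < ((n : ℝ) - a) / 2 by linarith)
    have h3 := Gamma_pos_of_pos (show 0 < ((n : ℝ) - b) / 2 by linarith)
    positivity
end
end
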